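/- Let Y₁ have the conditional density p_{aₙ} of X₁ given Sₙ = n·aₙ, and set Rₙ := p_{aₙ}(Y₁)/π^{aₙ}(Y₁) − 1. Under the growth condition ψ(tₙ)²/√(n·ψ′(tₙ)) → 0 as n → ∞, where tₙ := m⁻¹(aₙ), for every δ > 0 the probability (under the conditional law) that |Rₙ| > δ/√n tends to 0 as n → ∞; that is, Rₙ = o(1/√n) in probability under the conditional distribution. -/

import Mathlib

open Real Filter Topology MeasureTheory Set

noncomputable section

/-- A representation of a function `l` in class `R₀`:
`l x = exp (∫_1^x ε u / u du)` for `x ≥ 1`, where `ε` is twice differentiable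
(with first and second derivatives `ε'`, `ε''`) and `ε x → 0` as `x → ∞`. -/
def IsR0Rep (l ε ε' ε'' : ℝ → ℝ) : Prop :=
  (∀ x, HasDerivAt ε (ε' x) x) ∧ (∀ x, HasDerivAt ε' (ε'' x) x) ∧
    Tendsto ε atTop (𝓝 0) ∧
    ∀ x ≥ (1 : ℝ), l x = Real.exp (∫ u in (1:ℝ)..x, ε u / u)

/-- The generalized inverse `ψ u = inf {x | h x ≥ u}` of `h`. -/
def geninv (h : ℝ → ℝ) (u : ℝ) : ℝ := sInf {x : ℝ | u ≤ h x}

/-- Class `R_β` (`β > 0`): `h x = x ^ β * l x` for large `x`, with `l ∈ R₀` whose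
representing `ε` satisfies `limsup x * |ε' x| < ∞` and `limsup x ^ 2 * |ε'' x| < ∞`. -/
def MemRbeta (h : ℝ → ℝ) (β : ℝ) : Prop :=
  0 < β ∧ ∃ l ε ε' ε'' : ℝ → ℝ, IsR0Rep l ε ε' ε'' ∧
    (∀ᶠ x in atTop, h x = x ^ β * l x) ∧
    (∃ C : ℝ, ∀ᶠ x in atTop, x * |ε' x| ≤ C) ∧
    (∃ C : ℝ, ∀ᶠ x in atTop, x ^ (2 : ℕ) * |ε'' x| ≤ C)

/-- Class `R_∞`: `h` is increasing and strictly monotone and its generalized inverse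
`ψ` satisfies `ψ x = exp (∫_1^x ε u / u du)` with `ψ x → ∞`, `x ε' x / ε x → 0`,
`x ^ 2 ε'' x / ε x → 0` and `liminf x ^ η * ε x > 0` for some `η ∈ (0, 1/4)`. -/
def MemRinfty (h : ℝ → ℝ) : Prop :=
  StrictMonoOn h (Set.Ici 0) ∧
  ∃ ε ε' ε'' : ℝ → ℝ,
    (∀ x, HasDerivAt ε (ε' x) x) ∧ (∀ x, HasDerivAt ε' (ε'' x) x) ∧
    (∀ x ≥ (1 : ℝ), geninv h x = Real.exp (∫ u in (1:ℝ)..x, ε u / u)) ∧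
    Tendsto (geninv h) atTop atTop ∧
    Tendsto (fun x => x * ε' x / ε x) atTop (𝓝 0) ∧
    Tendsto (fun x => x ^ (2 : ℕ) * ε'' x / ε x) atTop (𝓝 0) ∧
    ∃ η : ℝ, η ∈ Set.Ioo (0 : ℝ) (1/4) ∧ ∃ c > (0 : ℝ), ∀ᶠ x in atTop, c ≤ x ^ η * ε x

/-- The class `𝔯 = R_β ∪ R_∞`. -/
def MemFrakR (h : ℝ → ℝ) : Prop := (∃ β : ℝ, MemRbeta h β) ∨ MemRinfty h

/-- The moment generating function `Φ t = ∫_0^∞ e^{t x} p x dx`. -/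
def mgfFun (p : ℝ → ℝ) (t : ℝ) : ℝ := ∫ x in Set.Ici (0:ℝ), Real.exp (t * x) * p x

/-- `m = (log Φ)'`, the mean of the tilted density. -/
def mFun (p : ℝ → ℝ) : ℝ → ℝ := deriv fun t => Real.log (mgfFun p t)

/-- `s² = m'`, the variance of the tilted density. -/
def s2Fun (p : ℝ → ℝ) : ℝ → ℝ := deriv (mFun p)

/-- `μ₃ = (log Φ)'''`, the third centered moment of the tilted density. -/
def mu3Fun (p : ℝ → ℝ) : ℝ → ℝ := deriv (s2Fun p)

/-- The tilted density `π^a x = e^{t x} p x / Φ t` (with `t` the tilting parameter). -/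
def tilt (p : ℝ → ℝ) (t x : ℝ) : ℝ := Real.exp (t * x) * p x / mgfFun p t

/-- `convPow f n` is the `n`-fold convolution of the density `f` with itself. -/
def convPow (f : ℝ → ℝ) : ℕ → ℝ → ℝ
  | 0 => fun _ => 0
  | 1 => f
  | n + 2 => fun x => ∫ y : ℝ, f y * convPow f (n + 1) (x - y)

/-- The conditional density of `X₁` given `Sₙ = n aₙ`:
`p_{aₙ}(y) = p y · p^{*(n-1)}(n aₙ - y) / p^{*n}(n aₙ)`. -/
def condDensity (p : ℝ → ℝ) (a : ℕ → ℝ) (n : ℕ) (y : ℝ) : ℝ :=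
  p y * convPow p (n - 1) ((n : ℝ) * a n - y) / convPow p n ((n : ℝ) * a n)

/-- Convolution of two real functions on the line. -/
def realConv (f g : ℝ → ℝ) (x : ℝ) : ℝ := ∫ y : ℝ, f y * g (x - y)

/-- The characteristic function `u ↦ ∫ e^{iux} f x dx` of an integrable function `f`. -/
def cf (f : ℝ → ℝ) (u : ℝ) : ℂ := ∫ x : ℝ, Complex.exp (Complex.I * ((u * x : ℝ) : ℂ)) * (f x : ℂ)

open scoped FourierTransform Convolution in
lemma fourier_ofReal_eq_cf (f : ℝ → ℝ) (w : ℝ) :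
    𝓕 (fun x => (f x : ℂ)) w = cf f (-(2 * π * w)) := by
  rw [Real.fourier_real_eq_integral_exp_smul, cf]
  refine integral_congr_ae (Eventually.of_forall fun x => ?_)
  simp only [smul_eq_mul]
  congr 2
  push_cast
  ring

lemma cf_eq_fourier (f : ℝ → ℝ) (u : ℝ) :
    cf f u = FourierTransform.fourier (fun x => (f x : ℂ)) (-(u / (2 * π))) := by
  rw [fourier_ofReal_eq_cf]
  congr 1
  field_simp

lemma integrable_cf_integrand {f : ℝ → ℝ} (hf : Integrable f) (u : ℝ) :
    Integrable fun x : ℝ => Complex.exp (Complex.I * ((u * x : ℝ) : ℂ)) * (f x : ℂ) := by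
  refine hf.ofReal.bdd_mul (c := 1) (Continuous.aestronglyMeasurable (by fun_prop)) ?_
  refine Eventually.of_forall fun x => ?_
  rw [Complex.norm_exp_I_mul_ofReal]

lemma norm_cf_le {f : ℝ → ℝ} (hf0 : ∀ x, 0 ≤ f x) (u : ℝ) : ‖cf f u‖ ≤ ∫ x, f x := by
  refine (norm_integral_le_integral_norm _).trans (le_of_eq ?_)
  refine integral_congr_ae (Eventually.of_forall fun x => ?_)
  simp only [norm_mul, Complex.norm_exp_I_mul_ofReal, Complex.norm_real, one_mul,
    Real.norm_eq_abs, abs_of_nonneg (hf0 x)]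

lemma cf_add {f g : ℝ → ℝ} (hf : Integrable f) (hg : Integrable g) (u : ℝ) :
    cf (fun x => f x + g x) u = cf f u + cf g u := by
  unfold cf
  rw [← integral_add (integrable_cf_integrand hf u) (integrable_cf_integrand hg u)]
  refine integral_congr_ae (Eventually.of_forall fun x => ?_)
  simp only
  push_cast
  ring

lemma continuous_cf {f : ℝ → ℝ} (hf : Integrable f) : Continuous (cf f) := by
  refine continuous_of_dominated (bound := fun x => ‖f x‖) ?_ ?_ hf.norm ?_
  · intro u
    exact (integrable_cf_integrand hf u).1
  · intro u
    refine Eventually.of_forall fun x => ?_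
    rw [norm_mul, Complex.norm_exp_I_mul_ofReal, one_mul, Complex.norm_real]
  · refine Eventually.of_forall fun x => ?_
    fun_prop

lemma integrable_realConv {f g : ℝ → ℝ} (hf : Integrable f) (hg : Integrable g) :
    Integrable (realConv f g) :=
  hf.integrable_convolution (ContinuousLinearMap.mul ℝ ℝ) hg

lemma integral_realConv {f g : ℝ → ℝ} (hf : Integrable f) (hg : Integrable g) :
    ∫ x, realConv f g x = (∫ x, f x) * ∫ x, g x :=
  integral_convolution (ContinuousLinearMap.mul ℝ ℝ) hf hg

lemma cf_realConv {f g : ℝ → ℝ} (hf : Integrable f) (hg : Integrable g) (u : ℝ) :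
    cf (realConv f g) u = cf f u * cf g u := by
  have h := Real.fourier_mul_convolution_eq (f₁ := fun x => (f x : ℂ)) (f₂ := fun x => (g x : ℂ))
    hf.ofReal hg.ofReal (-(u / (2 * π)))
  rw [cf_eq_fourier, cf_eq_fourier, cf_eq_fourier, ← h]
  refine congrArg (fun F : ℝ → ℂ => FourierTransform.fourier F _) (funext fun x => ?_)
  rw [realConv, ← integral_complex_ofReal]
  simp only [convolution_def, ContinuousLinearMap.mul_apply', Complex.ofReal_mul]

lemma continuous_integrable_inversion {P : ℝ → ℝ} (hP : Integrable P) (hc : Continuous P)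
    (hcf : Integrable (cf P)) (x : ℝ) :
    ((2 * π * P x : ℝ) : ℂ) =
      ∫ u : ℝ, Complex.exp (-(Complex.I * ((u * x : ℝ) : ℂ))) * cf P u := by
  have h1 : FourierTransform.fourier (fun x => (P x : ℂ)) = fun w => cf P (-(2 * π) * w) := by
    funext w
    rw [fourier_ofReal_eq_cf]
    congr 1
    ring
  have h2 : Integrable (FourierTransform.fourier (fun x => (P x : ℂ))) := by
    rw [h1]
    exact hcf.comp_mul_left' (by simp [Real.pi_ne_zero])
  have h3 := hP.ofReal.fourierInv_fourier_eq h2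
    (v := x) (Complex.continuous_ofReal.comp hc).continuousAt
  rw [Real.fourierInv_eq', h1] at h3
  simp only [smul_eq_mul] at h3
  have h4 := Measure.integral_comp_mul_left (fun u : ℝ =>
    Complex.exp (-(Complex.I * ((u * x : ℝ) : ℂ))) * cf P u) (-(2 * π))
  have h5 : |(-(2 * π))⁻¹| = (2 * π)⁻¹ := by
    rw [abs_inv, abs_neg, abs_of_pos (by positivity)]
  rw [h5] at h4
  have h6 : ∫ v : ℝ, Complex.exp (↑(2 * π * inner ℝ v x) * Complex.I) * cf P (-(2 * π) * v)
      = ∫ v : ℝ, Complex.exp (-(Complex.I * ((-(2 * π) * v * x : ℝ) : ℂ))) *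
        cf P (-(2 * π) * v) := by
    refine integral_congr_ae (Eventually.of_forall fun v => ?_)
    simp only
    congr 2
    simp
    ring
  rw [h6, h4] at h3
  have h7 : (2 * (π : ℂ)) * (2 * (π : ℂ))⁻¹ = 1 :=
    mul_inv_cancel₀ (by simp [Real.pi_ne_zero])
  rw [Complex.real_smul] at h3
  push_cast at h3 ⊢
  rw [← h3, ← mul_assoc, h7, one_mul]

lemma cf_comp_neg (f : ℝ → ℝ) (u : ℝ) : cf (fun x => f (-x)) u = (starRingEnd ℂ) (cf f u) := by
  unfold cf
  rw [← integral_conj, ← integral_neg_eq_self]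
  refine integral_congr_ae (Eventually.of_forall fun x => ?_)
  simp [← Complex.exp_conj]

lemma realConv_nonneg {f g : ℝ → ℝ} (hf : ∀ x, 0 ≤ f x) (hg : ∀ x, 0 ≤ g x) (x : ℝ) :
    0 ≤ realConv f g x :=
  integral_nonneg fun _ => mul_nonneg (hf _) (hg _)

lemma integrable_realConv_integrand {f g : ℝ → ℝ} {M : ℝ} (hf : AEStronglyMeasurable f)
    (hf0 : ∀ x, 0 ≤ f x) (hfM : ∀ x, f x ≤ M) (hg : Integrable g) (x : ℝ) :
    Integrable fun y => f y * g (x - y) := by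
  refine (hg.comp_sub_left x).bdd_mul (c := M) hf ?_
  refine Eventually.of_forall fun y => ?_
  rw [Real.norm_eq_abs, abs_of_nonneg (hf0 y)]
  exact hfM y

lemma realConv_le {f g : ℝ → ℝ} {M : ℝ} (hf : AEStronglyMeasurable f)
    (hf0 : ∀ x, 0 ≤ f x) (hfM : ∀ x, f x ≤ M) (hg : Integrable g) (hg0 : ∀ x, 0 ≤ g x) (x : ℝ) :
    realConv f g x ≤ M * ∫ y, g y := by
  rw [← integral_sub_left_eq_self g volume x, ← integral_const_mul]
  refine integral_mono (integrable_realConv_integrand hf hf0 hfM hg x)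
    ((hg.comp_sub_left x).const_mul M) fun y => ?_
  exact mul_le_mul_of_nonneg_right (hfM y) (hg0 _)

lemma realConv_comm (f g : ℝ → ℝ) (x : ℝ) : realConv f g x = realConv g f x := by
  unfold realConv
  rw [← integral_sub_left_eq_self _ volume x]
  refine integral_congr_ae (Eventually.of_forall fun y => ?_)
  simp only [sub_sub_cancel]
  ring

lemma continuous_realConv {f g : ℝ → ℝ} {M : ℝ} (hf : Integrable f)
    (hf0 : ∀ x, 0 ≤ f x) (hfM : ∀ x, f x ≤ M) (hg : Integrable g) :
    Continuous (realConv f g) := by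
  have hM : 0 ≤ M := (hf0 0).trans (hfM 0)
  refine continuous_of_uniform_approx_of_continuous fun s hs => ?_
  obtain ⟨ε, hε, hεs⟩ := Metric.mem_uniformity_dist.1 hs
  obtain ⟨k, hkc, hk, hkcont, hki⟩ :=
    hg.exists_hasCompactSupport_integral_sub_le (ε := ε / (2 * (M + 1))) (by positivity)
  refine ⟨realConv f k, ?_, fun x => hεs ?_⟩
  · exact hkc.continuous_convolution_right (ContinuousLinearMap.mul ℝ ℝ)
      hf.locallyIntegrable hkcont
  · have h1 := integrable_realConv_integrand hf.1 hf0 hfM hg x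
    have h2 := integrable_realConv_integrand hf.1 hf0 hfM hki x
    rw [Real.dist_eq, realConv, realConv, ← integral_sub h1 h2]
    have h3 : ∀ y, f y * g (x - y) - f y * k (x - y) = f y * (g (x - y) - k (x - y)) :=
      fun y => by ring
    simp_rw [h3]
    have h4 : |∫ y, f y * (g (x - y) - k (x - y))| ≤ M * ∫ y, ‖g y - k y‖ := by
      rw [← integral_sub_left_eq_self (fun y => ‖g y - k y‖) volume x, ← integral_const_mul]
      refine (abs_integral_le_integral_abs).trans ?_
      have h5 : Integrable fun y => g (x - y) - k (x - y) :=
        (hg.comp_sub_left x).sub (hki.comp_sub_left x)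
      refine integral_mono_of_nonneg (Eventually.of_forall fun _ => abs_nonneg _)
        (h5.norm.const_mul M) (Eventually.of_forall fun y => ?_)
      simp only [abs_mul, Real.norm_eq_abs, abs_of_nonneg (hf0 y)]
      exact mul_le_mul_of_nonneg_right (hfM y) (abs_nonneg _)
    calc _ ≤ M * ∫ y, ‖g y - k y‖ := h4
      _ ≤ M * (ε / (2 * (M + 1))) := by gcongr
      _ = ε * (M / (2 * (M + 1))) := by ring
      _ < ε * 1 := by
          gcongr
          rw [div_lt_one (by positivity)]
          linarith
      _ = ε := mul_one _

/-- Gaussian averages of the Fourier transform of a bounded nonnegative function. -/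
lemma norm_integral_cf_mul_gaussian_le {F : ℝ → ℝ} {K : ℝ} (hF : Integrable F)
    (hF0 : ∀ x, 0 ≤ F x) (hFK : ∀ x, F x ≤ K) {b : ℝ} (hb : 0 < b) :
    ‖∫ u : ℝ, cf F u * Complex.exp (-(b : ℂ) * (u : ℂ) ^ 2)‖ ≤ 2 * π * K := by
  have hK : 0 ≤ K := (hF0 0).trans (hFK 0)
  have hg : Integrable fun u : ℝ => Complex.exp (-(b : ℂ) * (u : ℂ) ^ 2) :=
    integrable_cexp_neg_mul_sq (by simpa using hb)
  have hprod : Integrable (Function.uncurry fun u x : ℝ =>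
      Complex.exp (Complex.I * ((u * x : ℝ) : ℂ)) * (F x : ℂ) *
        Complex.exp (-(b : ℂ) * (u : ℂ) ^ 2)) (volume.prod volume) := by
    have h1 := hg.mul_prod (hF.ofReal (𝕜 := ℂ))
    have h2 : Integrable (fun z : ℝ × ℝ => Complex.exp (Complex.I * ((z.1 * z.2 : ℝ) : ℂ)) *
        (Complex.exp (-(b : ℂ) * (z.1 : ℂ) ^ 2) * (F z.2 : ℂ))) (volume.prod volume) := by
      refine h1.bdd_mul (c := 1) (Continuous.aestronglyMeasurable (by fun_prop)) ?_
      refine Eventually.of_forall fun z => ?_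
      rw [Complex.norm_exp_I_mul_ofReal]
    refine h2.congr (Eventually.of_forall fun z => ?_)
    simp only [Function.uncurry]
    ring
  have h3 : ∫ u : ℝ, cf F u * Complex.exp (-(b : ℂ) * (u : ℂ) ^ 2) =
      ∫ x : ℝ, (F x : ℂ) * (((π : ℂ) / b) ^ (1 / 2 : ℂ) *
        Complex.exp (-(x : ℂ) ^ 2 / (4 * b))) := by
    simp_rw [cf, ← integral_mul_const]
    rw [integral_integral_swap hprod]
    refine integral_congr_ae (Eventually.of_forall fun x => ?_)
    simp only
    rw [← fourierIntegral_gaussian (by simpa using hb), ← integral_const_mul]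
    refine integral_congr_ae (Eventually.of_forall fun u => ?_)
    simp only
    push_cast
    rw [mul_comm (u : ℂ) (x : ℂ)]
    simp only [mul_assoc]
    ring
  have h4 : ∀ x : ℝ, ‖(F x : ℂ) * (((π : ℂ) / b) ^ (1 / 2 : ℂ) *
        Complex.exp (-(x : ℂ) ^ 2 / (4 * b)))‖ =
      F x * (√(π / b) * Real.exp (-(1 / (4 * b)) * x ^ 2)) := by
    intro x
    have e1 : ((π : ℂ) / b) ^ (1 / 2 : ℂ) = ((√(π / b) : ℝ) : ℂ) := by
      rw [Real.sqrt_eq_rpow, Complex.ofReal_cpow (by positivity)]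
      push_cast
      rfl
    have e2 : Complex.exp (-(x : ℂ) ^ 2 / (4 * b)) =
        ((Real.exp (-(1 / (4 * b)) * x ^ 2) : ℝ) : ℂ) := by
      push_cast
      congr 1
      ring
    rw [e1, e2, ← Complex.ofReal_mul, ← Complex.ofReal_mul, Complex.norm_real, Real.norm_eq_abs,
      abs_of_nonneg]
    exact mul_nonneg (hF0 x) (by positivity)
  rw [h3]
  refine (norm_integral_le_integral_norm _).trans ?_
  simp_rw [h4]
  have hgi : Integrable fun x : ℝ => Real.exp (-(1 / (4 * b)) * x ^ 2) :=
    integrable_exp_neg_mul_sq (by positivity)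
  have h5 : ∫ x, F x * (√(π / b) * Real.exp (-(1 / (4 * b)) * x ^ 2)) ≤
      ∫ x, K * (√(π / b) * Real.exp (-(1 / (4 * b)) * x ^ 2)) := by
    refine integral_mono_of_nonneg (Eventually.of_forall fun x => ?_)
      ((hgi.const_mul _).const_mul _) (Eventually.of_forall fun x => ?_)
    · exact mul_nonneg (hF0 x) (by positivity)
    · exact mul_le_mul_of_nonneg_right (hFK x) (by positivity)
  refine h5.trans (le_of_eq ?_)
  rw [integral_const_mul, integral_const_mul, integral_gaussian, ← Real.sqrt_mul (by positivity)]
  have : π / b * (π / (1 / (4 * b))) = (2 * π) ^ 2 := by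
    field_simp
    norm_num
  rw [this, Real.sqrt_sq (by positivity)]
  ring

lemma cf_autocorrelation {f : ℝ → ℝ} (hf : Integrable f) (u : ℝ) :
    cf (realConv f fun x => f (-x)) u = ((‖cf f u‖ ^ 2 : ℝ) : ℂ) := by
  rw [cf_realConv hf hf.comp_neg, cf_comp_neg, Complex.mul_conj, Complex.normSq_eq_norm_sq]

/-- A bounded integrable nonnegative function has a square integrable Fourier transform. -/
lemma integrable_norm_cf_sq {f : ℝ → ℝ} {M : ℝ} (hf : Integrable f) (hf0 : ∀ x, 0 ≤ f x)
    (hfM : ∀ x, f x ≤ M) (hf1 : ∫ x, f x ≤ 1) :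
    Integrable (fun u => ‖cf f u‖ ^ 2) ∧
      ∫ u, ‖cf f u‖ ^ 2 ≤ Real.exp 1 * (2 * π * M) := by
  have hM : 0 ≤ M := (hf0 0).trans (hfM 0)
  have hcont : Continuous fun u => ‖cf f u‖ ^ 2 := (continuous_cf hf).norm.pow 2
  have hR : ∀ R : ℝ, 0 < R → ∫ u in (-R)..R, ‖cf f u‖ ^ 2 ≤ Real.exp 1 * (2 * π * M) := by
    intro R hRpos
    set b : ℝ := 1 / R ^ 2 with hb
    have hbpos : 0 < b := by positivity
    have hbnd : ∀ u, ‖cf f u‖ ^ 2 ≤ 1 := fun u =>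
      pow_le_one₀ (norm_nonneg _) ((norm_cf_le hf0 u).trans hf1)
    have hgi : Integrable fun u : ℝ => Real.exp (-b * u ^ 2) := integrable_exp_neg_mul_sq hbpos
    have hinteg : Integrable fun u => ‖cf f u‖ ^ 2 * Real.exp (-b * u ^ 2) := by
      refine hgi.bdd_mul (c := 1) hcont.aestronglyMeasurable (Eventually.of_forall fun u => ?_)
      rw [Real.norm_eq_abs, abs_of_nonneg (by positivity)]
      exact hbnd u
    have h1 : ∫ u, ‖cf f u‖ ^ 2 * Real.exp (-b * u ^ 2) ≤ 2 * π * M := by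
      have h2 := norm_integral_cf_mul_gaussian_le (F := realConv f fun x => f (-x)) (K := M)
        (integrable_realConv hf hf.comp_neg) (realConv_nonneg hf0 fun x => hf0 _)
        (fun x => by
          refine (realConv_le hf.1 hf0 hfM hf.comp_neg (fun x => hf0 _) x).trans ?_
          rw [integral_neg_eq_self f]
          exact mul_le_of_le_one_right hM hf1) hbpos
      have h3 : ∫ u : ℝ, cf (realConv f fun x => f (-x)) u *
          Complex.exp (-(b : ℂ) * (u : ℂ) ^ 2) =
          ((∫ u, ‖cf f u‖ ^ 2 * Real.exp (-b * u ^ 2) : ℝ) : ℂ) := by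
        rw [← integral_complex_ofReal]
        refine integral_congr_ae (Eventually.of_forall fun u => ?_)
        simp only
        rw [cf_autocorrelation hf]
        push_cast
        rfl
      rw [h3, Complex.norm_real, Real.norm_eq_abs] at h2
      exact (le_abs_self _).trans h2
    rw [intervalIntegral.integral_of_le (by linarith)]
    have h4 : ∫ u in Ioc (-R) R, ‖cf f u‖ ^ 2 ≤
        ∫ u in Ioc (-R) R, Real.exp 1 * (‖cf f u‖ ^ 2 * Real.exp (-b * u ^ 2)) := by
      refine setIntegral_mono_on (hcont.integrableOn_Ioc) (hinteg.const_mul _).integrableOn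
        measurableSet_Ioc fun u hu => ?_
      have h5 : 1 ≤ Real.exp 1 * Real.exp (-b * u ^ 2) := by
        rw [← Real.exp_add]
        refine Real.one_le_exp ?_
        have : u ^ 2 ≤ R ^ 2 := sq_le_sq' hu.1.le hu.2
        rw [hb, neg_mul, one_div, inv_mul_eq_div]
        have := div_le_one_of_le₀ this (by positivity)
        linarith
      nlinarith [sq_nonneg ‖cf f u‖]
    refine h4.trans ?_
    rw [integral_const_mul]
    refine mul_le_mul_of_nonneg_left (le_trans ?_ h1) (by positivity)
    exact setIntegral_le_integral hinteg (Eventually.of_forall fun u => by positivity)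
  have hinteg : Integrable (fun u => ‖cf f u‖ ^ 2) := by
    refine integrable_of_intervalIntegral_norm_bounded (Real.exp 1 * (2 * π * M))
      (a := fun n : ℕ => -((n : ℝ) + 1)) (b := fun n : ℕ => (n : ℝ) + 1) (l := atTop)
      (fun n => hcont.integrableOn_Ioc) ?_ ?_ (Eventually.of_forall fun n => ?_)
    · exact tendsto_neg_atTop_atBot.comp
        (tendsto_atTop_add_const_right _ _ tendsto_natCast_atTop_atTop)
    · exact tendsto_atTop_add_const_right _ _ tendsto_natCast_atTop_atTop
    · have := hR (n + 1) (by positivity)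
      simpa using this
  refine ⟨hinteg, ?_⟩
  have ht := intervalIntegral_tendsto_integral hinteg
    (a := fun n : ℕ => -((n : ℝ) + 1)) (b := fun n : ℕ => (n : ℝ) + 1) (l := atTop)
    (tendsto_neg_atTop_atBot.comp
        (tendsto_atTop_add_const_right _ _ tendsto_natCast_atTop_atTop))
    (tendsto_atTop_add_const_right _ _ tendsto_natCast_atTop_atTop)
  exact le_of_tendsto ht (Eventually.of_forall fun n => hR (n + 1) (by positivity))

lemma integrable_realConv_integrand_right {f g : ℝ → ℝ} {M : ℝ} (hf : AEStronglyMeasurable f)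
    (hf0 : ∀ x, 0 ≤ f x) (hfM : ∀ x, f x ≤ M) (hg : Integrable g) (x : ℝ) :
    Integrable fun y => g y * f (x - y) := by
  have h := (integrable_realConv_integrand hf hf0 hfM hg x).comp_sub_left x
  refine h.congr (Eventually.of_forall fun y => ?_)
  simp only [sub_sub_cancel]
  ring

/-- The convolution powers of `f₁` (shifted by one). -/
def singPart (f₁ : ℝ → ℝ) : ℕ → ℝ → ℝ
  | 0 => f₁
  | j + 1 => realConv f₁ (singPart f₁ j)

/-- The terms in the convolution power of `f₁ + f₂` with exactly one factor `f₂`. -/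
def mixPart (f₁ f₂ : ℝ → ℝ) : ℕ → ℝ → ℝ
  | 0 => f₂
  | j + 1 => fun x => realConv f₁ (mixPart f₁ f₂ j) x + realConv f₂ (singPart f₁ j) x

/-- The terms in the convolution power of `f₁ + f₂` with at least two factors `f₂`. -/
def regPart (f₁ f₂ : ℝ → ℝ) : ℕ → ℝ → ℝ
  | 0 => fun _ => 0
  | j + 1 => fun x =>
      realConv (fun y => f₁ y + f₂ y) (regPart f₁ f₂ j) x + realConv f₂ (mixPart f₁ f₂ j) x

section Decomposition

variable {f₁ f₂ : ℝ → ℝ} {M b : ℝ}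

lemma singPart_nonneg (h₁ : ∀ x, 0 ≤ f₁ x) (j : ℕ) (x : ℝ) : 0 ≤ singPart f₁ j x := by
  induction j generalizing x with
  | zero => exact h₁ x
  | succ j ih => exact realConv_nonneg h₁ ih x

lemma integrable_singPart (hi₁ : Integrable f₁) (j : ℕ) : Integrable (singPart f₁ j) := by
  induction j with
  | zero => exact hi₁
  | succ j ih => exact integrable_realConv hi₁ ih

lemma integral_singPart (hi₁ : Integrable f₁) (j : ℕ) :
    ∫ x, singPart f₁ j x = (∫ x, f₁ x) ^ (j + 1) := by
  induction j with
  | zero => simp [singPart]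
  | succ j ih =>
    rw [singPart, integral_realConv hi₁ (integrable_singPart hi₁ j), ih]
    ring

lemma cf_singPart (hi₁ : Integrable f₁) (j : ℕ) (u : ℝ) :
    cf (singPart f₁ j) u = cf f₁ u ^ (j + 1) := by
  induction j with
  | zero => simp [singPart]
  | succ j ih =>
    rw [singPart, cf_realConv hi₁ (integrable_singPart hi₁ j), ih]
    ring

lemma realConv_integrand_eq_zero (hb : ∀ x, b < x → f₁ x = 0) {g : ℝ → ℝ} {b' : ℝ}
    (hb' : ∀ x, b' < x → g x = 0) {x : ℝ} (hx : b + b' < x) (y : ℝ) :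
    f₁ y * g (x - y) = 0 := by
  rcases lt_or_ge b y with h | h
  · rw [hb y h, zero_mul]
  · rw [hb' (x - y) (by linarith), mul_zero]

lemma singPart_eq_zero (hb : ∀ x, b < x → f₁ x = 0) (j : ℕ) {x : ℝ}
    (hx : (j + 1) * b < x) : singPart f₁ j x = 0 := by
  induction j generalizing x with
  | zero => exact hb x (by simpa using hx)
  | succ j ih =>
    push_cast at hx
    have h := realConv_integrand_eq_zero hb (g := singPart f₁ j) (b' := (j + 1) * b)
      (fun x hx => ih hx) (x := x) (by linarith)
    simp [singPart, realConv, h]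

lemma mixPart_nonneg (h₁ : ∀ x, 0 ≤ f₁ x) (h₂ : ∀ x, 0 ≤ f₂ x) (j : ℕ) (x : ℝ) :
    0 ≤ mixPart f₁ f₂ j x := by
  induction j generalizing x with
  | zero => exact h₂ x
  | succ j ih =>
    exact add_nonneg (realConv_nonneg h₁ ih x) (realConv_nonneg h₂ (singPart_nonneg h₁ j) x)

lemma integrable_mixPart (hi₁ : Integrable f₁) (hi₂ : Integrable f₂) (j : ℕ) :
    Integrable (mixPart f₁ f₂ j) := by
  induction j with
  | zero => exact hi₂
  | succ j ih =>
    exact (integrable_realConv hi₁ ih).add (integrable_realConv hi₂ (integrable_singPart hi₁ j))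

lemma mixPart_le (h₁ : ∀ x, 0 ≤ f₁ x) (h₂ : ∀ x, 0 ≤ f₂ x) (hi₁ : Integrable f₁)
    (hi₂ : Integrable f₂) (hM : ∀ x, f₂ x ≤ M) (j : ℕ) (x : ℝ) :
    mixPart f₁ f₂ j x ≤ (j + 1) * M * (∫ y, f₁ y) ^ j := by
  induction j generalizing x with
  | zero => simpa [mixPart] using hM x
  | succ j ih =>
    have e1 := realConv_le (integrable_mixPart hi₁ hi₂ j).1 (mixPart_nonneg h₁ h₂ j) ih hi₁ h₁ x
    have e2 := realConv_le hi₂.1 h₂ hM (integrable_singPart hi₁ j) (singPart_nonneg h₁ j) x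
    rw [integral_singPart hi₁] at e2
    rw [realConv_comm] at e1
    simp only [mixPart]
    refine (add_le_add e1 e2).trans (le_of_eq ?_)
    push_cast
    ring

lemma cf_mixPart (hi₁ : Integrable f₁) (hi₂ : Integrable f₂) (j : ℕ) (u : ℝ) :
    cf (mixPart f₁ f₂ j) u = (j + 1) * cf f₂ u * cf f₁ u ^ j := by
  induction j with
  | zero => simp [mixPart]
  | succ j ih =>
    rw [mixPart, cf_add (integrable_realConv hi₁ (integrable_mixPart hi₁ hi₂ j))
      (integrable_realConv hi₂ (integrable_singPart hi₁ j)),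
      cf_realConv hi₁ (integrable_mixPart hi₁ hi₂ j), cf_realConv hi₂ (integrable_singPart hi₁ j),
      ih, cf_singPart hi₁]
    push_cast
    ring

lemma regPart_nonneg (h₁ : ∀ x, 0 ≤ f₁ x) (h₂ : ∀ x, 0 ≤ f₂ x) (j : ℕ) (x : ℝ) :
    0 ≤ regPart f₁ f₂ j x := by
  induction j generalizing x with
  | zero => exact le_rfl
  | succ j ih =>
    exact add_nonneg (realConv_nonneg (fun y => add_nonneg (h₁ y) (h₂ y)) ih x)
      (realConv_nonneg h₂ (mixPart_nonneg h₁ h₂ j) x)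

lemma integrable_regPart (hi₁ : Integrable f₁) (hi₂ : Integrable f₂) (j : ℕ) :
    Integrable (regPart f₁ f₂ j) := by
  induction j with
  | zero => exact integrable_zero _ _ _
  | succ j ih =>
    exact (integrable_realConv (hi₁.add hi₂) ih).add
      (integrable_realConv hi₂ (integrable_mixPart hi₁ hi₂ j))

lemma exists_regPart_le (h₁ : ∀ x, 0 ≤ f₁ x) (h₂ : ∀ x, 0 ≤ f₂ x) (hi₁ : Integrable f₁)
    (hi₂ : Integrable f₂) (hM : ∀ x, f₂ x ≤ M) (j : ℕ) :
    ∃ C, ∀ x, regPart f₁ f₂ j x ≤ C := by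
  induction j with
  | zero => exact ⟨0, fun x => le_rfl⟩
  | succ j ih =>
    obtain ⟨C, hC⟩ := ih
    refine ⟨C * (∫ y, f₁ y + f₂ y) + M * ∫ y, mixPart f₁ f₂ j y, fun x => ?_⟩
    have e1 := realConv_le (integrable_regPart hi₁ hi₂ j).1 (regPart_nonneg h₁ h₂ j) hC
      (hi₁.add hi₂) (fun y => add_nonneg (h₁ y) (h₂ y)) x
    have e2 := realConv_le hi₂.1 h₂ hM (integrable_mixPart hi₁ hi₂ j) (mixPart_nonneg h₁ h₂ j) x
    rw [realConv_comm] at e1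
    exact add_le_add e1 e2

lemma continuous_regPart (h₁ : ∀ x, 0 ≤ f₁ x) (h₂ : ∀ x, 0 ≤ f₂ x) (hi₁ : Integrable f₁)
    (hi₂ : Integrable f₂) (hM : ∀ x, f₂ x ≤ M) (j : ℕ) : Continuous (regPart f₁ f₂ j) := by
  cases j with
  | zero => exact continuous_const
  | succ j =>
    obtain ⟨C, hC⟩ := exists_regPart_le h₁ h₂ hi₁ hi₂ hM j
    have e1 := continuous_realConv (integrable_regPart hi₁ hi₂ j) (regPart_nonneg h₁ h₂ j) hC
      (hi₁.add hi₂)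
    have e2 := continuous_realConv hi₂ h₂ hM (integrable_mixPart hi₁ hi₂ j)
    refine Continuous.add (e1.congr fun x => ?_) e2
    rw [realConv_comm]
    rfl

lemma cf_regPart (hi₁ : Integrable f₁) (hi₂ : Integrable f₂) (j : ℕ) (u : ℝ) :
    cf (regPart f₁ f₂ j) u = (cf f₁ u + cf f₂ u) ^ (j + 1) - cf f₁ u ^ (j + 1) -
      (j + 1) * cf f₂ u * cf f₁ u ^ j := by
  induction j with
  | zero => simp [regPart, cf]
  | succ j ih =>
    have hi : Integrable (fun y => f₁ y + f₂ y) := hi₁.add hi₂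
    rw [regPart, cf_add (integrable_realConv hi (integrable_regPart hi₁ hi₂ j))
      (integrable_realConv hi₂ (integrable_mixPart hi₁ hi₂ j)),
      cf_realConv hi (integrable_regPart hi₁ hi₂ j),
      cf_realConv hi₂ (integrable_mixPart hi₁ hi₂ j), ih, cf_mixPart hi₁ hi₂, cf_add hi₁ hi₂ u]
    push_cast
    ring

/-- Geometric control of the Fourier transform of the regular part. -/
lemma norm_cf_regPart_le (hi₁ : Integrable f₁) (hi₂ : Integrable f₂) {u ρ : ℝ}
    (hρ : ‖cf f₁ u + cf f₂ u‖ ≤ ρ) (hρ₁ : ‖cf f₁ u‖ ≤ ρ) (j : ℕ) :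
    ρ * ‖cf (regPart f₁ f₂ j) u‖ ≤ j ^ 2 * ρ ^ j * ‖cf f₂ u‖ ^ 2 := by
  have hρ0 : 0 ≤ ρ := (norm_nonneg _).trans hρ
  induction j with
  | zero => simp [regPart, cf]
  | succ j ih =>
    have e : cf (regPart f₁ f₂ (j + 1)) u = (cf f₁ u + cf f₂ u) * cf (regPart f₁ f₂ j) u +
        (j + 1) * cf f₂ u ^ 2 * cf f₁ u ^ j := by
      rw [cf_regPart hi₁ hi₂, cf_regPart hi₁ hi₂]
      push_cast
      ring
    rw [e]
    have e1 : ‖(cf f₁ u + cf f₂ u) * cf (regPart f₁ f₂ j) u‖ ≤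
        ρ * ‖cf (regPart f₁ f₂ j) u‖ := by
      rw [norm_mul]
      gcongr
    have e2 : ‖((j : ℂ) + 1) * cf f₂ u ^ 2 * cf f₁ u ^ j‖ ≤ (j + 1) * ‖cf f₂ u‖ ^ 2 * ρ ^ j := by
      rw [norm_mul, norm_mul, norm_pow, norm_pow]
      have : ‖(j : ℂ) + 1‖ = (j : ℝ) + 1 := by
        exact_mod_cast Complex.norm_natCast (j + 1)
      rw [this]
      gcongr
    calc ρ * ‖(cf f₁ u + cf f₂ u) * cf (regPart f₁ f₂ j) u + (j + 1) * cf f₂ u ^ 2 * cf f₁ u ^ j‖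
        ≤ ρ * (ρ * ‖cf (regPart f₁ f₂ j) u‖ + (j + 1) * ‖cf f₂ u‖ ^ 2 * ρ ^ j) := by
          gcongr
          exact (norm_add_le _ _).trans (add_le_add e1 e2)
      _ ≤ ρ * (j ^ 2 * ρ ^ j * ‖cf f₂ u‖ ^ 2 + (j + 1) * ‖cf f₂ u‖ ^ 2 * ρ ^ j) := by
          gcongr
      _ = ((j : ℝ) ^ 2 + j + 1) * ρ ^ (j + 1) * ‖cf f₂ u‖ ^ 2 := by ring
      _ ≤ ((j + 1 : ℕ) : ℝ) ^ 2 * ρ ^ (j + 1) * ‖cf f₂ u‖ ^ 2 := by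
          gcongr
          push_cast
          nlinarith [(Nat.cast_nonneg j : (0 : ℝ) ≤ j)]

lemma convPow_succ_eq_of_ae (h₁ : ∀ x, 0 ≤ f₁ x) (h₂ : ∀ x, 0 ≤ f₂ x) (hi₁ : Integrable f₁)
    (hi₂ : Integrable f₂) (hM : ∀ x, f₂ x ≤ M) (j : ℕ)
    (hae : convPow (fun x => f₁ x + f₂ x) (j + 1) =ᵐ[volume]
      fun x => singPart f₁ j x + mixPart f₁ f₂ j x + regPart f₁ f₂ j x) {x : ℝ}
    (hx : Integrable fun y => f₁ y * singPart f₁ j (x - y)) :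
    convPow (fun x => f₁ x + f₂ x) (j + 2) x =
      singPart f₁ (j + 1) x + mixPart f₁ f₂ (j + 1) x + regPart f₁ f₂ (j + 1) x := by
  obtain ⟨C, hC⟩ := exists_regPart_le h₁ h₂ hi₁ hi₂ hM j
  have i2 := integrable_realConv_integrand hi₂.1 h₂ hM (integrable_singPart hi₁ j) x
  have i3 := integrable_realConv_integrand_right (integrable_mixPart hi₁ hi₂ j).1
    (mixPart_nonneg h₁ h₂ j) (mixPart_le h₁ h₂ hi₁ hi₂ hM j) hi₁ x
  have i4 := integrable_realConv_integrand_right (integrable_mixPart hi₁ hi₂ j).1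
    (mixPart_nonneg h₁ h₂ j) (mixPart_le h₁ h₂ hi₁ hi₂ hM j) hi₂ x
  have i5 := integrable_realConv_integrand_right (integrable_regPart hi₁ hi₂ j).1
    (regPart_nonneg h₁ h₂ j) hC (hi₁.add hi₂) x
  have e1 : convPow (fun x => f₁ x + f₂ x) (j + 2) x = ∫ y,
      (((f₁ y * singPart f₁ j (x - y) + (f₁ y * mixPart f₁ f₂ j (x - y) +
        f₂ y * singPart f₁ j (x - y)))) +
        ((f₁ + f₂) y * regPart f₁ f₂ j (x - y) + f₂ y * mixPart f₁ f₂ j (x - y))) := by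
    rw [convPow]
    have hq := (quasiMeasurePreserving_sub_left_of_right_invariant volume x).ae hae
    refine integral_congr_ae ?_
    filter_upwards [hq] with y hy
    simp only [hy, Pi.add_apply]
    ring
  have j1 : Integrable fun y =>
      f₁ y * mixPart f₁ f₂ j (x - y) + f₂ y * singPart f₁ j (x - y) := i3.add i2
  have j2 : Integrable fun y => f₁ y * singPart f₁ j (x - y) +
      (f₁ y * mixPart f₁ f₂ j (x - y) + f₂ y * singPart f₁ j (x - y)) := hx.add j1
  have j3 : Integrable fun y =>
      (f₁ + f₂) y * regPart f₁ f₂ j (x - y) + f₂ y * mixPart f₁ f₂ j (x - y) := i5.add i4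
  rw [e1, integral_add j2 j3, integral_add hx j1, integral_add i3 i2, integral_add i5 i4]
  rfl

lemma convPow_ae_eq (h₁ : ∀ x, 0 ≤ f₁ x) (h₂ : ∀ x, 0 ≤ f₂ x) (hi₁ : Integrable f₁)
    (hi₂ : Integrable f₂) (hM : ∀ x, f₂ x ≤ M) (j : ℕ) :
    convPow (fun x => f₁ x + f₂ x) (j + 1) =ᵐ[volume]
      fun x => singPart f₁ j x + mixPart f₁ f₂ j x + regPart f₁ f₂ j x := by
  induction j with
  | zero => exact Eventually.of_forall fun x => by simp [convPow, singPart, mixPart, regPart]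
  | succ j ih =>
    have h := hi₁.ae_convolution_exists (ContinuousLinearMap.mul ℝ ℝ) (integrable_singPart hi₁ j)
    filter_upwards [h] with x hx
    exact convPow_succ_eq_of_ae h₁ h₂ hi₁ hi₂ hM j ih hx

lemma convPow_eq_of_lt (h₁ : ∀ x, 0 ≤ f₁ x) (h₂ : ∀ x, 0 ≤ f₂ x) (hi₁ : Integrable f₁)
    (hi₂ : Integrable f₂) (hM : ∀ x, f₂ x ≤ M) (hb : ∀ x, b < x → f₁ x = 0) (j : ℕ) {x : ℝ}
    (hx : (j + 2) * b < x) :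
    convPow (fun x => f₁ x + f₂ x) (j + 2) x =
      mixPart f₁ f₂ (j + 1) x + regPart f₁ f₂ (j + 1) x := by
  have h0 := realConv_integrand_eq_zero hb (g := singPart f₁ j) (b' := (j + 1) * b)
      (fun x hx => singPart_eq_zero hb j hx) (x := x) (by linarith)
  rw [convPow_succ_eq_of_ae h₁ h₂ hi₁ hi₂ hM j (convPow_ae_eq h₁ h₂ hi₁ hi₂ hM j)
    (by simp [h0]), singPart_eq_zero hb (j + 1) (by push_cast; linarith), zero_add]

end Decomposition

/-- A centred probability density split into a small part `f₁` supported to the left of `-1` and a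
bounded part `f₂`, with third absolute moment at most `C`. -/
structure SplitDensity (f₁ f₂ : ℝ → ℝ) (M C : ℝ) : Prop where
  nonneg₁ : ∀ x, 0 ≤ f₁ x
  nonneg₂ : ∀ x, 0 ≤ f₂ x
  integrable₁ : Integrable f₁
  integrable₂ : Integrable f₂
  le₂ : ∀ x, f₂ x ≤ M
  mass₁ : ∫ x, f₁ x ≤ 1 / 4
  mass : (∫ x, f₁ x) + ∫ x, f₂ x = 1
  integrable_abs_pow : Integrable fun x => |x| ^ 3 * (f₁ x + f₂ x)
  moment_le : ∫ x, |x| ^ 3 * (f₁ x + f₂ x) ≤ C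
  mean : ∫ x, x * (f₁ x + f₂ x) = 0
  support₁ : ∀ x, -1 < x → f₁ x = 0

lemma norm_cexp_I_mul_sub_taylor_two_le (y : ℝ) :
    ‖Complex.exp (Complex.I * (y : ℂ)) - 1 - Complex.I * y + (y : ℂ) ^ 2 / 2‖ ≤ |y| ^ 3 := by
  have hn : ‖Complex.I * (y : ℂ)‖ = |y| := by simp
  rcases le_or_gt |y| 2 with h | h
  · have hb := Complex.exp_bound' (x := Complex.I * (y : ℂ)) (n := 3) (by
      rw [hn]; norm_num; linarith)
    rw [hn] at hb
    have e : Complex.exp (Complex.I * (y : ℂ)) - 1 - Complex.I * y + (y : ℂ) ^ 2 / 2 =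
        Complex.exp (Complex.I * (y : ℂ)) -
          ∑ m ∈ Finset.range 3, (Complex.I * (y : ℂ)) ^ m / (m.factorial : ℂ) := by
      simp only [Finset.sum_range_succ, Finset.sum_range_zero, Nat.factorial, mul_pow,
        Complex.I_sq]
      push_cast
      ring
    rw [e]
    refine hb.trans ?_
    norm_num [Nat.factorial]
    nlinarith [pow_nonneg (abs_nonneg y) 3]
  · have h1 : ‖Complex.exp (Complex.I * (y : ℂ))‖ = 1 := Complex.norm_exp_I_mul_ofReal y
    have h2 : ‖(y : ℂ) ^ 2 / 2‖ = |y| ^ 2 / 2 := by simp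
    have := norm_add_le (Complex.exp (Complex.I * (y : ℂ)) - 1 - Complex.I * y) ((y : ℂ) ^ 2 / 2)
    have := norm_sub_le (Complex.exp (Complex.I * (y : ℂ)) - 1) (Complex.I * y)
    have := norm_sub_le (Complex.exp (Complex.I * (y : ℂ))) 1
    rw [norm_one] at this
    nlinarith [mul_pos (sub_pos.2 h) (sub_pos.2 h), pow_pos (by linarith : 0 < |y|) 2,
      mul_pos (pow_pos (by linarith : 0 < |y|) 2) (sub_pos.2 h)]

lemma norm_cexp_I_mul_sub_taylor_one_le (y : ℝ) :
    ‖Complex.exp (Complex.I * (y : ℂ)) - 1 - Complex.I * y‖ ≤ 3 * |y| ^ 2 := by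
  have hn : ‖Complex.I * (y : ℂ)‖ = |y| := by simp
  rcases le_or_gt |y| 1 with h | h
  · have hb := Complex.norm_exp_sub_one_sub_id_le (x := Complex.I * (y : ℂ)) (by rwa [hn])
    rw [hn] at hb
    nlinarith [sq_nonneg |y|]
  · have h1 : ‖Complex.exp (Complex.I * (y : ℂ))‖ = 1 := Complex.norm_exp_I_mul_ofReal y
    have := norm_sub_le (Complex.exp (Complex.I * (y : ℂ)) - 1) (Complex.I * y)
    have := norm_sub_le (Complex.exp (Complex.I * (y : ℂ))) 1
    rw [norm_one] at this
    nlinarith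

lemma norm_pow_sub_pow_le {A B : ℂ} {r : ℝ} (hA : ‖A‖ ≤ r) (hB : ‖B‖ ≤ r) (k : ℕ) :
    ‖A ^ (k + 1) - B ^ (k + 1)‖ ≤ (k + 1) * ‖A - B‖ * r ^ k := by
  have hr : 0 ≤ r := (norm_nonneg _).trans hA
  induction k with
  | zero => simp
  | succ k ih =>
    have e : A ^ (k + 1 + 1) - B ^ (k + 1 + 1) =
        (A ^ (k + 1) - B ^ (k + 1)) * A + B ^ (k + 1) * (A - B) := by ring
    rw [e]
    have e1 : ‖(A ^ (k + 1) - B ^ (k + 1)) * A‖ ≤ (k + 1) * ‖A - B‖ * r ^ k * r := by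
      rw [norm_mul]
      gcongr
    have e2 : ‖B ^ (k + 1) * (A - B)‖ ≤ r ^ (k + 1) * ‖A - B‖ := by
      rw [norm_mul, norm_pow]
      gcongr
    refine (norm_add_le _ _).trans ((add_le_add e1 e2).trans (le_of_eq ?_))
    push_cast
    ring

namespace SplitDensity

variable {f₁ f₂ : ℝ → ℝ} {M C : ℝ}

lemma integrable (H : SplitDensity f₁ f₂ M C) : Integrable fun x => f₁ x + f₂ x :=
  H.integrable₁.add H.integrable₂

lemma nonneg (H : SplitDensity f₁ f₂ M C) (x : ℝ) : 0 ≤ f₁ x + f₂ x :=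
  add_nonneg (H.nonneg₁ x) (H.nonneg₂ x)

lemma integral_eq_one (H : SplitDensity f₁ f₂ M C) : ∫ x, (f₁ x + f₂ x) = 1 := by
  rw [integral_add H.integrable₁ H.integrable₂, H.mass]

lemma integral₁_nonneg (H : SplitDensity f₁ f₂ M C) : 0 ≤ ∫ x, f₁ x :=
  integral_nonneg H.nonneg₁

lemma le_integral₂ (H : SplitDensity f₁ f₂ M C) : 3 / 4 ≤ ∫ x, f₂ x := by
  linarith [H.mass, H.mass₁]

lemma integral₂_le (H : SplitDensity f₁ f₂ M C) : ∫ x, f₂ x ≤ 1 := by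
  linarith [H.mass, H.integral₁_nonneg]

lemma pos (H : SplitDensity f₁ f₂ M C) : 0 < M := by
  by_contra! h
  have : ∫ x, f₂ x ≤ 0 := integral_nonpos fun x => (H.le₂ x).trans h
  linarith [H.le_integral₂]

lemma moment_nonneg (H : SplitDensity f₁ f₂ M C) : 0 ≤ C :=
  (integral_nonneg fun x => mul_nonneg (by positivity) (H.nonneg x)).trans H.moment_le

lemma integrable_of_abs_le (H : SplitDensity f₁ f₂ M C) {w : ℝ → ℝ} (hw : Continuous w)
    (hle : ∀ x, |w x| ≤ 1 + |x| ^ 3) : Integrable fun x => w x * (f₁ x + f₂ x) := by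
  refine (H.integrable.add H.integrable_abs_pow).mono'
    (hw.aestronglyMeasurable.mul H.integrable.1) (Eventually.of_forall fun x => ?_)
  rw [norm_mul, Real.norm_eq_abs, Real.norm_eq_abs, abs_of_nonneg (H.nonneg x)]
  have := mul_le_mul_of_nonneg_right (hle x) (H.nonneg x)
  simp only [Pi.add_apply]
  linarith

lemma integrable_id (H : SplitDensity f₁ f₂ M C) : Integrable fun x => x * (f₁ x + f₂ x) :=
  H.integrable_of_abs_le continuous_id fun x => by
    have := abs_nonneg x
    change |x| ≤ 1 + |x| ^ 3
    nlinarith [pow_nonneg this 3, mul_nonneg this (sq_nonneg (|x| - 1)), sq_nonneg (|x| - 1)]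

lemma sq_le_one_add (x : ℝ) : x ^ 2 ≤ 1 + |x| ^ 3 := by
  have := abs_nonneg x
  rw [← sq_abs]
  nlinarith [pow_nonneg this 3, mul_nonneg this (sq_nonneg (|x| - 1)), sq_nonneg (|x| - 1)]

lemma integrable_sq (H : SplitDensity f₁ f₂ M C) : Integrable fun x => x ^ 2 * (f₁ x + f₂ x) :=
  H.integrable_of_abs_le (continuous_pow 2) fun x => by
    rw [abs_of_nonneg (sq_nonneg x)]
    exact sq_le_one_add x

lemma variance_le (H : SplitDensity f₁ f₂ M C) : ∫ x, x ^ 2 * (f₁ x + f₂ x) ≤ 1 + C := by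
  have h : ∫ x, x ^ 2 * (f₁ x + f₂ x) ≤ ∫ x, ((f₁ x + f₂ x) + |x| ^ 3 * (f₁ x + f₂ x)) := by
    refine integral_mono H.integrable_sq (H.integrable.add H.integrable_abs_pow) fun x => ?_
    have := mul_le_mul_of_nonneg_right (sq_le_one_add x) (H.nonneg x)
    linarith
  rw [integral_add H.integrable H.integrable_abs_pow, H.integral_eq_one] at h
  linarith [H.moment_le]

lemma le_variance (H : SplitDensity f₁ f₂ M C) :
    1 / (128 * M ^ 2) ≤ ∫ x, x ^ 2 * (f₁ x + f₂ x) := by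
  have hM := H.pos
  set r : ℝ := 1 / (8 * M) with hr
  have hr0 : 0 < r := by positivity
  have hind : Integrable ((Icc (-r) r).indicator fun _ : ℝ => r ^ 2 * M) :=
    (integrable_indicator_iff measurableSet_Icc).2 (continuousOn_const.integrableOn_Icc)
  have h : ∫ x, (r ^ 2 * f₂ x - (Icc (-r) r).indicator (fun _ : ℝ => r ^ 2 * M) x) ≤
      ∫ x, x ^ 2 * (f₁ x + f₂ x) := by
    refine integral_mono ((H.integrable₂.const_mul _).sub hind) H.integrable_sq fun x => ?_
    have h1 := mul_nonneg (sq_nonneg x) (H.nonneg₁ x)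
    have h2 := mul_nonneg (sq_nonneg x) (H.nonneg₂ x)
    by_cases hx : x ∈ Icc (-r) r
    · simp only [indicator_of_mem hx]
      nlinarith [mul_le_mul_of_nonneg_left (H.le₂ x) (sq_nonneg r)]
    · simp only [indicator_of_notMem hx]
      have hlt : r < |x| := by
        rw [mem_Icc, ← abs_le] at hx
        exact not_le.1 hx
      have : r ^ 2 ≤ x ^ 2 := by
        rw [← sq_abs x]
        gcongr
      nlinarith [mul_le_mul_of_nonneg_right this (H.nonneg₂ x)]
  rw [integral_sub (H.integrable₂.const_mul _) hind, integral_const_mul,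
    integral_indicator measurableSet_Icc] at h
  simp only [integral_const, MeasurableSet.univ, measureReal_restrict_apply, univ_inter,
    Real.volume_real_Icc_of_le (by linarith : -r ≤ r), smul_eq_mul] at h
  have e : r ^ 2 * (3 / 4) - (r - -r) * (r ^ 2 * M) = 1 / (128 * M ^ 2) := by
    rw [hr]
    field_simp
    norm_num
  nlinarith [mul_le_mul_of_nonneg_left H.le_integral₂ (sq_nonneg r)]

lemma norm_cf_sub_taylor_le (H : SplitDensity f₁ f₂ M C) (u : ℝ) :
    ‖cf (fun x => f₁ x + f₂ x) u - 1 +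
      (((∫ x, x ^ 2 * (f₁ x + f₂ x)) * u ^ 2 / 2 : ℝ) : ℂ)‖ ≤ C * |u| ^ 3 := by
  set f : ℝ → ℝ := fun x => f₁ x + f₂ x with hf
  have i0 := integrable_cf_integrand H.integrable u
  have i1 : Integrable fun x : ℝ => ((f x : ℝ) : ℂ) := H.integrable.ofReal
  have i2 : Integrable fun x : ℝ => Complex.I * u * ((x * f x : ℝ) : ℂ) :=
    H.integrable_id.ofReal.const_mul _
  have i3 : Integrable fun x : ℝ => (u : ℂ) ^ 2 / 2 * ((x ^ 2 * f x : ℝ) : ℂ) :=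
    H.integrable_sq.ofReal.const_mul _
  have j1 : Integrable fun x : ℝ =>
      Complex.exp (Complex.I * ((u * x : ℝ) : ℂ)) * (f x : ℂ) - (f x : ℂ) := i0.sub i1
  have j2 : Integrable fun x : ℝ =>
      Complex.exp (Complex.I * ((u * x : ℝ) : ℂ)) * (f x : ℂ) - (f x : ℂ) -
        Complex.I * u * ((x * f x : ℝ) : ℂ) := j1.sub i2
  have e : cf f u - 1 + (((∫ x, x ^ 2 * (f₁ x + f₂ x)) * u ^ 2 / 2 : ℝ) : ℂ) =
      ∫ x, (Complex.exp (Complex.I * ((u * x : ℝ) : ℂ)) - 1 - Complex.I * ((u * x : ℝ) : ℂ) +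
        ((u * x : ℝ) : ℂ) ^ 2 / 2) * (f x : ℂ) := by
    have s1 : ∫ x, ((f x : ℝ) : ℂ) = 1 := by
      rw [integral_complex_ofReal, hf, H.integral_eq_one, Complex.ofReal_one]
    have s2 : ∫ x, Complex.I * u * ((x * f x : ℝ) : ℂ) = 0 := by
      rw [integral_const_mul, integral_complex_ofReal, hf, H.mean]
      simp
    have s3 : ∫ x, (u : ℂ) ^ 2 / 2 * ((x ^ 2 * f x : ℝ) : ℂ) =
        (((∫ x, x ^ 2 * (f₁ x + f₂ x)) * u ^ 2 / 2 : ℝ) : ℂ) := by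
      rw [integral_const_mul, integral_complex_ofReal]
      push_cast
      ring
    calc _ = cf f u - (∫ x, ((f x : ℝ) : ℂ)) - (∫ x, Complex.I * u * ((x * f x : ℝ) : ℂ)) +
          ∫ x, (u : ℂ) ^ 2 / 2 * ((x ^ 2 * f x : ℝ) : ℂ) := by rw [s1, s2, s3, sub_zero]
      _ = _ := by
        rw [cf, ← integral_sub i0 i1, ← integral_sub j1 i2, ← integral_add j2 i3]
        refine integral_congr_ae (Eventually.of_forall fun x => ?_)
        simp only [hf]
        push_cast
        ring
  rw [e]
  refine (norm_integral_le_integral_norm _).trans ?_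
  have hb : ∫ x, |u| ^ 3 * (|x| ^ 3 * f x) ≤ C * |u| ^ 3 := by
    rw [integral_const_mul, mul_comm]
    exact mul_le_mul_of_nonneg_right H.moment_le (by positivity)
  refine le_trans (integral_mono_of_nonneg (Eventually.of_forall fun x => norm_nonneg _)
    (H.integrable_abs_pow.const_mul _) (Eventually.of_forall fun x => ?_)) hb
  simp only [norm_mul, Complex.norm_real, Real.norm_eq_abs, abs_of_nonneg (H.nonneg x), hf]
  rw [← mul_assoc, ← mul_pow, ← abs_mul]
  exact mul_le_mul_of_nonneg_right (norm_cexp_I_mul_sub_taylor_two_le _) (H.nonneg x)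

end SplitDensity

lemma tendsto_integral_cos_pow :
    Tendsto (fun N : ℕ => ∫ y in (0 : ℝ)..(2 * π), ((1 + cos y) / 2) ^ N) atTop (𝓝 0) := by
  have hz : ∫ _ in (0 : ℝ)..(2 * π), (0 : ℝ) = 0 := by simp
  suffices h : Tendsto (fun N : ℕ => ∫ y in (0 : ℝ)..(2 * π), ((1 + cos y) / 2) ^ N) atTop
      (𝓝 (∫ _ in (0 : ℝ)..(2 * π), (0 : ℝ))) by
    rwa [hz] at h
  refine intervalIntegral.tendsto_integral_filter_of_dominated_convergence
    (F := fun (N : ℕ) y => ((1 + cos y) / 2) ^ N) (fun _ => (1 : ℝ))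
    (Eventually.of_forall fun N => Continuous.aestronglyMeasurable (by fun_prop))
    (Eventually.of_forall fun N => Eventually.of_forall fun y _ => ?_)
    intervalIntegrable_const ?_
  · rw [Real.norm_eq_abs, abs_pow]
    refine pow_le_one₀ (abs_nonneg _) ?_
    rw [abs_le]
    constructor <;> linarith [neg_one_le_cos y, cos_le_one y]
  · have hne : ∀ᵐ y : ℝ, y ≠ 2 * π := by simp [ae_iff, measure_singleton]
    filter_upwards [hne] with y hy hmem
    rw [uIoc_of_le (by positivity)] at hmem
    refine tendsto_pow_atTop_nhds_zero_of_lt_one (by linarith [neg_one_le_cos y]) ?_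
    have : cos y ≠ 1 := by
      intro h1
      rw [cos_eq_one_iff_of_lt_of_lt (by linarith [hmem.1, pi_pos])
        (lt_of_le_of_ne hmem.2 hy)] at h1
      exact hmem.1.ne' h1
    have := lt_of_le_of_ne (cos_le_one y) this
    linarith

lemma intervalIntegral_le_of_periodic {g : ℝ → ℝ} {T : ℝ} (hT : 0 < T)
    (hg : Function.Periodic g T) (hc : Continuous g) (h0 : ∀ x, 0 ≤ g x) {a b : ℝ} (hab : a ≤ b) :
    ∫ x in a..b, g x ≤ ((b - a) / T + 1) * ∫ x in (0 : ℝ)..T, g x := by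
  have hinteg : ∀ a b, IntervalIntegrable g volume a b := fun a b => hc.intervalIntegrable a b
  have hI : 0 ≤ ∫ x in (0 : ℝ)..T, g x :=
    intervalIntegral.integral_nonneg hT.le fun x _ => h0 x
  set k : ℕ := ⌈(b - a) / T⌉₊ with hk
  have h1 : b ≤ a + k * T := by
    have := Nat.le_ceil ((b - a) / T)
    rw [div_le_iff₀ hT] at this
    linarith
  have h2 : (k : ℝ) ≤ (b - a) / T + 1 :=
    (Nat.ceil_lt_add_one (div_nonneg (sub_nonneg.2 hab) hT.le)).le
  have h3 : ∫ x in a..(a + k * T), g x = k * ∫ x in (0 : ℝ)..T, g x := by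
    have := hg.intervalIntegral_add_zsmul_eq (k : ℤ) a (hinteg)
    simp only [zsmul_eq_mul, Int.cast_natCast] at this
    rw [this, hg.intervalIntegral_add_eq a 0, zero_add]
  calc ∫ x in a..b, g x ≤ ∫ x in a..(a + k * T), g x :=
        intervalIntegral.integral_mono_interval le_rfl hab h1
          (Eventually.of_forall fun x => h0 x) (hinteg _ _)
    _ = k * ∫ x in (0 : ℝ)..T, g x := h3
    _ ≤ _ := mul_le_mul_of_nonneg_right h2 hI

lemma integral_cos_pow_comp_le {u R θ ε : ℝ} (hε : 0 < ε) (hu : ε ≤ u) (hR : 0 ≤ R) (N : ℕ) :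
    ∫ x in (-R)..R, ((1 + cos (u * x - θ)) / 2) ^ N ≤
      (R / π + 1 / ε) * ∫ y in (0 : ℝ)..(2 * π), ((1 + cos y) / 2) ^ N := by
  have hu0 : 0 < u := hε.trans_le hu
  set g : ℝ → ℝ := fun y => ((1 + cos y) / 2) ^ N with hg
  have h0 : ∀ y, 0 ≤ g y := fun y => pow_nonneg (by linarith [neg_one_le_cos y]) _
  have hI : 0 ≤ ∫ y in (0 : ℝ)..(2 * π), g y :=
    intervalIntegral.integral_nonneg (by positivity) fun x _ => h0 x
  have hp : Function.Periodic g (2 * π) := fun y => by simp [hg]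
  have hle := intervalIntegral_le_of_periodic (by positivity : 0 < 2 * π) hp
    (by simp only [hg]; fun_prop) h0 (a := u * -R - θ) (b := u * R - θ) (by nlinarith)
  have e : ∫ x in (-R)..R, g (u * x - θ) = u⁻¹ * ∫ y in (u * -R - θ)..(u * R - θ), g y := by
    rw [intervalIntegral.integral_comp_mul_sub _ hu0.ne', smul_eq_mul]
  change ∫ x in (-R)..R, g (u * x - θ) ≤ _
  rw [e]
  calc u⁻¹ * ∫ y in (u * -R - θ)..(u * R - θ), g y
      ≤ u⁻¹ * (((u * R - θ - (u * -R - θ)) / (2 * π) + 1) * ∫ y in (0 : ℝ)..(2 * π), g y) := by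
        gcongr
    _ = (R / π + 1 / u) * ∫ y in (0 : ℝ)..(2 * π), g y := by
        field_simp
        ring
    _ ≤ _ := by gcongr

lemma integral_mul_cos_eq_norm_cf {f : ℝ → ℝ} (hf : Integrable f) (u : ℝ) :
    ∃ θ : ℝ, ‖cf f u‖ = ∫ x, cos (u * x - θ) * f x := by
  refine ⟨Complex.arg (cf f u), ?_⟩
  set θ := Complex.arg (cf f u) with hθ
  have h1 : ((‖cf f u‖ : ℝ) : ℂ) = Complex.exp (-(θ * Complex.I)) * cf f u := by
    conv_rhs => rw [← Complex.norm_mul_exp_arg_mul_I (cf f u)]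
    rw [mul_left_comm, ← Complex.exp_add, hθ, neg_add_cancel, Complex.exp_zero, mul_one]
  have h2 : Complex.exp (-(θ * Complex.I)) * cf f u =
      ∫ x, Complex.exp (((u * x - θ : ℝ) : ℂ) * Complex.I) * (f x : ℂ) := by
    rw [cf, ← integral_const_mul]
    refine integral_congr_ae (Eventually.of_forall fun x => ?_)
    simp only
    rw [← mul_assoc, ← Complex.exp_add]
    congr 2
    push_cast
    ring
  have hi : Integrable fun x => Complex.exp (((u * x - θ : ℝ) : ℂ) * Complex.I) * (f x : ℂ) := by
    refine hf.ofReal.bdd_mul (c := 1) (Continuous.aestronglyMeasurable (by fun_prop)) ?_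
    exact Eventually.of_forall fun x => (Complex.norm_exp_ofReal_mul_I _).le
  have h3 := congrArg Complex.re (h1.trans h2)
  rw [Complex.ofReal_re] at h3
  rw [h3]
  have h4 := integral_re hi
  simp only [RCLike.re_to_complex] at h4
  rw [← h4]
  refine integral_congr_ae (Eventually.of_forall fun x => ?_)
  simp only [Complex.re_mul_ofReal, Complex.exp_ofReal_mul_I_re]

namespace SplitDensity

lemma tail_le {f₁ f₂ : ℝ → ℝ} {M C : ℝ} (H : SplitDensity f₁ f₂ M C) {R : ℝ} (hR : 0 < R)
    {N : ℕ} {u θ : ℝ} :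
    ∫ x, ((1 + cos (u * x - θ)) / 2) ^ N * f₂ x ≤
      C / R ^ 3 + M * ∫ x in (-R)..R, ((1 + cos (u * x - θ)) / 2) ^ N := by
  set s : ℝ → ℝ := fun x => ((1 + cos (u * x - θ)) / 2) ^ N with hs
  have hsc : Continuous s := by simp only [hs]; fun_prop
  have s0 : ∀ x, 0 ≤ s x := fun x => pow_nonneg (by linarith [neg_one_le_cos (u * x - θ)]) _
  have s1 : ∀ x, s x ≤ 1 := fun x => pow_le_one₀ (by linarith [neg_one_le_cos (u * x - θ)])
    (by linarith [cos_le_one (u * x - θ)])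
  have hi1 : Integrable fun x => R⁻¹ ^ 3 * (|x| ^ 3 * (f₁ x + f₂ x)) :=
    H.integrable_abs_pow.const_mul _
  have hi2 : Integrable ((Ioc (-R) R).indicator fun x => M * s x) :=
    (integrable_indicator_iff measurableSet_Ioc).2
      ((hsc.const_mul M).integrableOn_Icc.mono_set Ioc_subset_Icc_self)
  have hM := H.pos
  have h : ∫ x, s x * f₂ x ≤ ∫ x, (R⁻¹ ^ 3 * (|x| ^ 3 * (f₁ x + f₂ x)) +
      (Ioc (-R) R).indicator (fun x => M * s x) x) := by
    refine integral_mono_of_nonneg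
      (Eventually.of_forall fun x => mul_nonneg (s0 x) (H.nonneg₂ x)) (hi1.add hi2)
      (Eventually.of_forall fun x => ?_)
    simp only
    have hn : 0 ≤ R⁻¹ ^ 3 * (|x| ^ 3 * (f₁ x + f₂ x)) :=
      mul_nonneg (by positivity) (mul_nonneg (by positivity) (H.nonneg x))
    by_cases hx : x ∈ Ioc (-R) R
    · rw [indicator_of_mem hx]
      nlinarith [mul_le_mul_of_nonneg_left (H.le₂ x) (s0 x)]
    · rw [indicator_of_notMem hx, add_zero]
      have hRx : R ≤ |x| := by
        by_contra! hlt
        rw [abs_lt] at hlt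
        exact hx ⟨hlt.1, hlt.2.le⟩
      have h1 : 1 ≤ R⁻¹ ^ 3 * |x| ^ 3 := by
        rw [← mul_pow]
        refine one_le_pow₀ ?_
        rw [inv_mul_eq_div, one_le_div hR]
        exact hRx
      calc s x * f₂ x ≤ 1 * f₂ x := mul_le_mul_of_nonneg_right (s1 x) (H.nonneg₂ x)
        _ ≤ (R⁻¹ ^ 3 * |x| ^ 3) * (f₁ x + f₂ x) := by
            refine mul_le_mul h1 (by linarith [H.nonneg₁ x]) (H.nonneg₂ x) (by positivity)
        _ = _ := by ring
  rw [integral_add hi1 hi2, integral_const_mul, integral_indicator measurableSet_Ioc,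
    integral_const_mul, ← intervalIntegral.integral_of_le (by linarith)] at h
  refine h.trans (add_le_add ?_ le_rfl)
  rw [inv_pow, inv_mul_eq_div]
  exact div_le_div_of_nonneg_right H.moment_le (by positivity)

/-- Uniformly over split densities, the characteristic function stays away from the unit circle
outside a neighbourhood of the origin. -/
lemma exists_norm_cf_le (M C ε : ℝ) (hε : 0 < ε) :
    ∃ ρ : ℝ, 1 / 2 ≤ ρ ∧ ρ < 1 ∧ ∀ f₁ f₂, SplitDensity f₁ f₂ M C → ∀ u, ε ≤ |u| →
      ‖cf f₁ u + cf f₂ u‖ ≤ ρ := by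
  set R : ℝ := max 1 (8 * C) with hRdef
  have hR1 : 1 ≤ R := le_max_left _ _
  have hR : 0 < R := by linarith
  have hlim := (tendsto_integral_cos_pow.const_mul (M * (R / π + 1 / ε)))
  rw [mul_zero] at hlim
  obtain ⟨N, hN, hN1⟩ := ((hlim.eventually (gt_mem_nhds (by norm_num : (0 : ℝ) < 1 / 8))).and
    (eventually_ge_atTop 2)).exists
  have hN2 : (2 : ℝ) ≤ N := by exact_mod_cast hN1
  refine ⟨1 - 1 / N, ?_, ?_, fun f₁ f₂ H u hu => ?_⟩
  · have : 1 / (N : ℝ) ≤ 1 / 2 := by gcongr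
    linarith
  · have : 0 < 1 / (N : ℝ) := by positivity
    linarith
  have hC := H.moment_nonneg
  have key : ∀ u, ε ≤ u → ‖cf f₂ u‖ ≤ (∫ x, f₂ x) - 1 / N := by
    intro u hu
    obtain ⟨θ, hθ⟩ := integral_mul_cos_eq_norm_cf H.integrable₂ u
    have htail := H.tail_le hR (N := N) (u := u) (θ := θ)
    have h1 : C / R ^ 3 ≤ 1 / 8 := by
      rw [div_le_iff₀ (by positivity)]
      have : 8 * C ≤ R := le_max_right _ _
      nlinarith [pow_le_pow_right₀ hR1 (by norm_num : 1 ≤ 3)]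
    have h2 : M * ∫ x in (-R)..R, ((1 + cos (u * x - θ)) / 2) ^ N ≤ 1 / 8 := by
      refine le_trans (mul_le_mul_of_nonneg_left
        (integral_cos_pow_comp_le hε hu hR.le N) H.pos.le) ?_
      rw [← mul_assoc]
      exact hN.le
    have ic : Integrable fun x => cos (u * x - θ) * f₂ x := by
      refine H.integrable₂.bdd_mul (c := 1) (Continuous.aestronglyMeasurable (by fun_prop)) ?_
      exact Eventually.of_forall fun x => abs_cos_le_one _
    have is : Integrable fun x => ((1 + cos (u * x - θ)) / 2) ^ N * f₂ x := by
      refine H.integrable₂.bdd_mul (c := 1) (Continuous.aestronglyMeasurable (by fun_prop)) ?_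
      refine Eventually.of_forall fun x => ?_
      rw [norm_pow]
      refine pow_le_one₀ (norm_nonneg _) ?_
      rw [Real.norm_eq_abs, abs_le]
      constructor <;> linarith [neg_one_le_cos (u * x - θ), cos_le_one (u * x - θ)]
    have hmono : ∫ x, (N / 2 : ℝ) * (cos (u * x - θ) * f₂ x) ≤
        ∫ x, ((N / 2 - 1 : ℝ) * f₂ x + ((1 + cos (u * x - θ)) / 2) ^ N * f₂ x) := by
      refine integral_mono (ic.const_mul _) ((H.integrable₂.const_mul _).add is) fun x => ?_
      have hb := one_add_mul_le_pow (a := (1 + cos (u * x - θ)) / 2 - 1)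
        (by linarith [neg_one_le_cos (u * x - θ)]) N
      rw [add_sub_cancel] at hb
      have := mul_le_mul_of_nonneg_right hb (H.nonneg₂ x)
      simp only
      nlinarith
    rw [integral_const_mul, integral_add (H.integrable₂.const_mul _) is, integral_const_mul,
      ← hθ] at hmono
    have h3 := H.le_integral₂
    have h4 : (N : ℝ) / 2 * ‖cf f₂ u‖ ≤ N / 2 * ((∫ x, f₂ x) - 1 / N) := by
      have : (N : ℝ) / 2 * ((∫ x, f₂ x) - 1 / N) = N / 2 * (∫ x, f₂ x) - 1 / 2 := by
        field_simp
      rw [this]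
      linarith
    exact le_of_mul_le_mul_left h4 (by positivity)
  have key' : ‖cf f₂ u‖ ≤ (∫ x, f₂ x) - 1 / N := by
    rcases le_abs.1 hu with h | h
    · exact key u h
    · have e : ‖cf f₂ (-u)‖ = ‖cf f₂ u‖ := by
        have : cf f₂ (-u) = (starRingEnd ℂ) (cf f₂ u) := by
          rw [← cf_comp_neg, cf, cf, ← integral_neg_eq_self]
          refine integral_congr_ae (Eventually.of_forall fun x => ?_)
          simp
        rw [this, RCLike.norm_conj]
      rw [← e]
      exact key (-u) h
  have h1 := norm_cf_le H.nonneg₁ u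
  have := norm_add_le (cf f₁ u) (cf f₂ u)
  linarith [H.mass]

end SplitDensity

lemma integral_abs_pow_mul_exp_neg_mul_sq_le {b ε : ℝ} (hb : 0 < b) (hε : 0 ≤ ε) (j : ℕ) :
    ∫ u in (-ε)..ε, |u| ^ j * exp (-b * u ^ 2) ≤
      Gamma ((j + 1) / 2) * b ^ (-((j : ℝ) + 1) / 2) := by
  have hq : (-1 : ℝ) < j := by linarith [(Nat.cast_nonneg j : (0 : ℝ) ≤ j)]
  have e1 := integral_rpow_mul_exp_neg_mul_rpow (p := 2) (q := j) (b := b) (by norm_num) hq hb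
  have e2 := integral_comp_abs (f := fun x : ℝ => x ^ (j : ℝ) * exp (-b * x ^ (2 : ℝ)))
  have e3 : (fun u : ℝ => |u| ^ j * exp (-b * u ^ 2)) =
      fun x : ℝ => |x| ^ (j : ℝ) * exp (-b * |x| ^ (2 : ℝ)) := by
    funext u
    rw [Real.rpow_natCast, Real.rpow_two, sq_abs]
  have hi : Integrable fun u : ℝ => |u| ^ j * exp (-b * u ^ 2) := by
    refine (integrable_rpow_mul_exp_neg_mul_sq hb hq).norm.congr (Eventually.of_forall fun u => ?_)
    simp only [Real.rpow_natCast, norm_mul, norm_pow, Real.norm_eq_abs, abs_exp]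
  rw [e3] at hi ⊢
  rw [intervalIntegral.integral_of_le (by linarith)]
  refine (setIntegral_le_integral hi (Eventually.of_forall fun x => by positivity)).trans ?_
  rw [e2, e1]
  refine le_of_eq ?_
  ring

namespace SplitDensity

/-- Quantitative behaviour of the characteristic function near the origin, uniform over split
densities. -/
lemma exists_cf_local (M C : ℝ) (hM : 0 < M) (hC : 0 ≤ C) :
    ∃ ε b L : ℝ, 0 < ε ∧ 0 < b ∧ 0 ≤ L ∧ ∀ f₁ f₂, SplitDensity f₁ f₂ M C →
      ∃ v : ℝ, 0 ≤ v ∧ v ≤ L ∧ ∀ u : ℝ, |u| ≤ ε →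
        ‖cf (fun x => f₁ x + f₂ x) u‖ ≤ exp (-b * u ^ 2) ∧
        exp (-v * u ^ 2 / 2) ≤ exp (-b * u ^ 2) ∧
        ‖cf (fun x => f₁ x + f₂ x) u - (exp (-v * u ^ 2 / 2) : ℝ)‖ ≤ L * |u| ^ 3 ∧
        ‖cf (fun x => f₁ x + f₂ x) u - 1‖ ≤ L * |u| ^ 2 := by
  set v₀ : ℝ := 1 / (128 * M ^ 2) with hv₀
  have hv₀pos : 0 < v₀ := by positivity
  refine ⟨min (1 / (1 + C)) (v₀ / (4 * (C + 1))), v₀ / 4, (1 + C) ^ 2 + C + 1, by positivity,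
    by positivity, by positivity, fun f₁ f₂ H => ⟨∫ x, x ^ 2 * (f₁ x + f₂ x), ?_, ?_, ?_⟩⟩
  · exact integral_nonneg fun x => mul_nonneg (sq_nonneg x) (H.nonneg x)
  · nlinarith [H.variance_le]
  intro u hu
  have hT := H.norm_cf_sub_taylor_le u
  have hlow := H.le_variance
  rw [← hv₀] at hlow
  have hup := H.variance_le
  set v := ∫ x, x ^ 2 * (f₁ x + f₂ x) with hv
  set φ := cf (fun x => f₁ x + f₂ x) u with hφ
  have hu1 : |u| * (1 + C) ≤ 1 := by
    have := hu.trans (min_le_left _ _)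
    rwa [le_div_iff₀ (by positivity)] at this
  have hu2 : |u| * (4 * (C + 1)) ≤ v₀ := by
    have := hu.trans (min_le_right _ _)
    rwa [le_div_iff₀ (by positivity)] at this
  have hu0 := abs_nonneg u
  have huone : |u| ≤ 1 := by nlinarith
  have husq : u ^ 2 = |u| ^ 2 := (sq_abs u).symm
  have hvu : v * u ^ 2 ≤ 1 := by
    rw [husq]
    calc v * |u| ^ 2 ≤ (1 + C) * |u| ^ 2 := by gcongr
      _ = (|u| * (1 + C)) * |u| := by ring
      _ ≤ 1 * 1 := mul_le_mul hu1 huone hu0 zero_le_one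
      _ = 1 := one_mul 1
  have hvu0 : 0 ≤ v * u ^ 2 := mul_nonneg (hv₀pos.le.trans hlow) (sq_nonneg u)
  have hcub : C * |u| ^ 3 ≤ v₀ / 4 * u ^ 2 := by
    rw [husq]
    have : C * |u| ≤ v₀ / 4 := by nlinarith
    calc C * |u| ^ 3 = C * |u| * |u| ^ 2 := by ring
      _ ≤ v₀ / 4 * |u| ^ 2 := by gcongr
  have hvlow : v₀ * u ^ 2 ≤ v * u ^ 2 := by gcongr
  have hv₀u : 0 ≤ v₀ * u ^ 2 := by positivity
  refine ⟨?_, ?_, ?_, ?_⟩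
  · have h1 : ‖φ‖ ≤ C * |u| ^ 3 + (1 - v * u ^ 2 / 2) := by
      have e : φ = (φ - 1 + ((v * u ^ 2 / 2 : ℝ) : ℂ)) + ((1 - v * u ^ 2 / 2 : ℝ) : ℂ) := by
        push_cast
        ring
      rw [e]
      refine (norm_add_le _ _).trans (add_le_add hT ?_)
      rw [Complex.norm_real, Real.norm_eq_abs, abs_of_nonneg (by linarith)]
    have := add_one_le_exp (-(v₀ / 4) * u ^ 2)
    nlinarith
  · apply exp_le_exp.2
    nlinarith
  · have h2 := abs_exp_sub_one_sub_id_le (x := -v * u ^ 2 / 2) (by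
      rw [abs_le]; constructor <;> linarith)
    have e : φ - (exp (-v * u ^ 2 / 2) : ℝ) = (φ - 1 + ((v * u ^ 2 / 2 : ℝ) : ℂ)) -
        ((exp (-v * u ^ 2 / 2) - 1 - (-v * u ^ 2 / 2) : ℝ) : ℂ) := by
      push_cast
      ring
    rw [e]
    refine (norm_sub_le _ _).trans ?_
    rw [Complex.norm_real, Real.norm_eq_abs]
    have h3 : (-v * u ^ 2 / 2) ^ 2 ≤ (1 + C) ^ 2 * |u| ^ 3 := by
      have h4 : v ^ 2 ≤ (1 + C) ^ 2 := by
        have := hv₀pos.le.trans hlow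
        gcongr
      calc (-v * u ^ 2 / 2) ^ 2 = v ^ 2 * |u| ^ 4 / 4 := by rw [husq]; ring
        _ ≤ (1 + C) ^ 2 * |u| ^ 4 / 4 := by gcongr
        _ ≤ (1 + C) ^ 2 * |u| ^ 3 / 4 := by
            have : |u| ^ 4 ≤ |u| ^ 3 := pow_le_pow_of_le_one hu0 huone (by norm_num)
            gcongr
        _ ≤ _ := by
            have : 0 ≤ (1 + C) ^ 2 * |u| ^ 3 := by positivity
            linarith
    nlinarith [pow_nonneg hu0 3]
  · have e : φ - 1 = (φ - 1 + ((v * u ^ 2 / 2 : ℝ) : ℂ)) - ((v * u ^ 2 / 2 : ℝ) : ℂ) := by ring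
    rw [e]
    refine (norm_sub_le _ _).trans ?_
    rw [Complex.norm_real, Real.norm_eq_abs, abs_of_nonneg (by linarith)]
    have h5 : C * |u| ^ 3 ≤ C * |u| ^ 2 := by
      have : |u| ^ 3 ≤ |u| ^ 2 := pow_le_pow_of_le_one hu0 huone (by norm_num)
      gcongr
    have h6 : v * u ^ 2 ≤ (1 + C) * |u| ^ 2 := by
      rw [husq]
      gcongr
    nlinarith [pow_nonneg hu0 2, mul_nonneg (sq_nonneg (1 + C)) (pow_nonneg hu0 2)]

end SplitDensity

section LocalIntegrals

variable {φ : ℝ → ℂ} {ε b L v : ℝ}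

lemma norm_pow_le_exp {u : ℝ} (h : ‖φ u‖ ≤ exp (-b * u ^ 2)) (k : ℕ) :
    ‖φ u‖ ^ k ≤ exp (-(k * b) * u ^ 2) := by
  calc ‖φ u‖ ^ k ≤ exp (-b * u ^ 2) ^ k := by gcongr
    _ = exp (-(k * b) * u ^ 2) := by
      rw [← Real.exp_nat_mul]
      congr 1
      ring

lemma norm_pow_sub_gaussian_le {u : ℝ} (h1 : ‖φ u‖ ≤ exp (-b * u ^ 2))
    (h2 : exp (-v * u ^ 2 / 2) ≤ exp (-b * u ^ 2))
    (h3 : ‖φ u - (exp (-v * u ^ 2 / 2) : ℝ)‖ ≤ L * |u| ^ 3) (k : ℕ) :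
    ‖φ u ^ (k + 1) - ((exp (-((k + 1) * v) * u ^ 2 / 2) : ℝ) : ℂ)‖ ≤
      (k + 1) * L * (|u| ^ 3 * exp (-(k * b) * u ^ 2)) := by
  have e : ((exp (-((k + 1) * v) * u ^ 2 / 2) : ℝ) : ℂ) =
      ((exp (-v * u ^ 2 / 2) : ℝ) : ℂ) ^ (k + 1) := by
    rw [← Complex.ofReal_pow, ← Real.exp_nat_mul]
    congr 2
    push_cast
    ring
  have hB : ‖((exp (-v * u ^ 2 / 2) : ℝ) : ℂ)‖ ≤ exp (-b * u ^ 2) := by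
    rwa [Complex.norm_real, Real.norm_eq_abs, abs_of_pos (exp_pos _)]
  rw [e]
  refine (norm_pow_sub_pow_le h1 hB k).trans ?_
  have e2 : exp (-b * u ^ 2) ^ k = exp (-(k * b) * u ^ 2) := by
    rw [← Real.exp_nat_mul]
    congr 1
    ring
  rw [e2]
  calc ((k : ℝ) + 1) * ‖φ u - ((exp (-v * u ^ 2 / 2) : ℝ) : ℂ)‖ * exp (-(k * b) * u ^ 2)
      ≤ (k + 1) * (L * |u| ^ 3) * exp (-(k * b) * u ^ 2) := by gcongr
    _ = _ := by ring

lemma norm_integral_le_of_le_moment {F : ℝ → ℂ} (hε : 0 ≤ ε) (hb : 0 < b) {A : ℝ} (j : ℕ)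
    (hA : 0 ≤ A) (h : ∀ u, |u| ≤ ε → ‖F u‖ ≤ A * (|u| ^ j * exp (-b * u ^ 2))) :
    ‖∫ u in (-ε)..ε, F u‖ ≤ A * (Gamma ((j + 1) / 2) * b ^ (-((j : ℝ) + 1) / 2)) := by
  have h1 : ‖∫ u in (-ε)..ε, F u‖ ≤ ∫ u in (-ε)..ε, A * (|u| ^ j * exp (-b * u ^ 2)) := by
    refine intervalIntegral.norm_integral_le_of_norm_le (by linarith)
      (Eventually.of_forall fun u hu => h u ?_) (Continuous.intervalIntegrable (by fun_prop) _ _)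
    exact abs_le.2 ⟨hu.1.le, hu.2⟩
  refine h1.trans ?_
  rw [intervalIntegral.integral_const_mul]
  exact mul_le_mul_of_nonneg_left (integral_abs_pow_mul_exp_neg_mul_sq_le hb hε j) hA

/-- Lower bound for the main term of the local limit theorem. -/
lemma le_norm_integral_pow (hφ : Continuous φ) (hε : 0 < ε) (hb : 0 < b) (hL : 0 ≤ L)
    (hvL : v ≤ L) (h1 : ∀ u, |u| ≤ ε → ‖φ u‖ ≤ exp (-b * u ^ 2))
    (h2 : ∀ u, |u| ≤ ε → exp (-v * u ^ 2 / 2) ≤ exp (-b * u ^ 2))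
    (h3 : ∀ u, |u| ≤ ε → ‖φ u - (exp (-v * u ^ 2 / 2) : ℝ)‖ ≤ L * |u| ^ 3) {k : ℕ} (hk : 1 ≤ k)
    (hkε : 1 / √(k + 1 : ℝ) ≤ ε) :
    2 * exp (-L / 2) / √(k + 1 : ℝ) -
        (k + 1) * L * (Gamma ((3 + 1) / 2) * (k * b) ^ (-((3 : ℝ) + 1) / 2)) ≤
      ‖∫ u in (-ε)..ε, φ u ^ (k + 1)‖ := by
  have hk0 : (0 : ℝ) < k := by exact_mod_cast hk
  set G : ℝ → ℝ := fun u => exp (-((k + 1) * v) * u ^ 2 / 2) with hG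
  have hGc : Continuous G := by simp only [hG]; fun_prop
  have hd : ‖∫ u in (-ε)..ε, (φ u ^ (k + 1) - (G u : ℂ))‖ ≤
      (k + 1) * L * (Gamma ((3 + 1) / 2) * (k * b) ^ (-((3 : ℝ) + 1) / 2)) := by
    have := norm_integral_le_of_le_moment (F := fun u => φ u ^ (k + 1) - (G u : ℂ)) hε.le
      (mul_pos hk0 hb) (A := (k + 1) * L) 3 (by positivity)
      fun u hu => norm_pow_sub_gaussian_le (h1 u hu) (h2 u hu) (h3 u hu) k
    exact_mod_cast this
  rw [intervalIntegral.integral_sub (Continuous.intervalIntegrable (by fun_prop) _ _)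
    (Continuous.intervalIntegrable (by fun_prop) _ _), intervalIntegral.integral_ofReal] at hd
  set r : ℝ := 1 / √(k + 1 : ℝ) with hr
  have hr0 : 0 < r := by positivity
  have hlow : 2 * exp (-L / 2) / √(k + 1 : ℝ) ≤ ∫ u in (-ε)..ε, G u := by
    calc 2 * exp (-L / 2) / √(k + 1 : ℝ) = ∫ _ in (-r)..r, exp (-L / 2) := by
          rw [intervalIntegral.integral_const, smul_eq_mul, hr]
          ring
      _ ≤ ∫ u in (-r)..r, G u := by
          refine intervalIntegral.integral_mono_on (by linarith) intervalIntegrable_const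
            (hGc.intervalIntegrable _ _) fun u hu => ?_
          apply exp_le_exp.2
          have hu2 : u ^ 2 ≤ r ^ 2 := sq_le_sq' hu.1 hu.2
          have hr2 : r ^ 2 * (k + 1) = 1 := by
            rw [hr, div_pow, Real.sq_sqrt (by positivity)]
            field_simp
          have hs : (k + 1) * u ^ 2 ≤ 1 := by nlinarith
          have hs0 : 0 ≤ (k + 1) * u ^ 2 := by positivity
          nlinarith
      _ ≤ _ := by
          refine intervalIntegral.integral_mono_interval (by linarith) (by linarith) hkε
            (Eventually.of_forall fun u => (exp_pos _).le) (hGc.intervalIntegrable _ _)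
  have h4 := norm_sub_norm_le ((∫ u in (-ε)..ε, G u : ℝ) : ℂ) (∫ u in (-ε)..ε, φ u ^ (k + 1))
  rw [norm_sub_rev] at h4
  have h5 : (∫ u in (-ε)..ε, G u) ≤ ‖((∫ u in (-ε)..ε, G u : ℝ) : ℂ)‖ := by
    rw [Complex.norm_real]
    exact le_abs_self _
  linarith

/-- The main terms of two consecutive convolution powers almost agree. -/
lemma norm_integral_pow_mul_sub_le (hφ : Continuous φ) (hε : 0 < ε) (hb : 0 < b) (hL : 0 ≤ L)
    (h1 : ∀ u, |u| ≤ ε → ‖φ u‖ ≤ exp (-b * u ^ 2))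
    (h2 : ∀ u, |u| ≤ ε → exp (-v * u ^ 2 / 2) ≤ exp (-b * u ^ 2))
    (h3 : ∀ u, |u| ≤ ε → ‖φ u - (exp (-v * u ^ 2 / 2) : ℝ)‖ ≤ L * |u| ^ 3)
    (h4 : ∀ u, |u| ≤ ε → ‖φ u - 1‖ ≤ L * |u| ^ 2) {k : ℕ} (hk : 1 ≤ k) {X K : ℝ}
    (hX : |X| ≤ K) :
    ‖∫ u in (-ε)..ε, (Complex.exp (Complex.I * ((u * X : ℝ) : ℂ)) - φ u) * φ u ^ (k + 1)‖ ≤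
      K * ((k + 1) * L) * (Gamma ((4 + 1) / 2) * (k * b) ^ (-((4 : ℝ) + 1) / 2)) +
      (3 * K ^ 2 + L) *
        (Gamma ((2 + 1) / 2) * (((k + 1 : ℕ) : ℝ) * b) ^ (-((2 : ℝ) + 1) / 2)) := by
  have hk0 : (0 : ℝ) < k := by exact_mod_cast hk
  have hK : 0 ≤ K := (abs_nonneg X).trans hX
  set G : ℝ → ℝ := fun u => exp (-((k + 1) * v) * u ^ 2 / 2) with hG
  have hGc : Continuous G := by simp only [hG]; fun_prop
  have hodd : ∫ u in (-ε)..ε, Complex.I * ((u * X : ℝ) : ℂ) * (G u : ℂ) = 0 := by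
    have h := intervalIntegral.integral_comp_neg (a := -ε) (b := ε)
      (fun u : ℝ => Complex.I * ((u * X : ℝ) : ℂ) * (G u : ℂ))
    have e : (fun u : ℝ => Complex.I * ((-u * X : ℝ) : ℂ) * (G (-u) : ℂ)) =
        fun u : ℝ => -(Complex.I * ((u * X : ℝ) : ℂ) * (G u : ℂ)) := by
      funext u
      simp [hG]
    rw [e, intervalIntegral.integral_neg, neg_neg] at h
    exact self_eq_neg.1 h.symm
  have hsplit : ∫ u in (-ε)..ε,
      (Complex.exp (Complex.I * ((u * X : ℝ) : ℂ)) - φ u) * φ u ^ (k + 1) =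
      (∫ u in (-ε)..ε, Complex.I * ((u * X : ℝ) : ℂ) * (φ u ^ (k + 1) - (G u : ℂ))) +
      ∫ u in (-ε)..ε, (Complex.exp (Complex.I * ((u * X : ℝ) : ℂ)) - 1 -
        Complex.I * ((u * X : ℝ) : ℂ) - (φ u - 1)) * φ u ^ (k + 1) := by
    have hc1 : Continuous fun u : ℝ =>
        Complex.I * ((u * X : ℝ) : ℂ) * (φ u ^ (k + 1) - (G u : ℂ)) := by fun_prop
    have hc2 : Continuous fun u : ℝ => (Complex.exp (Complex.I * ((u * X : ℝ) : ℂ)) - 1 -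
        Complex.I * ((u * X : ℝ) : ℂ) - (φ u - 1)) * φ u ^ (k + 1) := by fun_prop
    have hc3 : Continuous fun u : ℝ => Complex.I * ((u * X : ℝ) : ℂ) * (G u : ℂ) := by fun_prop
    have hadd := intervalIntegral.integral_add
      ((hc1.intervalIntegrable (μ := volume) (-ε) ε).add (hc2.intervalIntegrable _ _))
      (hc3.intervalIntegrable _ _)
    rw [hodd, add_zero] at hadd
    rw [← intervalIntegral.integral_add (hc1.intervalIntegrable _ _) (hc2.intervalIntegrable _ _),
      ← hadd]
    refine intervalIntegral.integral_congr fun u _ => ?_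
    ring
  rw [hsplit]
  refine (norm_add_le _ _).trans (add_le_add ?_ ?_)
  · refine le_trans (norm_integral_le_of_le_moment hε.le (mul_pos hk0 hb) 4
      (A := K * ((k + 1) * L)) (by positivity) fun u hu => ?_) (le_of_eq (by norm_num))
    rw [norm_mul, norm_mul, Complex.norm_I, one_mul, Complex.norm_real, Real.norm_eq_abs, abs_mul]
    have := norm_pow_sub_gaussian_le (h1 u hu) (h2 u hu) (h3 u hu) k
    calc |u| * |X| * ‖φ u ^ (k + 1) - (G u : ℂ)‖
        ≤ |u| * K * ((k + 1) * L * (|u| ^ 3 * exp (-(k * b) * u ^ 2))) := by gcongr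
      _ = _ := by ring
  · refine le_trans (norm_integral_le_of_le_moment hε.le
      (mul_pos (by positivity : (0 : ℝ) < ((k + 1 : ℕ) : ℝ)) hb) 2
      (A := 3 * K ^ 2 + L) (by positivity) fun u hu => ?_) (le_of_eq (by norm_num))
    rw [norm_mul, norm_pow]
    have e1 := norm_cexp_I_mul_sub_taylor_one_le (u * X)
    have e2 : |u * X| ^ 2 ≤ |u| ^ 2 * K ^ 2 := by
      rw [abs_mul, mul_pow]
      gcongr
    have e3 : ‖Complex.exp (Complex.I * ((u * X : ℝ) : ℂ)) - 1 -
        Complex.I * ((u * X : ℝ) : ℂ) - (φ u - 1)‖ ≤ (3 * K ^ 2 + L) * |u| ^ 2 := by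
      refine (norm_sub_le _ _).trans ?_
      nlinarith [h4 u hu]
    have e4 := norm_pow_le_exp (h1 u hu) (k + 1)
    calc _ ≤ (3 * K ^ 2 + L) * |u| ^ 2 * exp (-(((k + 1 : ℕ) : ℝ) * b) * u ^ 2) := by gcongr
      _ = _ := by ring

end LocalIntegrals

namespace SplitDensity

variable {f₁ f₂ : ℝ → ℝ} {M C ε ρ : ℝ}

lemma cf_eq_add (H : SplitDensity f₁ f₂ M C) (u : ℝ) :
    cf (fun x => f₁ x + f₂ x) u = cf f₁ u + cf f₂ u :=
  cf_add H.integrable₁ H.integrable₂ u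

lemma norm_cf_add_le_one (H : SplitDensity f₁ f₂ M C) (u : ℝ) : ‖cf f₁ u + cf f₂ u‖ ≤ 1 :=
  (norm_add_le _ _).trans
    ((add_le_add (norm_cf_le H.nonneg₁ u) (norm_cf_le H.nonneg₂ u)).trans H.mass.le)

lemma norm_cf₁_le (H : SplitDensity f₁ f₂ M C) (u : ℝ) : ‖cf f₁ u‖ ≤ 1 / 4 :=
  (norm_cf_le H.nonneg₁ u).trans H.mass₁

lemma integrable_cf_regPart (H : SplitDensity f₁ f₂ M C) (j : ℕ) :
    Integrable (cf (regPart f₁ f₂ j)) := by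
  have h2 := (integrable_norm_cf_sq H.integrable₂ H.nonneg₂ H.le₂ H.integral₂_le).1
  refine (h2.const_mul ((j : ℝ) ^ 2)).mono'
    (continuous_cf (integrable_regPart H.integrable₁ H.integrable₂ j)).aestronglyMeasurable
    (Eventually.of_forall fun u => ?_)
  have := norm_cf_regPart_le H.integrable₁ H.integrable₂ (H.norm_cf_add_le_one u)
    ((H.norm_cf₁_le u).trans (by norm_num)) j
  simpa using this

/-- Local Fourier representation of the convolution powers of a split density, with an
exponentially small error. -/
lemma norm_convPow_sub_integral_le (H : SplitDensity f₁ f₂ M C) (hε : 0 < ε) (hρ : 1 / 2 ≤ ρ)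
    (hρ1 : ρ < 1) (hcf : ∀ u, ε ≤ |u| → ‖cf f₁ u + cf f₂ u‖ ≤ ρ) (j : ℕ) {x : ℝ}
    (hx : -((j : ℝ) + 2) < x) :
    ‖((2 * π * convPow (fun x => f₁ x + f₂ x) (j + 2) x : ℝ) : ℂ) -
      ∫ u in (-ε)..ε, Complex.exp (-(Complex.I * ((u * x : ℝ) : ℂ))) *
        cf (fun x => f₁ x + f₂ x) u ^ (j + 2)‖ ≤
      (2 * π * M + 2 * ε + exp 1 * (2 * π * M)) * ((j + 3) ^ 2 * ρ ^ j) := by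
  have hρ0 : 0 < ρ := by linarith
  have hM := H.pos
  set P := regPart f₁ f₂ (j + 1) with hP
  set E : ℝ → ℂ := fun u => Complex.exp (-(Complex.I * ((u * x : ℝ) : ℂ))) with hE
  have hEc : Continuous E := by simp only [hE]; fun_prop
  have hEn : ∀ u, ‖E u‖ = 1 := fun u => by
    simp only [hE]
    rw [← mul_neg, ← Complex.ofReal_neg, Complex.norm_exp_I_mul_ofReal]
  set φ := cf (fun x => f₁ x + f₂ x) with hφ
  have hφc : Continuous φ := continuous_cf H.integrable
  have hPc : Continuous (cf P) := continuous_cf (integrable_regPart H.integrable₁ H.integrable₂ _)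
  have hconv := convPow_eq_of_lt H.nonneg₁ H.nonneg₂ H.integrable₁ H.integrable₂ H.le₂
    (b := -1) H.support₁ j (x := x) (by linarith)
  have hinv := continuous_integrable_inversion
    (integrable_regPart H.integrable₁ H.integrable₂ (j + 1))
    (continuous_regPart H.nonneg₁ H.nonneg₂ H.integrable₁ H.integrable₂ H.le₂ (j + 1))
    (H.integrable_cf_regPart (j + 1)) x
  rw [← hP] at hinv
  have hEP : Integrable fun u => E u * cf P u :=
    (H.integrable_cf_regPart (j + 1)).bdd_mul (c := 1) hEc.aestronglyMeasurable
      (Eventually.of_forall fun u => (hEn u).le)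
  have hsplit : ∫ u, E u * cf P u = (∫ u in (-ε)..ε, E u * cf P u) +
      ∫ u in (Ioc (-ε) ε)ᶜ, E u * cf P u := by
    rw [intervalIntegral.integral_of_le (by linarith), integral_add_compl measurableSet_Ioc hEP]
  have hdiff : ∫ u in (-ε)..ε, E u * cf P u = (∫ u in (-ε)..ε, E u * φ u ^ (j + 2)) +
      ∫ u in (-ε)..ε, E u * (cf P u - φ u ^ (j + 2)) := by
    rw [← intervalIntegral.integral_add (Continuous.intervalIntegrable (by fun_prop) _ _)
      (Continuous.intervalIntegrable (by fun_prop) _ _)]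
    refine intervalIntegral.integral_congr fun u _ => ?_
    ring
  have hmix : ‖((2 * π * mixPart f₁ f₂ (j + 1) x : ℝ) : ℂ)‖ ≤
      2 * π * M * ((j + 3) ^ 2 * ρ ^ j) := by
    have h1 := mixPart_le H.nonneg₁ H.nonneg₂ H.integrable₁ H.integrable₂ H.le₂ (j + 1) x
    have h0 := mixPart_nonneg H.nonneg₁ H.nonneg₂ (j + 1) x
    rw [Complex.norm_real, Real.norm_eq_abs, abs_of_nonneg (by positivity), mul_assoc (2 * π)]
    refine mul_le_mul_of_nonneg_left (h1.trans ?_) (by positivity)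
    have h3 : (∫ y, f₁ y) ^ (j + 1) ≤ ρ ^ j := by
      have := H.integral₁_nonneg
      calc (∫ y, f₁ y) ^ (j + 1) ≤ ρ ^ (j + 1) := by
            gcongr
            linarith [H.mass₁]
        _ ≤ ρ ^ j := pow_le_pow_of_le_one hρ0.le hρ1.le (Nat.le_succ j)
    push_cast
    have hj : (0 : ℝ) ≤ j := Nat.cast_nonneg j
    have hp : 0 ≤ (∫ y, f₁ y) ^ (j + 1) := pow_nonneg H.integral₁_nonneg _
    calc ((j : ℝ) + 1 + 1) * M * (∫ y, f₁ y) ^ (j + 1) ≤ ((j : ℝ) + 3) ^ 2 * M * ρ ^ j := by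
          gcongr
          nlinarith
      _ = _ := by ring
  have hin : ‖∫ u in (-ε)..ε, E u * (cf P u - φ u ^ (j + 2))‖ ≤
      2 * ε * ((j + 3) ^ 2 * ρ ^ j) := by
    have : ∀ u ∈ uIoc (-ε) ε, ‖E u * (cf P u - φ u ^ (j + 2))‖ ≤ (j + 3) ^ 2 * ρ ^ j := by
      intro u _
      have e : cf P u - φ u ^ (j + 2) = -(cf f₁ u ^ (j + 2) +
          (((j + 2 : ℕ) : ℂ)) * cf f₂ u * cf f₁ u ^ (j + 1)) := by
        rw [hP, cf_regPart H.integrable₁ H.integrable₂, hφ, H.cf_eq_add]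
        push_cast
        ring
      rw [norm_mul, hEn, one_mul, e, norm_neg]
      refine (norm_add_le _ _).trans ?_
      rw [norm_mul, norm_mul, norm_pow, norm_pow, Complex.norm_natCast]
      have h1 : ‖cf f₁ u‖ ≤ ρ := (H.norm_cf₁_le u).trans (by linarith)
      have h2 : ‖cf f₂ u‖ ≤ 1 := (norm_cf_le H.nonneg₂ u).trans H.integral₂_le
      have h3 : ‖cf f₁ u‖ ^ (j + 2) ≤ ρ ^ j :=
        (pow_le_pow_left₀ (norm_nonneg _) h1 _).trans
          (pow_le_pow_of_le_one hρ0.le hρ1.le (by lia))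
      have h4 : ‖cf f₁ u‖ ^ (j + 1) ≤ ρ ^ j :=
        (pow_le_pow_left₀ (norm_nonneg _) h1 _).trans
          (pow_le_pow_of_le_one hρ0.le hρ1.le (by lia))
      have hj : (0 : ℝ) ≤ j := Nat.cast_nonneg j
      calc ‖cf f₁ u‖ ^ (j + 2) + ((j + 2 : ℕ) : ℝ) * ‖cf f₂ u‖ * ‖cf f₁ u‖ ^ (j + 1)
          ≤ ρ ^ j + ((j + 2 : ℕ) : ℝ) * 1 * ρ ^ j := by gcongr
        _ = ((j : ℝ) + 3) * ρ ^ j := by push_cast; ring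
        _ ≤ _ := by
          gcongr
          nlinarith
    refine (intervalIntegral.norm_integral_le_of_norm_le_const this).trans (le_of_eq ?_)
    rw [abs_of_pos (by linarith)]
    ring
  have hout : ‖∫ u in (Ioc (-ε) ε)ᶜ, E u * cf P u‖ ≤
      exp 1 * (2 * π * M) * ((j + 3) ^ 2 * ρ ^ j) := by
    obtain ⟨hsq, hsqle⟩ := integrable_norm_cf_sq H.integrable₂ H.nonneg₂ H.le₂ H.integral₂_le
    have hb : ∀ u ∈ (Ioc (-ε) ε)ᶜ, ‖E u * cf P u‖ ≤ (j + 3) ^ 2 * ρ ^ j * ‖cf f₂ u‖ ^ 2 := by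
      intro u hu
      have hεu : ε ≤ |u| := by
        by_contra! hlt
        rw [abs_lt] at hlt
        exact hu ⟨hlt.1, hlt.2.le⟩
      rw [norm_mul, hEn, one_mul]
      have h1 := norm_cf_regPart_le H.integrable₁ H.integrable₂ (hcf u hεu)
        ((H.norm_cf₁_le u).trans (by linarith)) (j + 1)
      have h2 : ρ * ‖cf P u‖ ≤ ρ * (((j + 1 : ℕ) : ℝ) ^ 2 * ρ ^ j * ‖cf f₂ u‖ ^ 2) := by
        refine h1.trans (le_of_eq ?_)
        ring
      refine (le_of_mul_le_mul_left h2 hρ0).trans ?_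
      gcongr
      push_cast
      linarith
    refine (norm_integral_le_of_norm_le (hsq.const_mul _).integrableOn
      ((ae_restrict_iff' measurableSet_Ioc.compl).2 (Eventually.of_forall hb))).trans ?_
    rw [integral_const_mul, mul_comm]
    refine mul_le_mul_of_nonneg_right ?_ (by positivity)
    exact (setIntegral_le_integral hsq (Eventually.of_forall fun u => by positivity)).trans hsqle
  have hfin : ((2 * π * convPow (fun x => f₁ x + f₂ x) (j + 2) x : ℝ) : ℂ) -
      ∫ u in (-ε)..ε, E u * φ u ^ (j + 2) = ((2 * π * mixPart f₁ f₂ (j + 1) x : ℝ) : ℂ) +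
      (∫ u in (-ε)..ε, E u * (cf P u - φ u ^ (j + 2))) +
      ∫ u in (Ioc (-ε) ε)ᶜ, E u * cf P u := by
    rw [hconv, mul_add, Complex.ofReal_add, hinv]
    change _ + (∫ u, E u * cf P u) - _ = _
    rw [hsplit, hdiff]
    ring
  change ‖_ - ∫ u in (-ε)..ε, E u * φ u ^ (j + 2)‖ ≤ _
  rw [hfin]
  refine (norm_add_le _ _).trans ?_
  have := norm_add_le ((2 * π * mixPart f₁ f₂ (j + 1) x : ℝ) : ℂ)
    (∫ u in (-ε)..ε, E u * (cf P u - φ u ^ (j + 2)))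
  linarith

end SplitDensity

lemma convPow_nonneg {f : ℝ → ℝ} (hf : ∀ x, 0 ≤ f x) (n : ℕ) (x : ℝ) : 0 ≤ convPow f n x := by
  induction n using Nat.twoStepInduction generalizing x with
  | zero => exact le_rfl
  | one => exact hf x
  | more n _ ih => exact integral_nonneg fun y => mul_nonneg (hf y) (ih _)

lemma mul_rpow_neg_le {x b N s : ℝ} (hb : 0 < b) (hN : 0 < N) (hx : N / 3 ≤ x) (hs : 0 ≤ s) :
    (x * b) ^ (-s) ≤ (b / 3) ^ (-s) * N ^ (-s) := by
  rw [← Real.mul_rpow (by positivity) hN.le]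
  refine Real.rpow_le_rpow_of_nonpos (by positivity) ?_ (by linarith)
  nlinarith

lemma eventually_geometric_le {ρ : ℝ} (hρ0 : 0 < ρ) (hρ1 : ρ < 1) :
    ∀ᶠ k : ℕ in atTop, ((k : ℝ) + 3) ^ 2 * ρ ^ k ≤ ρ / ((k : ℝ) + 3) ^ 2 := by
  have h := tendsto_pow_const_mul_const_pow_of_abs_lt_one 4
    (by rwa [abs_of_pos hρ0] : |ρ| < 1)
  have h' := (tendsto_add_atTop_iff_nat 3).2 h
  filter_upwards [h'.eventually (gt_mem_nhds (by positivity : (0 : ℝ) < ρ ^ 4))] with k hk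
  rw [le_div_iff₀ (by positivity)]
  push_cast at hk
  have h2 : ρ ^ 3 * (((k : ℝ) + 3) ^ 2 * ρ ^ k * ((k : ℝ) + 3) ^ 2) ≤ ρ ^ 3 * ρ := by
    calc _ = ((k : ℝ) + 3) ^ 4 * ρ ^ (k + 3) := by ring
      _ ≤ ρ ^ 4 := hk.le
      _ = _ := by ring
  exact le_of_mul_le_mul_left h2 (by positivity)

lemma le_and_abs_sub_le_of_norm_sub_le {A B c D₀ D₁ E₀ N : ℝ} {I₁ I₂ I : ℂ} (hN : 1 ≤ N)
    (hc : 0 < c) (hE₀ : 0 ≤ E₀) (hB : 0 ≤ B) (hI : I = I₁ - I₂)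
    (h₁ : ‖(A : ℂ) - I₁‖ ≤ E₀ * (1 / (N * √N))) (h₂ : ‖(B : ℂ) - I₂‖ ≤ E₀ * (1 / (N * √N)))
    (hI' : ‖I‖ ≤ (D₀ - 2 * E₀) * (1 / (N * √N)))
    (hlow : c / √N - (D₁ - E₀) * (1 / N) ≤ ‖I₂‖) (hs : 2 * D₁ / c ≤ √N) :
    c / √N / 2 ≤ B ∧ |A - B| ≤ 2 * D₀ / c / N * B := by
  have hN0 : 0 < N := by linarith
  have hs0 : 0 < √N := Real.sqrt_pos.2 hN0
  have hs1 : 1 ≤ √N := Real.one_le_sqrt.2 hN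
  have hsq : √N * √N = N := Real.mul_self_sqrt hN0.le
  have hBlow : c / √N / 2 ≤ B := by
    have h1 := norm_sub_norm_le I₂ (B : ℂ)
    rw [norm_sub_rev, Complex.norm_real, Real.norm_eq_abs, abs_of_nonneg hB] at h1
    have h2 : 1 / (N * √N) ≤ 1 / N := by
      gcongr
      nlinarith
    have h3 : D₁ * (1 / N) ≤ c / √N / 2 := by
      rw [div_le_iff₀ hc] at hs
      have e : D₁ * (1 / N) = D₁ / √N / √N := by rw [div_div, hsq]; ring
      have e' : c / √N / 2 = c / 2 / √N := by ring
      rw [e, e']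
      refine div_le_div_of_nonneg_right ?_ hs0.le
      rw [div_le_iff₀ hs0]
      linarith
    have h4 := mul_le_mul_of_nonneg_left h2 hE₀
    linarith
  refine ⟨hBlow, ?_⟩
  have hAB : |A - B| ≤ D₀ * (1 / (N * √N)) := by
    rw [← Real.norm_eq_abs, ← Complex.norm_real]
    have e : ((A - B : ℝ) : ℂ) = ((A : ℂ) - I₁) - ((B : ℂ) - I₂) + I := by
      rw [hI, Complex.ofReal_sub]
      ring
    rw [e]
    have h3 := norm_add_le (((A : ℂ) - I₁) - ((B : ℂ) - I₂)) I
    have h4 := norm_sub_le ((A : ℂ) - I₁) ((B : ℂ) - I₂)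
    linarith
  have hD₀ : 0 ≤ D₀ := by
    have : 0 < 1 / (N * √N) := by positivity
    exact nonneg_of_mul_nonneg_left ((abs_nonneg _).trans hAB) this
  refine hAB.trans ?_
  calc D₀ * (1 / (N * √N)) = 2 * D₀ / c / N * (c / √N / 2) := by field_simp
    _ ≤ _ := by gcongr

set_option maxHeartbeats 1000000 in
/-- Uniform local limit comparison of two consecutive convolution powers of a split density. -/
theorem SplitDensity.exists_convPow_sub_le (M C K : ℝ) (hM : 0 < M) (hC : 0 ≤ C) (hK : 0 ≤ K) :
    ∃ (A : ℝ) (N₀ : ℕ), 0 ≤ A ∧ ∀ f₁ f₂, SplitDensity f₁ f₂ M C → ∀ n ≥ N₀, ∀ X : ℝ, |X| ≤ K →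
      0 < convPow (fun x => f₁ x + f₂ x) n 0 ∧
      |convPow (fun x => f₁ x + f₂ x) (n - 1) (-X) - convPow (fun x => f₁ x + f₂ x) n 0| ≤
        A / n * convPow (fun x => f₁ x + f₂ x) n 0 := by
  obtain ⟨ε, b, L, hε, hb, hL, hloc⟩ := SplitDensity.exists_cf_local M C hM hC
  obtain ⟨ρ, hρ, hρ1, hcf⟩ := SplitDensity.exists_norm_cf_le M C ε hε
  have hρ0 : 0 < ρ := by linarith
  set E₀ : ℝ := 2 * π * M + 2 * ε + exp 1 * (2 * π * M) with hE₀
  have hE₀0 : 0 ≤ E₀ := by positivity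
  set D₁ : ℝ := L * (Gamma ((3 + 1) / 2) * (b / 3) ^ (-(2 : ℝ))) + E₀ with hD₁
  set D₀ : ℝ := K * L * (Gamma ((4 + 1) / 2) * (b / 3) ^ (-(5 / 2 : ℝ))) +
    (3 * K ^ 2 + L) * (Gamma ((2 + 1) / 2) * (b / 3) ^ (-(3 / 2 : ℝ))) + 2 * E₀ with hD₀
  have hG4 : 0 < Gamma ((3 + 1) / 2) := Gamma_pos_of_pos (by norm_num)
  have hG5 : 0 < Gamma ((4 + 1) / 2) := Gamma_pos_of_pos (by norm_num)
  have hG3 : 0 < Gamma ((2 + 1) / 2) := Gamma_pos_of_pos (by norm_num)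
  have hD₁0 : 0 ≤ D₁ := by positivity
  have hD₀0 : 0 ≤ D₀ := by positivity
  set c₁ : ℝ := 2 * exp (-L / 2) with hc₁
  have hc₁0 : 0 < c₁ := by positivity
  have hsqrt : Tendsto (fun k : ℕ => √((k : ℝ) + 2)) atTop atTop :=
    Real.tendsto_sqrt_atTop.comp
      (tendsto_atTop_add_const_right _ _ tendsto_natCast_atTop_atTop)
  have hev := (eventually_geometric_le hρ0 hρ1).and
    ((hsqrt.eventually_ge_atTop (1 / ε)).and (hsqrt.eventually_ge_atTop (2 * D₁ / c₁)))
  obtain ⟨N₁, hN₁⟩ := eventually_atTop.1 hev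
  refine ⟨2 * D₀ / c₁, N₁ + 4 + ⌈K⌉₊, by positivity, fun f₁ f₂ H n hn X hX => ?_⟩
  obtain ⟨k, rfl⟩ : ∃ k, n = k + 3 := ⟨n - 3, by lia⟩
  obtain ⟨v, -, hvL, hv⟩ := hloc f₁ f₂ H
  set f : ℝ → ℝ := fun x => f₁ x + f₂ x with hf
  set φ := cf f with hφ
  have hφc : Continuous φ := continuous_cf H.integrable
  set N : ℝ := (k : ℝ) + 3 with hN
  have hk0 : (0 : ℝ) ≤ k := Nat.cast_nonneg k
  have hNpos : 0 < N := by positivity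
  have hNn : ((k + 3 : ℕ) : ℝ) = N := by push_cast; rfl
  have hk1 : (1 : ℝ) ≤ k := by
    have : 1 ≤ k := by lia
    exact_mod_cast this
  obtain ⟨hgeo, -, -⟩ := hN₁ k (by lia)
  obtain ⟨hgeo', hs1, hs2⟩ := hN₁ (k + 1) (by lia)
  push_cast at hgeo' hs1 hs2
  have hsN : √((k : ℝ) + 1 + 2) = √N := by rw [hN]; congr 1; ring
  rw [hsN] at hs1 hs2
  have hsNpos : 0 < √N := Real.sqrt_pos.2 hNpos
  have hsq : √N * √N = N := Real.mul_self_sqrt hNpos.le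
  have hr2 : N ^ (-(2 : ℝ)) = 1 / (N * N) := by
    rw [Real.rpow_neg hNpos.le, Real.rpow_two, one_div, sq]
  have hr32 : N ^ (-(3 / 2 : ℝ)) = 1 / (N * √N) := by
    rw [Real.rpow_neg hNpos.le, one_div, Real.sqrt_eq_rpow]
    congr 1
    nth_rw 2 [← Real.rpow_one N]
    rw [← Real.rpow_add hNpos]
    norm_num
  have hr52 : N ^ (-(5 / 2 : ℝ)) = 1 / (N * N * √N) := by
    rw [Real.rpow_neg hNpos.le, one_div, Real.sqrt_eq_rpow]
    congr 1
    rw [← sq, ← Real.rpow_two, ← Real.rpow_add hNpos]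
    norm_num
  have hsNle : √N ≤ N := by
    have : 1 ≤ √N := Real.one_le_sqrt.2 (by linarith)
    nlinarith
  have err1 : ∀ x : ℝ, -((k : ℝ) + 2) < x →
      ‖((2 * π * convPow f (k + 2) x : ℝ) : ℂ) - ∫ u in (-ε)..ε,
        Complex.exp (-(Complex.I * ((u * x : ℝ) : ℂ))) * φ u ^ (k + 2)‖ ≤ E₀ * (1 / (N * √N)) := by
    intro x hx
    refine (H.norm_convPow_sub_integral_le hε hρ hρ1 (hcf f₁ f₂ H) k hx).trans ?_
    refine mul_le_mul_of_nonneg_left (hgeo.trans ?_) hE₀0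
    calc ρ / ((k : ℝ) + 3) ^ 2 ≤ 1 / N ^ 2 := by gcongr
      _ ≤ _ := by rw [sq]; gcongr
  have err2 : ‖((2 * π * convPow f (k + 3) 0 : ℝ) : ℂ) - ∫ u in (-ε)..ε, φ u ^ (k + 3)‖ ≤
      E₀ * (1 / (N * √N)) := by
    have h := H.norm_convPow_sub_integral_le hε hρ hρ1 (hcf f₁ f₂ H) (k + 1) (x := 0)
      (by push_cast; linarith)
    simp only [mul_zero, Complex.ofReal_zero, neg_zero, Complex.exp_zero, one_mul] at h
    refine h.trans ?_
    push_cast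
    refine mul_le_mul_of_nonneg_left (hgeo'.trans ?_) hE₀0
    calc ρ / ((k : ℝ) + 1 + 3) ^ 2 ≤ 1 / N ^ 2 := by
          gcongr
          linarith
      _ ≤ _ := by rw [sq]; gcongr
  have hKk : K ≤ (k : ℝ) + 1 := by
    have h1 := Nat.le_ceil K
    have h2 : ⌈K⌉₊ ≤ k + 1 := by lia
    have h3 : ((⌈K⌉₊ : ℕ) : ℝ) ≤ ((k + 1 : ℕ) : ℝ) := by exact_mod_cast h2
    push_cast at h3
    linarith
  have err1X := err1 (-X) (by linarith [le_abs_self X])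
  have hlow := le_norm_integral_pow hφc hε hb hL hvL (fun u hu => (hv u hu).1)
    (fun u hu => (hv u hu).2.1) (fun u hu => (hv u hu).2.2.1) (k := k + 2) (by lia) (by
      have e : ((k + 2 : ℕ) : ℝ) + 1 = N := by push_cast; rw [hN]; ring
      rw [e, div_le_iff₀ hsNpos]
      rwa [div_le_iff₀' hε] at hs1)
  have e1 : ((k + 2 : ℕ) : ℝ) + 1 = N := by push_cast; rw [hN]; ring
  have g4 := mul_rpow_neg_le (x := ((k + 2 : ℕ) : ℝ)) (s := 2) hb hNpos
    (by push_cast; linarith) (by norm_num)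
  have ex1 : -((3 : ℝ) + 1) / 2 = -(2 : ℝ) := by norm_num
  rw [ex1, e1] at hlow
  rw [hr2] at g4
  have hdiff := norm_integral_pow_mul_sub_le hφc hε hb hL (fun u hu => (hv u hu).1)
    (fun u hu => (hv u hu).2.1) (fun u hu => (hv u hu).2.2.1) (fun u hu => (hv u hu).2.2.2)
    (k := k + 1) (by lia) hX
  have g5 := mul_rpow_neg_le (x := ((k + 1 : ℕ) : ℝ)) (s := 5 / 2) hb hNpos
    (by push_cast; linarith) (by norm_num)
  have g3 := mul_rpow_neg_le (x := ((k + 1 + 1 : ℕ) : ℝ)) (s := 3 / 2) hb hNpos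
    (by push_cast; linarith) (by norm_num)
  have ex2 : -((4 : ℝ) + 1) / 2 = -(5 / 2 : ℝ) := by norm_num
  have ex3 : -((2 : ℝ) + 1) / 2 = -(3 / 2 : ℝ) := by norm_num
  rw [ex2, ex3] at hdiff
  rw [hr52] at g5
  rw [hr32] at g3
  set r : ℝ := 1 / (N * √N) with hr
  have hr0 : 0 < r := by positivity
  have main_diff : ‖∫ u in (-ε)..ε,
      (Complex.exp (Complex.I * ((u * X : ℝ) : ℂ)) - φ u) * φ u ^ (k + 1 + 1)‖ ≤
      (D₀ - 2 * E₀) * r := by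
    refine hdiff.trans ?_
    have e2 : ((k + 1 : ℕ) : ℝ) + 1 ≤ N := by push_cast; rw [hN]; linarith
    calc _ ≤ K * (N * L) * (Gamma ((4 + 1) / 2) *
            ((b / 3) ^ (-(5 / 2 : ℝ)) * (1 / (N * N * √N)))) +
          (3 * K ^ 2 + L) * (Gamma ((2 + 1) / 2) * ((b / 3) ^ (-(3 / 2 : ℝ)) * r)) := by
          gcongr
      _ = _ := by
          rw [hD₀, hr]
          field_simp
          ring
  have main_low : c₁ / √N - (D₁ - E₀) * (1 / N) ≤ ‖∫ u in (-ε)..ε, φ u ^ (k + 3)‖ := by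
    refine le_trans ?_ hlow
    refine sub_le_sub le_rfl ?_
    calc _ ≤ N * L * (Gamma ((3 + 1) / 2) * ((b / 3) ^ (-(2 : ℝ)) * (1 / (N * N)))) := by gcongr
      _ = _ := by
          rw [hD₁]
          field_simp
          ring
  have hB0 : 0 ≤ 2 * π * convPow f (k + 3) 0 :=
    mul_nonneg (by positivity) (convPow_nonneg H.nonneg _ _)
  have hsub : ∫ u in (-ε)..ε,
      (Complex.exp (Complex.I * ((u * X : ℝ) : ℂ)) - φ u) * φ u ^ (k + 1 + 1) =
      (∫ u in (-ε)..ε, Complex.exp (-(Complex.I * ((u * -X : ℝ) : ℂ))) * φ u ^ (k + 2)) -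
        ∫ u in (-ε)..ε, φ u ^ (k + 3) := by
    have hc1 : Continuous fun u : ℝ =>
        Complex.exp (-(Complex.I * ((u * -X : ℝ) : ℂ))) * φ u ^ (k + 2) := by fun_prop
    have hc2 : Continuous fun u : ℝ => φ u ^ (k + 3) := by fun_prop
    rw [← intervalIntegral.integral_sub (hc1.intervalIntegrable _ _) (hc2.intervalIntegrable _ _)]
    refine intervalIntegral.integral_congr fun u _ => ?_
    simp only [mul_neg, Complex.ofReal_neg, neg_neg]
    ring
  obtain ⟨hBlow, hAB⟩ := le_and_abs_sub_le_of_norm_sub_le (by linarith : 1 ≤ N) hc₁0 hE₀0 hB0 hsub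
    err1X err2 main_diff main_low hs2
  rw [hNn]
  have hπ : 0 < 2 * π := by positivity
  have hBpos : 0 < 2 * π * convPow f (k + 3) 0 := lt_of_lt_of_le (by positivity) hBlow
  refine ⟨pos_of_mul_pos_right hBpos hπ.le, ?_⟩
  refine le_of_mul_le_mul_left ?_ hπ
  rw [← abs_of_pos hπ, ← abs_mul, abs_of_pos hπ, mul_sub]
  exact hAB.trans (le_of_eq (by ring))

lemma integral_comp_add_mul (F : ℝ → ℝ) (a : ℝ) {σ : ℝ} (hσ : 0 < σ) :
    ∫ x, F (a + σ * x) = σ⁻¹ * ∫ x, F x := by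
  rw [Measure.integral_comp_mul_left (fun x => F (a + x)) σ, integral_add_left_eq_self,
    abs_of_pos (inv_pos.2 hσ), smul_eq_mul]

lemma integrable_comp_add_mul_iff (F : ℝ → ℝ) (a : ℝ) {σ : ℝ} (hσ : 0 < σ) :
    Integrable (fun x => F (a + σ * x)) ↔ Integrable F := by
  rw [integrable_comp_mul_left_iff (fun x => F (a + x)) hσ.ne']
  exact ⟨fun h => by simpa using h.comp_add_left (-a), fun h => h.comp_add_left a⟩

/-- Convolution powers commute with exponential tilting and affine rescaling. -/
lemma convPow_affine_tilt (p : ℝ → ℝ) (A t a : ℝ) {σ : ℝ} (hσ : 0 < σ) (k : ℕ) (x : ℝ) :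
    convPow (fun x => A * (exp (t * (a + σ * x)) * p (a + σ * x))) (k + 1) x =
      A ^ (k + 1) / σ ^ k * (exp (t * ((k + 1) * a + σ * x)) *
        convPow p (k + 1) ((k + 1) * a + σ * x)) := by
  induction k generalizing x with
  | zero => simp [convPow]
  | succ k ih =>
    simp only [convPow, ih]
    push_cast
    have e : ∀ y : ℝ, A * (exp (t * (a + σ * y)) * p (a + σ * y)) *
        (A ^ (k + 1) / σ ^ k * (exp (t * ((k + 1) * a + σ * (x - y))) *
          convPow p (k + 1) ((k + 1) * a + σ * (x - y)))) =
        A ^ (k + 2) / σ ^ k * exp (t * ((k + 1 + 1) * a + σ * x)) *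
          (p (a + σ * y) * convPow p (k + 1) ((k + 1 + 1) * a + σ * x - (a + σ * y))) := by
      intro y
      have e1 : (k + 1 + 1) * a + σ * x - (a + σ * y) = (k + 1) * a + σ * (x - y) := by ring
      have e2 : t * ((k + 1 + 1) * a + σ * x) =
        t * (a + σ * y) + t * ((k + 1) * a + σ * (x - y)) := by ring
      rw [e1, e2, exp_add]
      ring
    simp only [e]
    rw [integral_const_mul, integral_comp_add_mul
      (fun z => p z * convPow p (k + 1) ((k + 1 + 1) * a + σ * x - z)) a hσ]
    generalize ∫ z, p z * convPow p (k + 1) ((k + 1 + 1) * a + σ * x - z) = I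
    rw [pow_succ σ, div_mul_eq_div_div_swap]
    ring

/-- The conditional density as a perturbation of the tilted one. -/
lemma condDensity_eq_tilt_mul {p f : ℝ → ℝ} {a : ℕ → ℝ} {t σ : ℝ} {n : ℕ} (hn : 2 ≤ n) (hσ : 0 < σ)
    (hΦ : 0 < mgfFun p t) (hf : f = fun x => σ * tilt p t (a n + σ * x)) (y : ℝ) :
    condDensity p a n y =
      tilt p t y * (convPow f (n - 1) (-((y - a n) / σ)) / convPow f n 0) := by
  obtain ⟨k, rfl⟩ : ∃ k, n = k + 2 := ⟨n - 2, by lia⟩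
  set b := a (k + 2) with hb
  have hf' : f = fun x => (σ / mgfFun p t) * (exp (t * (b + σ * x)) * p (b + σ * x)) := by
    rw [hf]
    funext x
    simp only [tilt]
    ring
  have e1 : ((k : ℝ) + 1) * b + σ * -((y - b) / σ) = (k + 2) * b - y := by
    field_simp
    ring
  rw [hf', show k + 2 - 1 = k + 1 from rfl, convPow_affine_tilt p _ t b hσ k, e1,
    show k + 2 = k + 1 + 1 from rfl, convPow_affine_tilt p _ t b hσ (k + 1)]
  simp only [condDensity, tilt]
  push_cast
  have e2 : ((k : ℝ) + 1 + 1) * b + σ * 0 = (k + 2) * b := by ring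
  have e3 : (k : ℝ) + 1 + 1 = k + 2 := by ring
  rw [e2, e3, mul_sub, exp_sub]
  have h1 := (exp_pos (t * ((k + 2) * b))).ne'
  have h2 := (exp_pos (t * y)).ne'
  rw [hb]
  by_cases hP : convPow p (k + 1 + 1) ((k + 2) * a (k + 2)) = 0
  · simp [hP]
  · rw [div_pow, div_pow]
    field_simp
    ring

lemma integral_condDensity_eq_one {p : ℝ → ℝ} {a : ℕ → ℝ} {n : ℕ} (hn : 2 ≤ n)
    (h : convPow p n (n * a n) ≠ 0) : ∫ y, condDensity p a n y = 1 := by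
  obtain ⟨k, rfl⟩ : ∃ k, n = k + 2 := ⟨n - 2, by lia⟩
  simp only [condDensity]
  rw [integral_div, div_eq_one_iff_eq h]
  rfl

lemma setIntegral_condDensity_le {p f₁ f₂ : ℝ → ℝ} {a : ℕ → ℝ} {t σ M C K A δ : ℝ} {n : ℕ}
    (hn : 2 ≤ n) (hσ : 0 < σ) (hΦ : 0 < mgfFun p t) (hp0 : ∀ x < 0, p x = 0)
    (hp : ∀ x, 0 ≤ x → 0 < p x) (H : SplitDensity f₁ f₂ M C)
    (hf : (fun x => f₁ x + f₂ x) = fun x => σ * tilt p t (a n + σ * x)) (hK : 0 < K)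
    (hA1 : A / n ≤ 1) (hAδ : A / n ≤ δ)
    (hconv : ∀ X : ℝ, |X| ≤ K → 0 < convPow (fun x => f₁ x + f₂ x) n 0 ∧
      |convPow (fun x => f₁ x + f₂ x) (n - 1) (-X) - convPow (fun x => f₁ x + f₂ x) n 0| ≤
        A / n * convPow (fun x => f₁ x + f₂ x) n 0) :
    ∫ y in {y : ℝ | δ < |condDensity p a n y / tilt p t y - 1|}, condDensity p a n y ≤
      A / n + (1 + C) / K ^ 2 := by
  set f : ℝ → ℝ := fun x => f₁ x + f₂ x with hfdef
  set b := a n with hb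
  have hcond := condDensity_eq_tilt_mul hn hσ hΦ hf
  have hpnn : ∀ x, 0 ≤ p x := fun x =>
    (lt_or_ge x 0).elim (fun h => (hp0 x h).ge) fun h => (hp x h).le
  have htiltnn : ∀ x, 0 ≤ tilt p t x := fun x =>
    div_nonneg (mul_nonneg (exp_pos _).le (hpnn x)) hΦ.le
  have htilt : ∀ x, 0 ≤ x → 0 < tilt p t x := fun x hx =>
    div_pos (mul_pos (exp_pos _) (hp x hx)) hΦ
  have hpos := (hconv 0 (by simpa using hK.le)).1
  have hcnn : ∀ y, 0 ≤ condDensity p a n y := fun y => by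
    rw [hcond]
    exact mul_nonneg (htiltnn y) (div_nonneg (convPow_nonneg H.nonneg _ _) hpos.le)
  have hne : convPow p n (n * a n) ≠ 0 := by
    intro h0
    obtain ⟨k, rfl⟩ : ∃ k, n = k + 1 := ⟨n - 1, by lia⟩
    have hf' : f = fun x => (σ / mgfFun p t) * (exp (t * (b + σ * x)) * p (b + σ * x)) := by
      rw [hf]
      funext x
      simp only [tilt]
      ring
    push_cast at h0
    rw [hf', convPow_affine_tilt p _ t b hσ k, mul_zero, add_zero, h0, mul_zero, mul_zero] at hpos
    exact lt_irrefl _ hpos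
  have hone := integral_condDensity_eq_one hn hne
  have hinteg : Integrable (condDensity p a n) := by
    by_contra h
    rw [integral_undef h] at hone
    exact zero_ne_one hone
  have hratio : ∀ y, |y - b| ≤ K * σ →
      |convPow f (n - 1) (-((y - b) / σ)) / convPow f n 0 - 1| ≤ A / n := by
    intro y hy
    have h := (hconv ((y - b) / σ) (by rwa [abs_div, abs_of_pos hσ, div_le_iff₀ hσ])).2
    rwa [div_sub_one hpos.ne', abs_div, abs_of_pos hpos, div_le_iff₀ hpos]
  have htint : Integrable (tilt p t) := by
    have h := H.integrable
    rw [← hfdef, hf] at h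
    rw [← integrable_comp_add_mul_iff _ b hσ]
    exact (integrable_const_mul_iff (IsUnit.mk0 _ hσ.ne') _).1 h
  have htone : ∫ y, tilt p t y = 1 := by
    have h := H.integral_eq_one
    change ∫ x, f x = 1 at h
    rw [hf, integral_const_mul, integral_comp_add_mul _ _ hσ, ← mul_assoc,
      mul_inv_cancel₀ hσ.ne', one_mul] at h
    exact h
  set S : Set ℝ := {y | K * σ < |y - b|} ∪ Iio 0 with hS
  have hSm : MeasurableSet S :=
    (measurableSet_lt measurable_const (by fun_prop)).union measurableSet_Iio
  have hSc : ∀ y ∈ Sᶜ, |y - b| ≤ K * σ ∧ 0 ≤ y := by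
    intro y hy
    simpa [hS, not_or, not_lt] using hy
  have hbad : {y : ℝ | δ < |condDensity p a n y / tilt p t y - 1|} ⊆ S := by
    intro y hy
    by_contra hyS
    obtain ⟨h1, h2⟩ := hSc y hyS
    simp only [mem_ofPred_eq] at hy
    rw [hcond, mul_div_cancel_left₀ _ (htilt y h2).ne'] at hy
    linarith [hratio y h1]
  have h1 : ∫ y in {y : ℝ | δ < |condDensity p a n y / tilt p t y - 1|}, condDensity p a n y ≤
      ∫ y in S, condDensity p a n y :=
    setIntegral_mono_set hinteg.integrableOn (Eventually.of_forall hcnn)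
      (LE.le.eventuallyLE hbad)
  have h2 := integral_add_compl hSm hinteg
  have h3 := integral_add_compl hSm htint
  have h4 : (1 - A / n) * ∫ y in Sᶜ, tilt p t y ≤ ∫ y in Sᶜ, condDensity p a n y := by
    rw [← integral_const_mul]
    refine setIntegral_mono_on (htint.integrableOn.const_mul _) hinteg.integrableOn hSm.compl ?_
    intro y hy
    rw [hcond y, mul_comm]
    refine mul_le_mul_of_nonneg_left ?_ (htiltnn y)
    have := (abs_le.1 (hratio y (hSc y hy).1)).1
    linarith
  have h5 : ∫ y in S, tilt p t y ≤ (1 + C) / K ^ 2 := by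
    have hvint : Integrable fun y => tilt p t y * (((y - b) / σ) ^ 2 / K ^ 2) := by
      rw [← integrable_comp_add_mul_iff _ b hσ]
      refine (H.integrable_sq.const_mul (σ⁻¹ * (K ^ 2)⁻¹)).congr (Eventually.of_forall fun x => ?_)
      have := congrFun hf x
      simp only [hfdef] at this
      simp only [this, add_sub_cancel_left, mul_div_cancel_left₀ _ hσ.ne']
      field_simp
    calc ∫ y in S, tilt p t y ≤ ∫ y in S, tilt p t y * (((y - b) / σ) ^ 2 / K ^ 2) := by
          refine setIntegral_mono_on htint.integrableOn hvint.integrableOn hSm ?_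
          rintro y (hy | hy)
          · refine le_mul_of_one_le_right (htiltnn y) ?_
            rw [one_le_div (by positivity), ← sq_abs ((y - b) / σ), abs_div, abs_of_pos hσ]
            refine pow_le_pow_left₀ hK.le ?_ 2
            rw [le_div_iff₀ hσ]
            exact le_of_lt hy
          · simp [tilt, hp0 y hy]
      _ ≤ ∫ y, tilt p t y * (((y - b) / σ) ^ 2 / K ^ 2) :=
          setIntegral_le_integral hvint
            (Eventually.of_forall fun y => mul_nonneg (htiltnn y) (by positivity))
      _ = (∫ x, x ^ 2 * f x) / K ^ 2 := by
          have h := integral_comp_add_mul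
            (fun y => tilt p t y * (((y - b) / σ) ^ 2 / K ^ 2)) b hσ
          rw [eq_comm, inv_mul_eq_iff_eq_mul₀ hσ.ne', ← integral_const_mul] at h
          rw [h, ← integral_div]
          refine integral_congr_ae (Eventually.of_forall fun x => ?_)
          simp only [congrFun hf x, add_sub_cancel_left, mul_div_cancel_left₀ _ hσ.ne']
          ring
      _ ≤ _ := div_le_div_of_nonneg_right H.variance_le (by positivity)
  have hA0 : 0 ≤ A / n := (abs_nonneg _).trans (hratio b (by simp; positivity))
  have h6 : 0 ≤ ∫ y in S, tilt p t y := integral_nonneg htiltnn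
  rw [hone] at h2
  rw [htone] at h3
  nlinarith

lemma integrable_exp_neg_mul_abs {l : ℝ} (hl : 0 < l) : Integrable fun u : ℝ => exp (-l * |u|) := by
  rw [← integrableOn_univ, ← Iic_union_Ioi (a := (0 : ℝ))]
  refine IntegrableOn.union ?_ ?_
  · refine (integrableOn_exp_mul_Iic hl 0).congr_fun (fun u hu => ?_) measurableSet_Iic
    rw [abs_of_nonpos hu, neg_mul_neg]
  · refine (exp_neg_integrableOn_Ioi 0 hl).congr_fun (fun u hu => ?_) measurableSet_Ioi
    rw [abs_of_pos hu]

/-- A density which decays exponentially to the right of `s₀` and whose mass to the left of `s₀` is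
exponentially small is, after centering, a split density. -/
theorem exists_splitDensity_of_exp_decay {κ l : ℝ} (hκ : 0 < κ) (hl : 0 < l) :
    ∃ C₂ C₃ : ℝ, 0 ≤ C₂ ∧ ∀ (F : ℝ → ℝ) (s₀ : ℝ), (∀ u, 0 ≤ F u) → Integrable F → ∫ u, F u = 1 →
      s₀ ≤ -1 - C₂ → (∀ u, s₀ < u → F u ≤ κ * exp (-l * |u|)) →
      IntegrableOn (fun u => F u * exp (l * |u|)) (Iic s₀) →
      ∫ u in Iic s₀, F u * exp (l * |u|) ≤ 1 / 4 →
      Integrable (fun u => u * F u) ∧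
      SplitDensity (fun v => (Iic s₀).indicator F (v + ∫ u, u * F u))
        (fun v => (Ioi s₀).indicator F (v + ∫ u, u * F u)) κ C₃ := by
  have hl2 : 0 < l / 2 := by positivity
  have hI := (integrable_exp_neg_mul_abs hl2).const_mul κ
  set W : ℝ := 1 / 4 + ∫ u : ℝ, κ * exp (-(l / 2) * |u|) with hW
  have hW0 : 0 ≤ W := add_nonneg (by norm_num) (integral_nonneg fun u => by positivity)
  refine ⟨2 / l * W, 4 * (48 / l ^ 3 * W + (2 / l * W) ^ 3), by positivity, ?_⟩
  intro F s₀ hF hFi hF1 hs₀ hdec hleft hleft4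
  set E : ℝ → ℝ := fun u => F u * exp (l / 2 * |u|) with hE
  have hEG : ∀ u, E u ≤ (Iic s₀).indicator (fun u => F u * exp (l * |u|)) u +
      κ * exp (-(l / 2) * |u|) := by
    intro u
    rcases le_or_gt u s₀ with hu | hu
    · rw [indicator_of_mem (mem_Iic.2 hu)]
      have h1 : exp (l / 2 * |u|) ≤ exp (l * |u|) := by
        gcongr
        linarith
      have h2 := mul_le_mul_of_nonneg_left h1 (hF u)
      have h3 : 0 ≤ κ * exp (-(l / 2) * |u|) := by positivity
      simp only [hE]
      linarith
    · rw [indicator_of_notMem (by simpa using hu), zero_add]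
      calc E u ≤ κ * exp (-l * |u|) * exp (l / 2 * |u|) :=
            mul_le_mul_of_nonneg_right (hdec u hu) (exp_pos _).le
        _ = _ := by
          rw [mul_assoc, ← exp_add]
          ring_nf
  have hGi : Integrable fun u => (Iic s₀).indicator (fun u => F u * exp (l * |u|)) u +
      κ * exp (-(l / 2) * |u|) := (hleft.integrable_indicator measurableSet_Iic).add hI
  have hE0 : ∀ u, 0 ≤ E u := fun u => mul_nonneg (hF u) (exp_pos _).le
  have hEi : Integrable E := by
    refine hGi.mono' (hFi.1.mul (by fun_prop)) (Eventually.of_forall fun u => ?_)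
    rw [Real.norm_of_nonneg (hE0 u)]
    exact hEG u
  have hEW : ∫ u, E u ≤ W := by
    refine (integral_mono hEi hGi hEG).trans ?_
    rw [integral_add (hleft.integrable_indicator measurableSet_Iic) hI,
      integral_indicator measurableSet_Iic]
    linarith
  have hm1 : ∀ u, |u| * F u ≤ 2 / l * E u := by
    intro u
    have h1 := add_one_le_exp (l / 2 * |u|)
    have h2 : |u| ≤ 2 / l * exp (l / 2 * |u|) := by
      rw [div_mul_eq_mul_div, le_div_iff₀ hl]
      linarith
    calc _ ≤ 2 / l * exp (l / 2 * |u|) * F u := mul_le_mul_of_nonneg_right h2 (hF u)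
      _ = _ := by
        simp only [hE]
        ring
  have hm3 : ∀ u, |u| ^ 3 * F u ≤ 48 / l ^ 3 * E u := by
    intro u
    have h1 := Real.pow_div_factorial_le_exp (l / 2 * |u|) (by positivity) 3
    have h2 : |u| ^ 3 ≤ 48 / l ^ 3 * exp (l / 2 * |u|) := by
      rw [div_mul_eq_mul_div, le_div_iff₀ (by positivity)]
      norm_num [Nat.factorial] at h1
      nlinarith
    calc _ ≤ 48 / l ^ 3 * exp (l / 2 * |u|) * F u := mul_le_mul_of_nonneg_right h2 (hF u)
      _ = _ := by
        simp only [hE]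
        ring
  have hi1 : Integrable fun u => u * F u := by
    refine (hEi.const_mul (2 / l)).mono' (continuous_id.aestronglyMeasurable.mul hFi.1)
      (Eventually.of_forall fun u => ?_)
    rw [norm_mul, Real.norm_of_nonneg (hF u), Real.norm_eq_abs]
    exact hm1 u
  have hi3 : Integrable fun u => |u| ^ 3 * F u := by
    refine (hEi.const_mul (48 / l ^ 3)).mono'
      ((continuous_abs.pow 3).aestronglyMeasurable.mul hFi.1)
      (Eventually.of_forall fun u => ?_)
    rw [Real.norm_of_nonneg (mul_nonneg (by positivity) (hF u))]
    exact hm3 u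
  set s := ∫ u, u * F u with hs
  have hsabs : |s| ≤ 2 / l * W := by
    rw [hs, ← Real.norm_eq_abs]
    refine (norm_integral_le_of_norm_le (hEi.const_mul (2 / l))
      (Eventually.of_forall fun u => ?_)).trans ?_
    · rw [norm_mul, Real.norm_of_nonneg (hF u), Real.norm_eq_abs]
      exact hm1 u
    · rw [integral_const_mul]
      gcongr
  have hsum : ∀ v, (Iic s₀).indicator F (v + s) + (Ioi s₀).indicator F (v + s) = F (v + s) := by
    intro v
    rw [← compl_Iic]
    exact indicator_self_add_compl_apply _ _ _
  have hcube : ∀ u, |u - s| ^ 3 ≤ 4 * (|u| ^ 3 + |s| ^ 3) := by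
    intro u
    have h1 : |u - s| ≤ |u| + |s| := abs_sub _ _
    have h2 : |u - s| ^ 3 ≤ (|u| + |s|) ^ 3 := by gcongr
    nlinarith [mul_nonneg (add_nonneg (abs_nonneg u) (abs_nonneg s)) (sq_nonneg (|u| - |s|))]
  have hcubei : Integrable fun u => 4 * (|u| ^ 3 + |s| ^ 3) * F u := by
    refine ((hi3.add (hFi.const_mul (|s| ^ 3))).const_mul 4).congr
      (Eventually.of_forall fun u => ?_)
    simp only [Pi.add_apply]
    ring
  have hm3s : Integrable fun u => |u - s| ^ 3 * F u := by
    refine hcubei.mono'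
      ((by fun_prop : Continuous fun u : ℝ => |u - s| ^ 3).aestronglyMeasurable.mul
      hFi.1) (Eventually.of_forall fun u => ?_)
    rw [Real.norm_of_nonneg (mul_nonneg (by positivity) (hF u))]
    exact mul_le_mul_of_nonneg_right (hcube u) (hF u)
  have hleftF : ∫ u in Iic s₀, F u ≤ 1 / 4 := by
    refine (setIntegral_mono hFi.integrableOn hleft fun u => ?_).trans hleft4
    exact le_mul_of_one_le_right (hF u) (one_le_exp (by positivity))
  refine ⟨hi1, ?_, ?_, ?_, ?_, ?_, ?_, ?_, ?_, ?_, ?_, ?_⟩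
  · exact fun v => indicator_nonneg (fun u _ => hF u) _
  · exact fun v => indicator_nonneg (fun u _ => hF u) _
  · exact (hFi.indicator measurableSet_Iic).comp_add_right s
  · exact (hFi.indicator measurableSet_Ioi).comp_add_right s
  · intro v
    by_cases hv : v + s ∈ Ioi s₀
    · rw [indicator_of_mem hv]
      refine (hdec _ hv).trans (mul_le_of_le_one_right hκ.le (exp_le_one_iff.2 ?_))
      nlinarith [abs_nonneg (v + s)]
    · rw [indicator_of_notMem hv]
      exact hκ.le
  · rw [integral_add_right_eq_self (fun u => (Iic s₀).indicator F u),
      integral_indicator measurableSet_Iic]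
    exact hleftF
  · rw [integral_add_right_eq_self (fun u => (Iic s₀).indicator F u),
      integral_add_right_eq_self (fun u => (Ioi s₀).indicator F u),
      integral_indicator measurableSet_Iic, integral_indicator measurableSet_Ioi, ← compl_Iic,
      integral_add_compl measurableSet_Iic hFi, hF1]
  · simp only [hsum]
    have h := hm3s.comp_add_right s
    simpa using h
  · simp only [hsum]
    have e := integral_add_right_eq_self (μ := volume) (fun u => |u - s| ^ 3 * F u) s
    simp only [add_sub_cancel_right] at e
    rw [e]
    refine (integral_mono hm3s hcubei fun u =>
      mul_le_mul_of_nonneg_right (hcube u) (hF u)).trans ?_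
    have e2 : ∫ u, 4 * (|u| ^ 3 + |s| ^ 3) * F u = 4 * ((∫ u, |u| ^ 3 * F u) + |s| ^ 3) := by
      have e3 : ∀ u, 4 * (|u| ^ 3 + |s| ^ 3) * F u =
          4 * (|u| ^ 3 * F u) + 4 * |s| ^ 3 * F u := fun u => by ring
      simp only [e3]
      rw [integral_add (hi3.const_mul 4) (hFi.const_mul _), integral_const_mul, integral_const_mul,
        hF1]
      ring
    rw [e2]
    have h3 : ∫ u, |u| ^ 3 * F u ≤ 48 / l ^ 3 * W := by
      refine (integral_mono hi3 (hEi.const_mul _) hm3).trans ?_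
      rw [integral_const_mul]
      gcongr
    gcongr
  · simp only [hsum]
    have e := integral_add_right_eq_self (μ := volume) (fun u => (u - s) * F u) s
    simp only [add_sub_cancel_right] at e
    rw [e]
    simp only [sub_mul]
    rw [integral_sub hi1 (hFi.const_mul s), integral_const_mul, hF1, ← hs]
    ring
  · intro v hv
    refine indicator_of_notMem ?_ _
    have := neg_le_of_abs_le hsabs
    simp only [mem_Iic, not_le]
    linarith

section Moments

open ProbabilityTheory

variable {p : ℝ → ℝ}

lemma integral_withDensity_ofReal (hpnn : ∀ x, 0 ≤ p x) (hpi : Integrable p) (F : ℝ → ℝ) :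
    ∫ x, F x ∂(volume.withDensity fun x => ENNReal.ofReal (p x)) = ∫ x, F x * p x := by
  rw [integral_withDensity_eq_integral_toReal_smul₀ hpi.1.aemeasurable.ennreal_ofReal
    (Eventually.of_forall fun x => ENNReal.ofReal_lt_top)]
  refine integral_congr_ae (Eventually.of_forall fun x => ?_)
  simp only [ENNReal.toReal_ofReal (hpnn x), smul_eq_mul, mul_comm]

lemma integrable_exp_mul_of_pos (hpzero : ∀ x < 0, p x = 0) (hpi : Integrable p)
    (hPhi : ∀ t > (0 : ℝ), IntegrableOn (fun x => exp (t * x) * p x) (Ici 0)) (t : ℝ) :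
    Integrable fun x => exp (t * x) * p x := by
  rw [← integrableOn_univ, ← Iio_union_Ici (a := (0 : ℝ))]
  refine IntegrableOn.union ?_ ?_
  · refine integrableOn_zero.congr_fun (fun x hx => ?_) measurableSet_Iio
    rw [hpzero x hx, mul_zero]
  · rcases lt_or_ge 0 t with ht | ht
    · exact hPhi t ht
    · refine Integrable.mono hpi.integrableOn ((by fun_prop : Continuous fun x : ℝ =>
        exp (t * x)).aestronglyMeasurable.mul hpi.1).restrict ?_
      filter_upwards [ae_restrict_mem measurableSet_Ici] with x hx
      rw [norm_mul, Real.norm_of_nonneg (exp_pos _).le]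
      refine mul_le_of_le_one_left (norm_nonneg _) (exp_le_one_iff.2 ?_)
      exact mul_nonpos_of_nonpos_of_nonneg ht hx

lemma mgfFun_eq_integral (hpzero : ∀ x < 0, p x = 0) (t : ℝ) :
    mgfFun p t = ∫ x, exp (t * x) * p x := by
  rw [mgfFun, ← integral_indicator measurableSet_Ici]
  refine integral_congr_ae (Eventually.of_forall fun x => ?_)
  by_cases hx : x ∈ Ici (0 : ℝ)
  · simp [indicator_of_mem hx]
  · simp [indicator_of_notMem hx, hpzero x (not_le.1 hx)]

/-- The derivative of the log-Laplace transform is the mean of the tilted density, and it is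
monotone. -/
lemma mFun_eq_integral_and_monotone (hpnn : ∀ x, 0 ≤ p x) (hpzero : ∀ x < 0, p x = 0)
    (hpi : Integrable p)
    (hPhi : ∀ t > (0 : ℝ), IntegrableOn (fun x => exp (t * x) * p x) (Ici 0)) :
    (∀ t, mFun p t = ∫ x, x * tilt p t x) ∧ Monotone (mFun p) := by
  set μ : Measure ℝ := volume.withDensity fun x => ENNReal.ofReal (p x) with hμ
  have hset : integrableExpSet id μ = univ := by
    refine eq_univ_of_forall fun t => ?_
    change Integrable (fun x => exp (t * id x)) μ
    rw [hμ, integrable_withDensity_iff_integrable_smul₀' hpi.1.aemeasurable.ennreal_ofReal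
      (Eventually.of_forall fun x => ENNReal.ofReal_lt_top)]
    refine (integrable_exp_mul_of_pos hpzero hpi hPhi t).congr (Eventually.of_forall fun x => ?_)
    simp only [ENNReal.toReal_ofReal (hpnn x), smul_eq_mul, mul_comm, id]
  have hmem : ∀ t, t ∈ interior (integrableExpSet id μ) := fun t => by
    rw [hset, interior_univ]
    exact mem_univ t
  have hmgf : ∀ t, mgf id μ t = mgfFun p t := fun t => by
    rw [mgfFun_eq_integral hpzero, mgf, hμ, integral_withDensity_ofReal hpnn hpi]
    rfl
  have hcgf : mFun p = deriv (cgf id μ) := by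
    simp only [mFun, ← hmgf]
    rfl
  constructor
  · intro t
    rw [hcgf, deriv_cgf (hmem t), hmgf, hμ, integral_withDensity_ofReal hpnn hpi, ← integral_div]
    refine integral_congr_ae (Eventually.of_forall fun x => ?_)
    simp only [tilt, id]
    ring
  · have han : ∀ t, AnalyticAt ℝ (cgf id μ) t := fun t => analyticAt_cgf (hmem t)
    rw [hcgf]
    refine monotone_of_deriv_nonneg (fun t => (han t).deriv.differentiableAt) fun t => ?_
    have h := iteratedDeriv_two_cgf_eq_integral (hmem t)
    rw [iteratedDeriv_succ, iteratedDeriv_one] at h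
    rw [h, hmgf, mgfFun_eq_integral hpzero]
    refine div_nonneg (integral_nonneg fun x => mul_nonneg (sq_nonneg _) (exp_pos _).le)
      (integral_nonneg fun x => mul_nonneg (exp_pos _).le (hpnn x))

lemma tendsto_atTop_of_mFun (hpnn : ∀ x, 0 ≤ p x) (hpzero : ∀ x < 0, p x = 0)
    (hpi : Integrable p)
    (hPhi : ∀ t > (0 : ℝ), IntegrableOn (fun x => exp (t * x) * p x) (Ici 0))
    {a t : ℕ → ℝ} (ha : Tendsto a atTop atTop) (htm : ∀ n, mFun p (t n) = a n) :
    Tendsto t atTop atTop := by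
  have hmono := (mFun_eq_integral_and_monotone hpnn hpzero hpi hPhi).2
  refine tendsto_atTop.2 fun T => ?_
  filter_upwards [ha.eventually_gt_atTop (mFun p T)] with n hn
  by_contra! h
  have := hmono h.le
  rw [htm] at this
  linarith

end Moments

/-- Near the point where `h` takes the value `t`, the function `h` varies by order `1 / σ` on an
interval of length of order `σ`, for some scale `σ` depending on `t`. -/
def HasLocalScale (h : ℝ → ℝ) (c C : ℝ) : Prop :=
  ∀ B : ℝ, ∃ T : ℝ, ∀ t ≥ T, ∃ x₁ x₀ x₂ σ : ℝ, 0 < σ ∧ B ≤ x₁ ∧ x₁ < x₀ ∧ x₀ < x₂ ∧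
    h x₁ ≤ t - c / σ ∧ h x₀ = t ∧ t + c / σ ≤ h x₂ ∧ h x₂ ≤ t + C / σ ∧
    c * σ ≤ x₂ - x₀ ∧ x₂ - x₀ ≤ C * σ ∧ x₀ - x₁ ≤ C * σ ∧ B * σ ≤ x₀

lemma sub_le_mul_sub_of_hasDerivAt_le {k k' : ℝ → ℝ} (hk : ∀ x, HasDerivAt k (k' x) x)
    {a b m : ℝ} (hab : a ≤ b) (h : ∀ x ∈ Ioo a b, k' x ≤ m) : k b - k a ≤ m * (b - a) := by
  rcases hab.eq_or_lt with rfl | hab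
  · simp
  · obtain ⟨x, hx, e⟩ := exists_hasDerivAt_eq_slope k k' hab
      (fun x _ => (hk x).continuousAt.continuousWithinAt) fun x _ => hk x
    rw [← div_le_iff₀ (sub_pos.2 hab), ← e]
    exact h x hx

lemma mul_sub_le_sub_of_le_hasDerivAt {k k' : ℝ → ℝ} (hk : ∀ x, HasDerivAt k (k' x) x)
    {a b m : ℝ} (hab : a ≤ b) (h : ∀ x ∈ Ioo a b, m ≤ k' x) : m * (b - a) ≤ k b - k a := by
  have := sub_le_mul_sub_of_hasDerivAt_le (k := fun x => -k x) (k' := fun x => -k' x) (m := -m)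
    (fun x => (hk x).neg) hab fun x hx => neg_le_neg (h x hx)
  linarith

section LocalScale

variable {g h : ℝ → ℝ} {A c C t x₁ x₀ x₂ σ : ℝ}

lemma exponent_le_sub_abs (hg : ∀ x, HasDerivAt g (h x) x) (hmono : MonotoneOn h (Ici A))
    (hc : 0 < c) (hσ : 0 < σ) (hA : A ≤ x₁) (h10 : x₁ < x₀) (h02 : x₀ < x₂)
    (h1 : h x₁ ≤ t - c / σ) (h0 : h x₀ = t) (h2 : t + c / σ ≤ h x₂)
    (hr : x₂ - x₀ ≤ C * σ) (hl : x₀ - x₁ ≤ C * σ) {x : ℝ} (hx : A ≤ x) :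
    t * x - g x ≤ t * x₀ - g x₀ + c * C - c / σ * |x - x₀| := by
  have hk : ∀ x, HasDerivAt (fun x => t * x - g x) (t - h x) x := fun x => by
    simpa using ((hasDerivAt_id x).const_mul t).fun_sub (hg x)
  have hcσ : 0 < c / σ := by positivity
  have hcc : c / σ * (C * σ) = c * C := by field_simp
  have hup : ∀ y, A ≤ y → y ≤ x₀ → t * y - g y ≤ t * x₀ - g x₀ := fun y hy hy0 => by
    have := mul_sub_le_sub_of_le_hasDerivAt hk hy0 (m := 0) fun z hz => by
      have := hmono (show A ≤ z by linarith [hz.1]) (show A ≤ x₀ by linarith) hz.2.le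
      linarith
    linarith
  have hdown : ∀ y, x₀ ≤ y → t * y - g y ≤ t * x₀ - g x₀ := fun y hy => by
    have := sub_le_mul_sub_of_hasDerivAt_le hk hy (m := 0) fun z hz => by
      have := hmono (show A ≤ x₀ by linarith) (show A ≤ z by linarith [hz.1]) hz.1.le
      linarith
    linarith
  rcases le_total x x₀ with hx0 | hx0
  · rw [abs_of_nonpos (by linarith)]
    rcases le_total x x₁ with hx1 | hx1
    · have := mul_sub_le_sub_of_le_hasDerivAt hk hx1 (m := c / σ) fun z hz => by
        have := hmono (show A ≤ z by linarith [hz.1]) hA hz.2.le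
        linarith
      have h3 := hup x₁ hA h10.le
      have h4 := mul_le_mul_of_nonneg_left hl hcσ.le
      linarith
    · have h3 := hup x hx hx0
      have h4 := mul_le_mul_of_nonneg_left (show x₀ - x ≤ C * σ by linarith) hcσ.le
      linarith
  · rw [abs_of_nonneg (by linarith)]
    rcases le_total x x₂ with hx2 | hx2
    · have h3 := hdown x hx0
      have h4 := mul_le_mul_of_nonneg_left (show x - x₀ ≤ C * σ by linarith) hcσ.le
      linarith
    · have := sub_le_mul_sub_of_hasDerivAt_le hk hx2 (m := -(c / σ)) fun z hz => by
        have := hmono (show A ≤ x₂ by linarith) (show A ≤ z by linarith [hz.1]) hz.1.le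
        linarith
      have h3 := hdown x₂ h02.le
      have h4 := mul_le_mul_of_nonneg_left hr hcσ.le
      linarith

lemma le_exponent (hg : ∀ x, HasDerivAt g (h x) x) (hmono : MonotoneOn h (Ici A))
    (hσ : 0 < σ) (hA : A ≤ x₀) (hC : 0 ≤ C) (h2 : h x₂ ≤ t + C / σ) (hr : x₂ - x₀ ≤ C * σ) {x : ℝ}
    (hx : x₀ ≤ x) (hx2 : x ≤ x₂) : t * x₀ - g x₀ - C ^ 2 ≤ t * x - g x := by
  have hk : ∀ x, HasDerivAt (fun x => t * x - g x) (t - h x) x := fun x => by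
    simpa using ((hasDerivAt_id x).const_mul t).fun_sub (hg x)
  have h3 := mul_sub_le_sub_of_le_hasDerivAt hk hx (m := -(C / σ)) fun z hz => by
    have := hmono (show A ≤ z by linarith [hz.1]) (show A ≤ x₂ by linarith) (hz.2.le.trans hx2)
    linarith
  have h4 := mul_le_mul_of_nonneg_left (show x - x₀ ≤ C * σ by linarith)
    (show 0 ≤ C / σ by positivity)
  have h5 : C / σ * (C * σ) = C ^ 2 := by field_simp
  linarith

end LocalScale

lemma eventually_mul_exp_neg_le (D : ℝ) {e : ℝ} (he : 0 < e) :
    ∀ᶠ t : ℝ in atTop, D * (t * exp (-t)) ≤ e := by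
  have h := (Real.tendsto_pow_mul_exp_neg_atTop_nhds_zero 1).const_mul D
  simp only [pow_one, mul_zero] at h
  filter_upwards [h.eventually (gt_mem_nhds he)] with t ht using ht.le

set_option maxHeartbeats 1000000 in
/-- If `h` has a local scale, then centered and rescaled tilted densities are split densities with
uniform constants. -/
theorem exists_splitDensity_tilt {p g q h : ℝ → ℝ} {c₀ A c C : ℝ} (hc₀ : 0 < c₀) (hA0 : 0 ≤ A)
    (hpdef : ∀ x ≥ (0 : ℝ), p x = c₀ * exp (-(g x - q x))) (hpzero : ∀ x < (0 : ℝ), p x = 0)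
    (hpi : Integrable p) (hp1 : ∫ x, p x = 1) (hg : ∀ x, HasDerivAt g (h x) x)
    (hq : ∀ x ≥ A, |q x| ≤ 1) (hmono : MonotoneOn h (Ici A)) (hnn : ∀ x ≥ A, 0 ≤ h x)
    (hPhi : ∀ t > (0 : ℝ), IntegrableOn (fun x => exp (t * x) * p x) (Ici 0))
    (hc : 0 < c) (hC : 0 ≤ C) (hloc : HasLocalScale h c C) :
    ∃ M C₃ T : ℝ, ∀ t ≥ T, ∃ (f₁ f₂ : ℝ → ℝ) (σ : ℝ), 0 < σ ∧ 0 < mgfFun p t ∧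
      SplitDensity f₁ f₂ M C₃ ∧
      (fun x => f₁ x + f₂ x) = fun x => σ * tilt p t ((∫ y, y * tilt p t y) + σ * x) := by
  set l : ℝ := c / (A + 2) with hl
  have hl0 : 0 < l := by positivity
  have hlc : l ≤ c := div_le_self hc.le (by linarith)
  set κ : ℝ := exp (2 + c * C + C ^ 2) / c with hκ
  have hκ0 : 0 < κ := by positivity
  obtain ⟨C₂, C₃, hC₂, hsplit⟩ := exists_splitDensity_of_exp_decay hκ0 hl0
  set G : ℝ := g (A + 2) + c * C + C ^ 2 + 1 with hG
  obtain ⟨T₁, hT₁⟩ := eventually_atTop.1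
    (eventually_mul_exp_neg_le (exp G / (c ^ 2 * c₀)) (show (0 : ℝ) < 1 / 4 by norm_num))
  obtain ⟨T₂, hT₂⟩ := hloc (2 * (1 + C₂) + 2 * (A + 2))
  refine ⟨κ, C₃, max T₁ (max T₂ 1), fun t ht => ?_⟩
  simp only [ge_iff_le, max_le_iff] at ht
  obtain ⟨ht1, ht2, ht3⟩ := ht
  obtain ⟨x₁, x₀, x₂, σ, hσ, hB, h10, h02, h1, h0, h2, h2', hr', hr, hl', hBσ⟩ := hT₂ t ht2
  have hAx₁ : A ≤ x₁ := by linarith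
  have hAx₀ : A + 2 ≤ x₀ := by linarith
  have ht0 : 0 < t := by linarith
  have hpnn : ∀ x, 0 ≤ p x := fun x => by
    rcases lt_or_ge x 0 with hx | hx
    · exact (hpzero x hx).ge
    · rw [hpdef x hx]
      positivity
  have hcσt : c / σ ≤ t := by linarith [hnn x₁ hAx₁]
  have hdecay : ∀ x, A ≤ x → t * x - g x ≤ t * x₀ - g x₀ + c * C - c / σ * |x - x₀| :=
    fun x hx => exponent_le_sub_abs hg hmono hc hσ hAx₁ h10 h02 h1 h0 h2 hr hl' hx
  set m : ℝ := c * σ * (c₀ * exp (t * x₀ - g x₀ - C ^ 2 - 1)) with hm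
  have hm0 : 0 < m := by positivity
  have hΦm : m ≤ mgfFun p t := by
    calc m ≤ (x₂ - x₀) * (c₀ * exp (t * x₀ - g x₀ - C ^ 2 - 1)) :=
          mul_le_mul_of_nonneg_right hr' (by positivity)
      _ = ∫ x in Ioc x₀ x₂, c₀ * exp (t * x₀ - g x₀ - C ^ 2 - 1) := by
        simp [h02.le]
      _ ≤ ∫ x in Ioc x₀ x₂, exp (t * x) * p x := by
        refine setIntegral_mono_on (integrableOn_const (by simp))
          ((hPhi t ht0).mono_set fun x hx => ?_)
          measurableSet_Ioc fun x hx => ?_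
        · exact show 0 ≤ x by linarith [hx.1]
        · have h3 := le_exponent hg hmono hσ (by linarith) hC h2' hr hx.1.le hx.2
          have h4 := (abs_le.1 (hq x (by linarith [hx.1]))).1
          rw [hpdef x (by linarith [hx.1]), mul_left_comm, ← exp_add]
          gcongr
          linarith
      _ ≤ _ := by
        refine setIntegral_mono_set (hPhi t ht0)
          (Eventually.of_forall fun x => mul_nonneg (exp_pos _).le (hpnn x)) ?_
        refine LE.le.eventuallyLE fun x hx => ?_
        exact show 0 ≤ x by linarith [hx.1]
  have hΦ : 0 < mgfFun p t := hm0.trans_le hΦm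
  have htnn : ∀ x, 0 ≤ tilt p t x := fun x =>
    div_nonneg (mul_nonneg (exp_pos _).le (hpnn x)) hΦ.le
  have hexpi := integrable_exp_mul_of_pos hpzero hpi hPhi t
  have hti : Integrable (tilt p t) := hexpi.div_const _
  have ht1' : ∫ x, tilt p t x = 1 := by
    simp only [tilt]
    rw [integral_div, div_eq_one_iff_eq hΦ.ne', mgfFun_eq_integral hpzero]
  set F : ℝ → ℝ := fun u => σ * tilt p t (x₀ + σ * u) with hF
  have hFnn : ∀ u, 0 ≤ F u := fun u => mul_nonneg hσ.le (htnn _)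
  have hFi : Integrable F := ((integrable_comp_add_mul_iff _ x₀ hσ).2 hti).const_mul σ
  have hF1 : ∫ u, F u = 1 := by
    rw [hF, integral_const_mul, integral_comp_add_mul _ _ hσ, ht1', mul_one, mul_inv_cancel₀ hσ.ne']
  set s₀ : ℝ := (A - x₀) / σ with hs₀
  have hs₀le : s₀ ≤ -1 - C₂ := by
    rw [hs₀, div_le_iff₀ hσ]
    nlinarith
  have hFdec : ∀ u, s₀ < u → F u ≤ κ * exp (-l * |u|) := by
    intro u hu
    rw [hs₀, div_lt_iff₀ hσ] at hu
    have hx : A ≤ x₀ + σ * u := by linarith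
    have h3 := hdecay _ hx
    have h4 := (abs_le.1 (hq _ hx)).2
    rw [add_sub_cancel_left, abs_mul, abs_of_pos hσ, ← mul_assoc, div_mul_cancel₀ _ hσ.ne'] at h3
    have h5 : σ * (exp (t * (x₀ + σ * u)) * p (x₀ + σ * u)) ≤ κ * exp (-l * |u|) * m := by
      rw [hpdef _ (by linarith), mul_left_comm (exp _), ← exp_add]
      have e : κ * exp (-l * |u|) * m =
          σ * (c₀ * exp (2 + c * C + C ^ 2 + -l * |u| + (t * x₀ - g x₀ - C ^ 2 - 1))) := by
        rw [hκ, hm, exp_add _ (t * x₀ - g x₀ - C ^ 2 - 1), exp_add _ (-l * |u|)]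
        field_simp
      rw [e]
      refine mul_le_mul_of_nonneg_left
        (mul_le_mul_of_nonneg_left (exp_le_exp.2 ?_) hc₀.le) hσ.le
      have := mul_le_mul_of_nonneg_right hlc (abs_nonneg u)
      linarith
    calc F u = σ * (exp (t * (x₀ + σ * u)) * p (x₀ + σ * u)) / mgfFun p t := by
          simp only [hF, tilt, mul_div_assoc]
      _ ≤ _ := by
        rw [div_le_iff₀ hΦ]
        exact h5.trans (mul_le_mul_of_nonneg_left hΦm (by positivity))
  set R : ℝ := exp (t * A + l * (x₀ / σ)) / mgfFun p t with hR
  have hRle : R ≤ 1 / 4 := by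
    have h3 := hdecay (A + 2) (by linarith)
    rw [abs_of_nonpos (by linarith)] at h3
    have h4 : l / σ * (x₀ - (A + 2)) ≤ c / σ * (x₀ - (A + 2)) := by
      have : 0 ≤ x₀ - (A + 2) := by linarith
      gcongr
    have h5 : l / σ * (A + 2) = c / σ := by
      rw [hl]
      field_simp
    have h6 : l / σ * x₀ = l * (x₀ / σ) := by ring
    have h7 : exp (t * A + l * (x₀ / σ)) ≤ exp G * exp (-t) * exp (t * x₀ - g x₀ - C ^ 2 - 1) := by
      rw [← exp_add, ← exp_add, exp_le_exp]
      linarith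
    refine le_trans ?_ (hT₁ t ht1)
    rw [hR, div_le_iff₀ hΦ]
    refine h7.trans ?_
    have h8 : exp G * exp (-t) * exp (t * x₀ - g x₀ - C ^ 2 - 1) =
        exp G / (c ^ 2 * c₀) * (c / σ * exp (-t)) * m := by
      rw [hm]
      field_simp
    rw [h8]
    gcongr
  have hleft : ∀ u ∈ Iic s₀, F u * exp (l * |u|) ≤ R * (σ * p (x₀ + σ * u)) := by
    intro u hu
    rw [mem_Iic, hs₀, le_div_iff₀ hσ] at hu
    rcases lt_or_ge (x₀ + σ * u) 0 with hx | hx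
    · simp [hF, tilt, hpzero _ hx]
    · have hu0 : u ≤ 0 := by
        by_contra! h
        nlinarith
      rw [abs_of_nonpos hu0]
      have h3 : -u ≤ x₀ / σ := by
        rw [le_div_iff₀ hσ]
        linarith
      have e : F u * exp (l * -u) =
          exp (t * (x₀ + σ * u) + l * -u) / mgfFun p t * (σ * p (x₀ + σ * u)) := by
        simp only [hF, tilt, exp_add]
        ring
      rw [e, hR]
      have := hpnn (x₀ + σ * u)
      gcongr
      linarith
  have hpi' : Integrable fun u => R * (σ * p (x₀ + σ * u)) :=
    (((integrable_comp_add_mul_iff p x₀ hσ).2 hpi).const_mul σ).const_mul R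
  have hlefti : IntegrableOn (fun u => F u * exp (l * |u|)) (Iic s₀) := by
    refine hpi'.integrableOn.mono' ((hFi.1.mul (by fun_prop)).restrict) ?_
    filter_upwards [ae_restrict_mem measurableSet_Iic] with u hu
    rw [Real.norm_of_nonneg (mul_nonneg (hFnn u) (exp_pos _).le)]
    exact hleft u hu
  have hleft4 : ∫ u in Iic s₀, F u * exp (l * |u|) ≤ 1 / 4 := by
    refine (setIntegral_mono_on hlefti hpi'.integrableOn measurableSet_Iic hleft).trans ?_
    refine (setIntegral_le_integral hpi' (Eventually.of_forall fun u => ?_)).trans ?_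
    · exact mul_nonneg (by positivity) (mul_nonneg hσ.le (hpnn _))
    · rw [integral_const_mul, integral_const_mul, integral_comp_add_mul _ _ hσ, hp1, mul_one,
        mul_inv_cancel₀ hσ.ne', mul_one]
      exact hRle
  obtain ⟨huF, hsd⟩ := hsplit F s₀ hFnn hFi hF1 hs₀le hFdec hlefti hleft4
  refine ⟨_, _, σ, hσ, hΦ, hsd, ?_⟩
  have hmean : ∫ y, y * tilt p t y = x₀ + σ * ∫ u, u * F u := by
    have e := integral_comp_add_mul (fun y => y * tilt p t y) x₀ hσ
    rw [eq_comm, inv_mul_eq_iff_eq_mul₀ hσ.ne'] at e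
    rw [e, ← integral_const_mul, ← integral_const_mul]
    have e2 : ∀ u, σ * ((x₀ + σ * u) * tilt p t (x₀ + σ * u)) = x₀ * F u + σ * (u * F u) := by
      intro u
      simp only [hF]
      ring
    simp only [e2]
    rw [integral_add (hFi.const_mul x₀) (huF.const_mul σ), integral_const_mul, hF1, mul_one,
      integral_const_mul]
  funext v
  rw [hmean, ← compl_Iic, indicator_self_add_compl_apply]
  simp only [hF]
  congr 2
  ring

lemma hasDerivAt_integral_div {ε : ℝ → ℝ} (hε : Continuous ε) {x : ℝ} (hx : 0 < x) :
    HasDerivAt (fun x => ∫ u in (1 : ℝ)..x, ε u / u) (ε x / x) x := by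
  have hc : ContinuousOn (fun u => ε u / u) (Ioi 0) :=
    hε.continuousOn.div continuousOn_id fun u hu => (ne_of_gt hu)
  have hsub : uIcc 1 x ⊆ Ioi 0 := by
    intro u hu
    rw [mem_uIcc] at hu
    rcases hu with hu | hu
    · exact lt_of_lt_of_le one_pos hu.1
    · exact lt_of_lt_of_le hx hu.1
  exact intervalIntegral.integral_hasDerivAt_right (hc.mono hsub).intervalIntegrable
    (hc.stronglyMeasurableAtFilter isOpen_Ioi x hx) (hc.continuousAt (Ioi_mem_nhds hx))

lemma exists_ge_eq_of_tendsto {h : ℝ → ℝ} {Y t : ℝ} (hc : ContinuousOn h (Ici Y))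
    (ht : Tendsto h atTop atTop) (hY : h Y ≤ t) : ∃ x ≥ Y, h x = t := by
  obtain ⟨z, hz, hz'⟩ := ((ht.eventually_ge_atTop t).and (eventually_ge_atTop Y)).exists
  obtain ⟨x, hx, e⟩ := intermediate_value_Icc hz' (hc.mono Icc_subset_Ici_self) ⟨hY, hz⟩
  exact ⟨x, hx.1, e⟩

/-- Logarithmic increments of a function in `R_β` are comparable to those of a power. -/
lemma MemRbeta.exists_log_sub {h : ℝ → ℝ} {β : ℝ} (hβ : MemRbeta h β) :
    ∃ X₀ : ℝ, 1 ≤ X₀ ∧ (∀ x ≥ X₀, 0 < h x) ∧ ContinuousOn h (Ici X₀) ∧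
      ∀ x y, X₀ ≤ x → x ≤ y → β / 2 * (log y - log x) ≤ log (h y) - log (h x) ∧
        log (h y) - log (h x) ≤ 2 * β * (log y - log x) := by
  obtain ⟨hβ0, l, ε, ε', ε'', ⟨hε, -, hε0, hl⟩, hh, -, -⟩ := hβ
  have hεc : Continuous ε := continuous_iff_continuousAt.2 fun x => (hε x).continuousAt
  have hsmall : ∀ᶠ x in atTop, |ε x| ≤ β / 2 := by
    have := hε0.abs
    rw [abs_zero] at this
    filter_upwards [this.eventually (gt_mem_nhds (by positivity : 0 < β / 2))] with x hx using hx.le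
  obtain ⟨X, hX⟩ := eventually_atTop.1 (hh.and hsmall)
  have hform : ∀ x ≥ max X 1, h x = x ^ β * exp (∫ u in (1 : ℝ)..x, ε u / u) := fun x hx => by
    rw [(hX x ((le_max_left _ _).trans hx)).1, hl x ((le_max_right _ _).trans hx)]
  have hposx : ∀ x ≥ max X 1, 0 < x := fun x hx =>
    lt_of_lt_of_le one_pos ((le_max_right _ _).trans hx)
  have hI : ∀ x, 0 < x → HasDerivAt (fun x => β * log x + ∫ u in (1 : ℝ)..x, ε u / u)
      (β * x⁻¹ + ε x / x) x := fun x hx =>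
    ((Real.hasDerivAt_log hx.ne').const_mul β).fun_add (hasDerivAt_integral_div hεc hx)
  have hlog : ∀ x ≥ max X 1, log (h x) = β * log x + ∫ u in (1 : ℝ)..x, ε u / u := fun x hx => by
    rw [hform x hx, Real.log_mul (Real.rpow_pos_of_pos (hposx x hx) β).ne' (exp_pos _).ne',
      Real.log_rpow (hposx x hx), Real.log_exp]
  have hpos : ∀ x ≥ max X 1, 0 < h x := fun x hx => by
    rw [hform x hx]
    exact mul_pos (Real.rpow_pos_of_pos (hposx x hx) β) (exp_pos _)
  refine ⟨max X 1, le_max_right _ _, hpos, ?_, fun x y hx hxy => ?_⟩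
  · have : ContinuousOn (fun x => exp (β * log x + ∫ u in (1 : ℝ)..x, ε u / u)) (Ici (max X 1)) :=
      fun x hx => (hI x (hposx x hx)).continuousAt.rexp.continuousWithinAt
    refine this.congr fun x hx => ?_
    beta_reduce
    rw [← hlog x hx, Real.exp_log (hpos x hx)]
  · rw [hlog x hx, hlog y (hx.trans hxy)]
    have hD : ∀ a : ℝ, ∀ z ∈ Icc x y, HasDerivAt
        (fun z => (β * log z + ∫ u in (1 : ℝ)..z, ε u / u) - a * log z)
        (β * z⁻¹ + ε z / z - a * z⁻¹) z := fun a z hz => by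
      have hz0 := hposx z (hx.trans hz.1)
      exact (hI z hz0).fun_sub ((Real.hasDerivAt_log hz0.ne').const_mul a)
    have hmono : MonotoneOn (fun z => (β * log z + ∫ u in (1 : ℝ)..z, ε u / u) - β / 2 * log z)
        (Icc x y) := by
      refine monotoneOn_of_hasDerivWithinAt_nonneg (convex_Icc x y)
        (fun z hz => (hD _ z hz).continuousAt.continuousWithinAt)
        (fun z hz => (hD _ z (interior_subset hz)).hasDerivWithinAt) fun z hz => ?_
      have hz := interior_subset hz
      have hz0 := hposx z (hx.trans hz.1)
      have := (abs_le.1 (hX z ((le_max_left _ _).trans (hx.trans hz.1))).2).1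
      have e : β * z⁻¹ + ε z / z - β / 2 * z⁻¹ = (β / 2 + ε z) / z := by ring
      rw [e]
      exact div_nonneg (by linarith) hz0.le
    have hanti : AntitoneOn (fun z => (β * log z + ∫ u in (1 : ℝ)..z, ε u / u) - 2 * β * log z)
        (Icc x y) := by
      refine antitoneOn_of_hasDerivWithinAt_nonpos (convex_Icc x y)
        (fun z hz => (hD _ z hz).continuousAt.continuousWithinAt)
        (fun z hz => (hD _ z (interior_subset hz)).hasDerivWithinAt) fun z hz => ?_
      have hz := interior_subset hz
      have hz0 := hposx z (hx.trans hz.1)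
      have := (abs_le.1 (hX z ((le_max_left _ _).trans (hx.trans hz.1))).2).2
      have e : β * z⁻¹ + ε z / z - 2 * β * z⁻¹ = (-β + ε z) / z := by ring
      rw [e]
      exact div_nonpos_of_nonpos_of_nonneg (by linarith) hz0.le
    have h1 := hmono (left_mem_Icc.2 hxy) (right_mem_Icc.2 hxy) hxy
    have h2 := hanti (left_mem_Icc.2 hxy) (right_mem_Icc.2 hxy) hxy
    simp only at h1 h2
    constructor <;> linarith

lemma exp_neg_half_mul_le {β r : ℝ} (hβ : 0 < β) (hr : 0 ≤ r) (hr2 : r ≤ 1 / 2) :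
    exp (-(β / 2 * r)) ≤ 1 - β / (4 * (1 + β)) * r := by
  have h3 := add_one_le_exp (β / 2 * r)
  have h4 : exp (-(β / 2 * r)) ≤ 1 / (β / 2 * r + 1) := by
    rw [exp_neg, inv_eq_one_div]
    exact one_div_le_one_div_of_le (by positivity) h3
  refine h4.trans ?_
  rw [div_le_iff₀ (by positivity)]
  have h5 : β / (4 * (1 + β)) * (1 + β) = β / 4 := by field_simp
  set d := β / (4 * (1 + β)) with hd
  have hd0 : 0 < d := by positivity
  have hβr : β * r ≤ β := mul_le_of_le_one_right hβ.le (by linarith)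
  have h6 : d * r * (β / 2 * r + 1) ≤ d * r * (1 + β) :=
    mul_le_mul_of_nonneg_left (by linarith) (by positivity)
  have h7 : d * r * (1 + β) = β / 4 * r := by
    rw [← h5]
    ring
  have h8 : 0 ≤ β * r := by positivity
  linarith

lemma exp_mul_le {b r : ℝ} (hb : 0 ≤ b) (hr : 0 ≤ r) (hr1 : r ≤ 1) :
    exp (b * r) ≤ 1 + b * exp b * r := by
  have h3 := add_one_le_exp (-(b * r))
  have h4 : exp (b * r) * exp (-(b * r)) = 1 := by
    rw [← exp_add]
    simp
  have h5 : exp (b * r) ≤ exp b := exp_le_exp.2 (mul_le_of_le_one_right hb hr1)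
  have h6 := mul_le_mul_of_nonneg_left h3 (exp_pos (b * r)).le
  have h7 : exp (b * r) * (b * r) ≤ exp b * (b * r) :=
    mul_le_mul_of_nonneg_right h5 (by positivity)
  linarith

set_option maxHeartbeats 1000000 in
theorem MemRbeta.hasLocalScale {h : ℝ → ℝ} {β : ℝ} (hβ : MemRbeta h β) :
    (∃ A : ℝ, MonotoneOn h (Ici A)) ∧ Tendsto h atTop atTop ∧
      HasLocalScale h (β / (4 * (1 + β))) (1 + 2 * β * exp (2 * β)) := by
  have hβ0 : 0 < β := hβ.1
  obtain ⟨X₀, hX1, hpos, hcont, hlog⟩ := hβ.exists_log_sub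
  have hmono : MonotoneOn h (Ici X₀) := fun x hx y hy hxy => by
    have h1 := (hlog x y hx hxy).1
    have h2 : log x ≤ log y := Real.log_le_log (by linarith [mem_Ici.1 hx]) hxy
    have h3 : log (h x) ≤ log (h y) := by
      have : 0 ≤ β / 2 * (log y - log x) := mul_nonneg (by positivity) (by linarith)
      linarith
    exact (Real.log_le_log_iff (hpos x hx) (hpos y hy)).1 h3
  have htend : Tendsto h atTop atTop := by
    have h1 : Tendsto (fun x => log (h x)) atTop atTop := by
      refine tendsto_atTop_mono' atTop (f₁ := fun x => β / 2 * log x +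
        (log (h X₀) - β / 2 * log X₀)) ?_ ?_
      · filter_upwards [eventually_ge_atTop X₀] with x hx
        have := (hlog X₀ x le_rfl hx).1
        linarith
      · exact tendsto_atTop_add_const_right _ _
          (Real.tendsto_log_atTop.const_mul_atTop (by positivity))
    refine (Real.tendsto_exp_atTop.comp h1).congr' ?_
    filter_upwards [eventually_ge_atTop X₀] with x hx
    simp [Real.exp_log (hpos x hx)]
  refine ⟨⟨X₀, hmono⟩, htend, fun B => ?_⟩
  set Y : ℝ := 2 * (|B| + X₀) with hY
  have hB0 := abs_nonneg B
  refine ⟨max (h Y) ((|B| + 2) ^ 2), fun t ht => ?_⟩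
  have ht1 : h Y ≤ t := (le_max_left _ _).trans ht
  have ht2 : (|B| + 2) ^ 2 ≤ t := (le_max_right _ _).trans ht
  have ht0 : 0 < t := lt_of_lt_of_le (by positivity) ht2
  obtain ⟨x₀, hx₀, hx₀t⟩ := exists_ge_eq_of_tendsto
    (hcont.mono (Ici_subset_Ici.2 (by linarith : X₀ ≤ Y))) htend ht1
  have hx0 : 0 < x₀ := by linarith
  set w : ℝ := √(x₀ * t) with hw
  have hwB : |B| + 2 ≤ w := by
    rw [hw]
    refine Real.le_sqrt_of_sq_le (ht2.trans ?_)
    exact le_mul_of_one_le_left ht0.le (by linarith)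
  have hw0 : 0 < w := by linarith
  have hww : w * w = x₀ * t := Real.mul_self_sqrt (by positivity)
  set r : ℝ := 1 / w with hr
  have hr0 : 0 < r := by positivity
  have hr2 : r ≤ 1 / 2 := by
    rw [hr]
    exact one_div_le_one_div_of_le (by norm_num) (by linarith)
  have hBr : B * r ≤ 1 := by
    rw [hr, mul_one_div, div_le_one hw0]
    linarith [le_abs_self B]
  set σ : ℝ := x₀ * r with hσ
  have hσ0 : 0 < σ := by positivity
  have hσinv : ∀ b : ℝ, b / σ = t * (b * r) := fun b => by
    rw [hσ, hr]
    field_simp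
    linear_combination b * hww
  have hσx : σ ≤ x₀ / 2 := by
    rw [hσ]
    nlinarith
  have hx₁ : X₀ + |B| ≤ x₀ - σ := by linarith
  have hx₂ : X₀ ≤ x₀ := by linarith
  have e₁ : log (x₀ - σ) = log x₀ + log (1 - r) := by
    rw [← Real.log_mul hx0.ne' (by linarith), hσ]
    ring_nf
  have e₂ : log (x₀ + σ) = log x₀ + log (1 + r) := by
    rw [← Real.log_mul hx0.ne' (by linarith), hσ]
    ring_nf
  obtain ⟨hl1, -⟩ := hlog (x₀ - σ) x₀ (by linarith) (by linarith)
  obtain ⟨hl2, hl3⟩ := hlog x₀ (x₀ + σ) hx₂ (by linarith)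
  rw [e₁, hx₀t] at hl1
  rw [e₂, hx₀t] at hl2 hl3
  have hexp : ∀ x ≥ X₀, h x = t * exp (log (h x) - log t) := fun x hx => by
    rw [exp_sub, Real.exp_log (hpos x hx), Real.exp_log ht0]
    field_simp
  have hlow : log (1 - r) ≤ -r := by
    have := Real.log_le_sub_one_of_pos (by linarith : 0 < 1 - r)
    linarith
  have hup : log (1 + r) ≤ r := by
    have := Real.log_le_sub_one_of_pos (by linarith : 0 < 1 + r)
    linarith
  have hup' : r / 2 ≤ log (1 + r) := by
    have h1 := Real.one_sub_inv_le_log_of_pos (by linarith : 0 < 1 + r)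
    have h2 : r / 2 ≤ 1 - (1 + r)⁻¹ := by
      rw [le_sub_iff_add_le, ← le_sub_iff_add_le', inv_le_iff_one_le_mul₀ (by linarith)]
      nlinarith
    linarith
  have hc4 : β / (4 * (1 + β)) ≤ β / 4 := by
    apply div_le_div_of_nonneg_left hβ0.le (by norm_num)
    linarith
  have hc1 : β / (4 * (1 + β)) ≤ 1 := by
    rw [div_le_one (by positivity)]
    linarith
  have hC0 : 0 ≤ 2 * β * exp (2 * β) := by positivity
  refine ⟨x₀ - σ, x₀, x₀ + σ, σ, hσ0, by linarith [le_abs_self B], by linarith, by linarith,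
    ?_, hx₀t, ?_, ?_, ?_, ?_, ?_, ?_⟩
  · rw [hexp (x₀ - σ) (by linarith), hσinv]
    have h1 : exp (log (h (x₀ - σ)) - log t) ≤ exp (-(β / 2 * r)) := by
      rw [exp_le_exp]
      have : β / 2 * log (1 - r) ≤ β / 2 * (-r) := mul_le_mul_of_nonneg_left hlow (by positivity)
      linarith
    have h2 := exp_neg_half_mul_le hβ0 hr0.le hr2
    have h3 := mul_le_mul_of_nonneg_left (h1.trans h2) ht0.le
    linarith
  · rw [hexp (x₀ + σ) (by linarith), hσinv]
    have h1 := add_one_le_exp (log (h (x₀ + σ)) - log t)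
    have h2 : β / (4 * (1 + β)) * r ≤ β / 4 * r := by gcongr
    have h3 : β / 2 * (r / 2) ≤ β / 2 * log (1 + r) := by gcongr
    have h4 : β / (4 * (1 + β)) * r + 1 ≤ exp (log (h (x₀ + σ)) - log t) := by linarith
    have h5 := mul_le_mul_of_nonneg_left h4 ht0.le
    linarith
  · rw [hexp (x₀ + σ) (by linarith), hσinv]
    have h1 : exp (log (h (x₀ + σ)) - log t) ≤ exp (2 * β * r) := by
      rw [exp_le_exp]
      have : 2 * β * log (1 + r) ≤ 2 * β * r := by gcongr
      linarith
    have h2 : exp (2 * β * r) ≤ 1 + (1 + 2 * β * exp (2 * β)) * r := by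
      have := exp_mul_le (by positivity : 0 ≤ 2 * β) hr0.le (by linarith)
      linarith
    have h3 := mul_le_mul_of_nonneg_left (h1.trans h2) ht0.le
    linarith
  · rw [add_sub_cancel_left]
    exact mul_le_of_le_one_left hσ0.le hc1
  · rw [add_sub_cancel_left]
    exact le_mul_of_one_le_left hσ0.le (by linarith)
  · rw [sub_sub_cancel]
    exact le_mul_of_one_le_left hσ0.le (by linarith)
  · rw [hσ]
    nlinarith

/-- A derivative that is strictly increasing has no jumps, so its generalized inverse is a
genuine right inverse. -/
lemma apply_geninv_eq {g h : ℝ → ℝ} (hg : ∀ x, HasDerivAt g (h x) x)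
    (hmono : StrictMonoOn h (Ici 0)) {u : ℝ} (hu : 0 < geninv h u) : h (geninv h u) = u := by
  set S : Set ℝ := {x : ℝ | u ≤ h x} with hS
  set z := geninv h u with hz
  have hne : S.Nonempty := by
    by_contra hne
    rw [not_nonempty_iff_eq_empty] at hne
    simp [hz, geninv, ← hS, hne] at hu
  have hbdd : BddBelow S := by
    by_contra hb
    rw [hz, geninv, ← hS, Real.sInf_of_not_bddBelow hb] at hu
    exact lt_irrefl _ hu
  have hlt : ∀ x < z, h x < u := fun x hx => not_le.1 fun hux =>
    notMem_of_lt_csInf hx hbdd hux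
  have hgt : ∀ x > z, u < h x := fun x hx => by
    obtain ⟨s, hs, hsx⟩ := exists_lt_of_csInf_lt hne hx
    have hs0 : 0 ≤ s := hu.le.trans (csInf_le hbdd hs)
    exact lt_of_le_of_lt hs (hmono hs0 (hs0.trans hsx.le) hsx)
  rcases lt_trichotomy (h z) u with hh | hh | hh
  · obtain ⟨x, hx, e⟩ := exists_hasDerivWithinAt_eq_of_gt_of_lt (by linarith : z ≤ z + 1)
      (fun x _ => (hg x).hasDerivWithinAt) (by linarith : h z < (h z + u) / 2)
      (by linarith [hgt (z + 1) (by linarith)])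
    linarith [hgt x hx.1]
  · exact hh
  · obtain ⟨x, hx, e⟩ := exists_hasDerivWithinAt_eq_of_gt_of_lt (by linarith : z - 1 ≤ z)
      (fun x _ => (hg x).hasDerivWithinAt) (by linarith [hlt (z - 1) (by linarith)])
      (by linarith : (h z + u) / 2 < h z)
    linarith [hlt x hx.2]

/-- If the logarithmic derivative `k` of `ψ` varies slowly on the scale of `t`, then `ψ'` is
comparable to `σ²` within distance `1 / σ` of `t`. -/
lemma deriv_comparable_of_log_deriv {ψ k : ℝ → ℝ} {U₀ t σ : ℝ} (hU : 0 < U₀)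
    (hder : ∀ u ≥ U₀, HasDerivAt ψ (ψ u * k u) u) (hψpos : ∀ u ≥ U₀, 0 < ψ u)
    (hkpos : ∀ u ≥ U₀, 0 < k u) (hkanti : AntitoneOn k (Ici U₀))
    (hkmono : MonotoneOn (fun u => u ^ 2 * k u) (Ici U₀)) (ht : 2 * U₀ ≤ t) (hσ : 0 < σ)
    (hσ2 : σ ^ 2 = ψ t * k t) (hσt : 1 / σ ≤ t / 2) (hkσ : 4 * k t ≤ σ) :
    ∀ v ∈ Icc (t - 1 / σ) (t + 1 / σ), U₀ ≤ v ∧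
      σ ^ 2 / (4 * exp 1) ≤ ψ v * k v ∧ ψ v * k v ≤ 4 * exp 1 * σ ^ 2 := by
  have ht0 : 0 < t := by linarith
  have hmem : ∀ v ∈ Icc (t - 1 / σ) (t + 1 / σ), t / 2 ≤ v ∧ v ≤ 2 * t := fun v hv =>
    ⟨by linarith [hv.1], by linarith [hv.2]⟩
  have hk4 : ∀ v, t / 2 ≤ v → v ≤ 2 * t → k t / 4 ≤ k v ∧ k v ≤ 4 * k t := by
    intro v h1 h2
    have hv : U₀ ≤ v := by linarith
    have a1 := hkanti (mem_Ici.2 (by linarith : U₀ ≤ t / 2)) hv h1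
    have a2 := hkanti hv (mem_Ici.2 (by linarith : U₀ ≤ 2 * t)) h2
    have b1 := hkmono (mem_Ici.2 (by linarith : U₀ ≤ t / 2)) (mem_Ici.2 (by linarith : U₀ ≤ t))
      (by linarith)
    have b2 := hkmono (mem_Ici.2 (by linarith : U₀ ≤ t)) (mem_Ici.2 (by linarith : U₀ ≤ 2 * t))
      (by linarith)
    have c1 : t ^ 2 * k (t / 2) ≤ t ^ 2 * (4 * k t) := by
      simp only at b1
      linarith
    have c2 : t ^ 2 * (k t) ≤ t ^ 2 * (4 * k (2 * t)) := by
      simp only at b2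
      linarith
    have d1 := le_of_mul_le_mul_left c1 (by positivity)
    have d2 := le_of_mul_le_mul_left c2 (by positivity)
    exact ⟨by linarith, by linarith⟩
  have hkt := hkpos t (by linarith)
  have hψt := hψpos t (by linarith)
  have hr : 0 < 1 / σ := by positivity
  have htmem : t ∈ Icc (t - 1 / σ) (t + 1 / σ) := ⟨by linarith, by linarith⟩
  intro v hv
  obtain ⟨hv1, hv2⟩ := hmem v hv
  have hvU : U₀ ≤ v := by linarith
  have hlog : |log (ψ v) - log (ψ t)| ≤ 1 := by
    have h1 := (convex_Icc (t - 1 / σ) (t + 1 / σ)).norm_image_sub_le_of_norm_hasDerivWithin_le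
      (f := fun u => log (ψ u)) (f' := k) (C := 4 * k t) (x := t) (y := v) (fun w hw => by
        obtain ⟨hw1, hw2⟩ := hmem w hw
        have hwU : U₀ ≤ w := by linarith
        have := (hder w hwU).log (hψpos w hwU).ne'
        rw [mul_div_cancel_left₀ _ (hψpos w hwU).ne'] at this
        exact this.hasDerivWithinAt) (fun w hw => by
        obtain ⟨hw1, hw2⟩ := hmem w hw
        rw [Real.norm_of_nonneg (hkpos w (by linarith)).le]
        exact (hk4 w hw1 hw2).2) htmem hv
    rw [Real.norm_eq_abs, Real.norm_eq_abs] at h1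
    have h2 : |v - t| ≤ 1 / σ := abs_le.2 ⟨by linarith [hv.1], by linarith [hv.2]⟩
    calc _ ≤ 4 * k t * |v - t| := h1
      _ ≤ σ * (1 / σ) := mul_le_mul hkσ h2 (abs_nonneg _) hσ.le
      _ = 1 := mul_one_div_cancel hσ.ne'
  have hψv := hψpos v hvU
  obtain ⟨l1, l2⟩ := abs_le.1 hlog
  have hup : ψ v ≤ exp 1 * ψ t := by
    rw [← Real.log_le_log_iff hψv (by positivity), Real.log_mul (exp_pos _).ne' hψt.ne',
      Real.log_exp]
    linarith
  have hlow : ψ t ≤ exp 1 * ψ v := by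
    rw [← Real.log_le_log_iff hψt (by positivity), Real.log_mul (exp_pos _).ne' hψv.ne',
      Real.log_exp]
    linarith
  obtain ⟨k1, k2⟩ := hk4 v hv1 hv2
  have hkv := hkpos v hvU
  refine ⟨hvU, ?_, ?_⟩
  · rw [hσ2, div_le_iff₀ (by positivity)]
    calc ψ t * k t ≤ (exp 1 * ψ v) * (4 * k v) :=
          mul_le_mul hlow (by linarith) hkt.le (by positivity)
      _ = _ := by ring
  · rw [hσ2]
    calc ψ v * k v ≤ (exp 1 * ψ t) * (4 * k t) := mul_le_mul hup k2 hkv.le (by positivity)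
      _ = _ := by ring

lemma hasLocalScale_of_inverse {h ψ k : ℝ → ℝ} {U₀ : ℝ} (hU : 0 < U₀)
    (hinv : ∀ u ≥ U₀, h (ψ u) = u)
    (hder : ∀ u ≥ U₀, HasDerivAt ψ (ψ u * k u) u) (hψpos : ∀ u ≥ U₀, 0 < ψ u)
    (hkpos : ∀ u ≥ U₀, 0 < k u) (hkanti : AntitoneOn k (Ici U₀))
    (hkmono : MonotoneOn (fun u => u ^ 2 * k u) (Ici U₀)) (hψ : Tendsto ψ atTop atTop)
    (hk : Tendsto (fun u => u ^ 2 * k u) atTop atTop) :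
    HasLocalScale h (1 / (4 * exp 1)) (4 * exp 1) := by
  intro B
  set e : ℝ := exp 1 with he
  have he1 : 1 ≤ e := by
    have := add_one_le_exp (1 : ℝ)
    linarith
  set N : ℝ := |B| + 8 * e with hN
  have hB := abs_nonneg B
  have hN0 : 0 < N := by linarith
  obtain ⟨T, hT⟩ := eventually_atTop.1 ((((eventually_ge_atTop (2 * U₀)).and
    (hψ.eventually_ge_atTop (2 * |B|))).and (hψ.eventually_ge_atTop (N ^ 2 * k U₀))).and
    ((hk.eventually_ge_atTop 4).and (hψ.eventually_ge_atTop 1)))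
  refine ⟨T, fun t ht => ?_⟩
  obtain ⟨⟨⟨ht1, ht2⟩, ht3⟩, ht4, ht5⟩ := hT t ht
  have htU : U₀ ≤ t := by linarith
  have ht0 : 0 < t := by linarith
  have hkt := hkpos t htU
  have hψt := hψpos t htU
  set σ := √(ψ t * k t) with hσdef
  have hσ : 0 < σ := by positivity
  have hσ2 : σ ^ 2 = ψ t * k t := Real.sq_sqrt (by positivity)
  have hkle : k t ≤ k U₀ := hkanti self_mem_Ici htU htU
  have hNk : N ^ 2 * k t ≤ ψ t := le_trans (by gcongr) ht3
  have hNσ : N * σ ≤ ψ t := by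
    refine (sq_le_sq₀ (by positivity) hψt.le).1 ?_
    rw [mul_pow, hσ2]
    calc N ^ 2 * (ψ t * k t) = ψ t * (N ^ 2 * k t) := by ring
      _ ≤ ψ t * ψ t := by gcongr
      _ = _ := by ring
  have hσt : 1 / σ ≤ t / 2 := by
    rw [div_le_iff₀ hσ]
    have : 2 ≤ t * σ := by
      refine (sq_le_sq₀ (by positivity) (by positivity)).1 ?_
      rw [mul_pow, hσ2]
      calc (2 : ℝ) ^ 2 ≤ t ^ 2 * k t := by linarith
        _ = t ^ 2 * k t * 1 := by ring
        _ ≤ t ^ 2 * k t * ψ t := by gcongr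
        _ = _ := by ring
    linarith
  have hkσ : 4 * k t ≤ σ := by
    refine (sq_le_sq₀ (by positivity) hσ.le).1 ?_
    rw [hσ2]
    have h16 : 16 * k t ≤ ψ t := le_trans (mul_le_mul_of_nonneg_right (by nlinarith) hkt.le) hNk
    nlinarith
  have hcomp := deriv_comparable_of_log_deriv hU hder hψpos hkpos hkanti hkmono ht1 hσ hσ2 hσt hkσ
  have hr : 0 < 1 / σ := by positivity
  have hinc : ∀ x y, t - 1 / σ ≤ x → y ≤ t + 1 / σ → y - x = 1 / σ →
      1 / (4 * e) * σ ≤ ψ y - ψ x ∧ ψ y - ψ x ≤ 4 * e * σ := by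
    intro x y hx hy hxy
    have hsub : Icc x y ⊆ Icc (t - 1 / σ) (t + 1 / σ) := Icc_subset_Icc hx hy
    obtain ⟨c, hc, ec⟩ := exists_hasDerivAt_eq_slope ψ (fun u => ψ u * k u)
      (by linarith : x < y)
      (fun z hz => (hder z (hcomp z (hsub hz)).1).continuousAt.continuousWithinAt)
      (fun z hz => hder z (hcomp z (hsub (Ioo_subset_Icc_self hz))).1)
    obtain ⟨-, c1, c2⟩ := hcomp c (hsub (Ioo_subset_Icc_self hc))
    rw [hxy, div_div_eq_mul_div, div_one] at ec
    rw [ec] at c1 c2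
    constructor
    · refine le_of_mul_le_mul_right (le_trans (le_of_eq ?_) c1) hσ
      ring
    · refine le_of_mul_le_mul_right (c2.trans (le_of_eq ?_)) hσ
      ring
  obtain ⟨i1, i2⟩ := hinc (t - 1 / σ) t le_rfl (by linarith) (by ring)
  obtain ⟨i3, i4⟩ := hinc t (t + 1 / σ) (by linarith) le_rfl (by ring)
  have hc0 : 0 < 1 / (4 * e) * σ := by positivity
  have hc1 : 1 / (4 * e) / σ ≤ 1 / σ := by
    refine div_le_div_of_nonneg_right ?_ hσ.le
    rw [div_le_one (by positivity)]
    linarith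
  have hC1 : 1 / σ ≤ 4 * e / σ := div_le_div_of_nonneg_right (by linarith) hσ.le
  have h₁ := hinv (t - 1 / σ) (hcomp _ ⟨le_rfl, by linarith⟩).1
  have h₂ := hinv (t + 1 / σ) (hcomp _ ⟨by linarith, le_rfl⟩).1
  have hBσ : B * σ ≤ |B| * σ := mul_le_mul_of_nonneg_right (le_abs_self B) hσ.le
  have heσ : 0 < e * σ := by positivity
  have hBσ0 : 0 ≤ |B| * σ := by positivity
  have hNσ' : |B| * σ + 8 * (e * σ) ≤ ψ t := by
    rw [hN] at hNσ
    linarith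
  exact ⟨ψ (t - 1 / σ), ψ t, ψ (t + 1 / σ), σ, hσ, by linarith [le_abs_self B], by linarith,
    by linarith, by linarith, hinv t htU, by linarith, by linarith, i3, i4, i2, by linarith⟩

theorem MemRinfty.hasLocalScale {g h : ℝ → ℝ} (hg : ∀ x, HasDerivAt g (h x) x)
    (hinf : MemRinfty h) :
    MonotoneOn h (Ici 0) ∧ Tendsto h atTop atTop ∧
      HasLocalScale h (1 / (4 * exp 1)) (4 * exp 1) := by
  obtain ⟨hmono, ε, ε', -, hε, -, hrep, hψ, hlim, -, η, hη, c, hc, hcη⟩ := hinf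
  have hεc : Continuous ε := continuous_iff_continuousAt.2 fun x => (hε x).continuousAt
  have hψpos : ∀ u ≥ 1, 0 < geninv h u := fun u hu => by
    rw [hrep u hu]
    exact exp_pos _
  have hinv : ∀ u ≥ 1, h (geninv h u) = u := fun u hu => apply_geninv_eq hg hmono (hψpos u hu)
  have htend : Tendsto h atTop atTop := by
    refine tendsto_atTop.2 fun b => ?_
    filter_upwards [eventually_ge_atTop (geninv h (max b 1))] with x hx
    have h1 := hψpos _ (le_max_right b 1)
    have h2 := hmono.monotoneOn (mem_Ici.2 h1.le) (mem_Ici.2 (h1.le.trans hx)) hx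
    rw [hinv _ (le_max_right b 1)] at h2
    exact (le_max_left _ _).trans h2
  refine ⟨hmono.monotoneOn, htend, ?_⟩
  have hlim1 : ∀ᶠ x in atTop, |x * ε' x / ε x| ≤ 1 := by
    have := hlim.abs
    rw [abs_zero] at this
    filter_upwards [this.eventually (gt_mem_nhds one_pos)] with x hx using hx.le
  obtain ⟨X, hX⟩ := eventually_atTop.1 (hcη.and hlim1)
  set U₀ : ℝ := max X 2 with hU₀
  have hU2 : ∀ u ≥ U₀, 2 ≤ u := fun u hu => (le_max_right _ _).trans hu
  have hεpos : ∀ u ≥ U₀, 0 < ε u := fun u hu => by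
    have h1 := hU2 u hu
    have h2 := lt_of_lt_of_le hc (hX u ((le_max_left _ _).trans hu)).1
    exact pos_of_mul_pos_right h2 (Real.rpow_nonneg (by linarith) _)
  have habs : ∀ u ≥ U₀, |u * ε' u| ≤ ε u := fun u hu => by
    have := (hX u ((le_max_left _ _).trans hu)).2
    rwa [abs_div, abs_of_pos (hεpos u hu), div_le_one (hεpos u hu)] at this
  have hsq : ∀ u ≥ U₀, u ^ 2 * (ε u / u) = u * ε u := fun u hu => by
    have := hU2 u hu
    field_simp
  have hmulmono : MonotoneOn (fun u => u * ε u) (Ici U₀) := by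
    have hd : ∀ u, HasDerivAt (fun u => u * ε u) (1 * ε u + u * ε' u) u := fun u =>
      (hasDerivAt_id' u).fun_mul (hε u)
    refine monotoneOn_of_hasDerivWithinAt_nonneg (convex_Ici _)
      (fun u _ => (hd u).continuousAt.continuousWithinAt)
      (fun u _ => (hd u).hasDerivWithinAt) fun u hu => ?_
    linarith [(abs_le.1 (habs u (interior_subset hu))).1]
  refine hasLocalScale_of_inverse (k := fun u => ε u / u) (ψ := geninv h)
    (lt_of_lt_of_le two_pos (hU2 U₀ le_rfl)) (fun u hu => hinv u (by linarith [hU2 u hu]))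
    (fun u hu => ?_) (fun u hu => hψpos u (by linarith [hU2 u hu]))
    (fun u hu => div_pos (hεpos u hu) (by linarith [hU2 u hu])) ?_
    (hmulmono.congr fun u hu => (hsq u hu).symm) hψ ?_
  · have hu2 := hU2 u hu
    have h1 : HasDerivAt (fun u => exp (∫ v in (1 : ℝ)..u, ε v / v))
        (exp (∫ v in (1 : ℝ)..u, ε v / v) * (ε u / u)) u :=
      (hasDerivAt_integral_div hεc (by linarith)).exp
    rw [← hrep u (by linarith)] at h1
    refine h1.congr_of_eventuallyEq ?_
    filter_upwards [Ioi_mem_nhds (by linarith : 1 < u)] with v hv using hrep v hv.le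
  · have hd : ∀ u ∈ Ici U₀, HasDerivAt (fun u => ε u / u) ((ε' u * u - ε u * 1) / u ^ 2) u :=
      fun u hu => (hε u).fun_div (hasDerivAt_id' u) (by linarith [hU2 u hu])
    refine antitoneOn_of_hasDerivWithinAt_nonpos (convex_Ici _)
      (fun u hu => (hd u hu).continuousAt.continuousWithinAt)
      (fun u hu => (hd u (interior_subset hu)).hasDerivWithinAt) fun u hu => ?_
    refine div_nonpos_of_nonpos_of_nonneg ?_ (by positivity)
    linarith [(abs_le.1 (habs u (interior_subset hu))).2]
  · have h1 : Tendsto (fun u : ℝ => c * u ^ (1 - η)) atTop atTop :=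
      (tendsto_rpow_atTop (by linarith [hη.2])).const_mul_atTop hc
    refine tendsto_atTop_mono' atTop ?_ h1
    filter_upwards [eventually_ge_atTop U₀] with u hu
    have hu0 : 0 < u := by linarith [hU2 u hu]
    rw [hsq u hu, Real.rpow_sub hu0, Real.rpow_one]
    have h2 := (hX u ((le_max_left _ _).trans hu)).1
    have h3 : 0 < u ^ η := Real.rpow_pos_of_pos hu0 η
    rw [mul_div_assoc', div_le_iff₀ h3]
    nlinarith

lemma MemFrakR.exists_hasLocalScale {g h : ℝ → ℝ} (hg : ∀ x, HasDerivAt g (h x) x)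
    (hmem : MemFrakR h) :
    ∃ c C A : ℝ, 0 < c ∧ 0 ≤ C ∧ MonotoneOn h (Ici A) ∧ Tendsto h atTop atTop ∧
      HasLocalScale h c C := by
  rcases hmem with ⟨β, hβ⟩ | hinf
  · obtain ⟨⟨A, hA⟩, hlim, hloc⟩ := hβ.hasLocalScale
    have := hβ.1
    exact ⟨_, _, A, by positivity, by positivity, hA, hlim, hloc⟩
  · obtain ⟨hA, hlim, hloc⟩ := hinf.hasLocalScale hg
    exact ⟨_, _, 0, by positivity, by positivity, hA, hlim, hloc⟩

lemma squeeze_zero_of_forall_pos {u : ℕ → ℝ} (h0 : ∀ n, 0 ≤ u n)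
    (h : ∀ η > 0, ∀ᶠ n in atTop, u n ≤ η) : Tendsto u atTop (𝓝 0) := by
  refine Metric.tendsto_nhds.2 fun η hη => ?_
  filter_upwards [h (η / 2) (half_pos hη)] with n hn
  rw [Real.dist_eq, sub_zero, abs_of_nonneg (h0 n)]
  linarith

/-- With `Y₁` distributed according to the conditional density
`p_{aₙ}` of `X₁` given `Sₙ = n aₙ` and `Rₙ = p_{aₙ}(Y₁)/π^{aₙ}(Y₁) - 1`, under the
growth condition `ψ(tₙ)²/√(n ψ'(tₙ)) → 0` one has, for every `δ > 0`,
`P_{aₙ}(|Rₙ| > δ/√n) → 0`: the conditional probability of the set where the relative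
error exceeds `δ/√n` tends to `0`. -/
theorem gibbs_principle_in_probability
    (p g q h : ℝ → ℝ) (c : ℝ) (hc : 0 < c)
    (hpdef : ∀ x ≥ (0:ℝ), p x = c * Real.exp (-(g x - q x)))
    (hpzero : ∀ x < (0:ℝ), p x = 0)
    (hpdens : (∫ x in Set.Ici (0:ℝ), p x) = 1)
    (hgpos : ∀ x ≥ (0:ℝ), 0 < g x)
    (hglim : Tendsto (fun x => g x / x) atTop atTop)
    (hgderiv : ∀ x, HasDerivAt g (h x) x)
    (hq : ∃ ϑ > (0:ℝ), ∀ᶠ x in atTop, ∀ v, |v - x| < ϑ * x → |q v| ≤ 1 / Real.sqrt (x * h x))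
    (hmem : MemFrakR h)
    (hPhi : ∀ t > (0:ℝ), IntegrableOn (fun x => Real.exp (t * x) * p x) (Set.Ici 0))
    (a tseq : ℕ → ℝ) (ha : Tendsto a atTop atTop)
    (htm : ∀ n, mFun p (tseq n) = a n)
    (hgrowth : Tendsto
      (fun n : ℕ => geninv h (tseq n) ^ 2 / Real.sqrt ((n : ℝ) * deriv (geninv h) (tseq n)))
      atTop (𝓝 0)) :
    ∀ δ > (0:ℝ),
      Tendsto
        (fun n : ℕ =>
          ∫ y in {y : ℝ | δ / Real.sqrt n < |condDensity p a n y / tilt p (tseq n) y - 1|},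
            condDensity p a n y)
        atTop (𝓝 0) := by
  obtain ⟨c', C', A₁, hc', hC', hmono, hlim, hloc⟩ := hmem.exists_hasLocalScale hgderiv
  have hppos : ∀ x, 0 ≤ x → 0 < p x := fun x hx => by
    rw [hpdef x hx]
    positivity
  have hpnn : ∀ x, 0 ≤ p x := fun x =>
    (lt_or_ge x 0).elim (fun hx => (hpzero x hx).ge) fun hx => (hppos x hx).le
  have hpi : Integrable p := by
    have h1 : IntegrableOn p (Ici 0) := by
      by_contra hni
      rw [integral_undef hni] at hpdens
      exact zero_ne_one hpdens
    rw [← integrableOn_univ, ← Iio_union_Ici (a := (0 : ℝ))]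
    exact (integrableOn_zero.congr_fun (fun x hx => (hpzero x hx).symm) measurableSet_Iio).union h1
  have hp1 : ∫ x, p x = 1 := by
    have := mgfFun_eq_integral hpzero 0
    simp only [mgfFun, zero_mul, exp_zero, one_mul] at this
    rw [← this, hpdens]
  obtain ⟨A₂, hA₂⟩ : ∃ A₂, ∀ x ≥ A₂, |q x| ≤ 1 := by
    obtain ⟨ϑ, hϑ, hq⟩ := hq
    refine eventually_atTop.1 ?_
    filter_upwards [hq, eventually_ge_atTop 1, hlim.eventually_ge_atTop 1] with x hx hx1 hhx
    refine (hx x (by simp only [sub_self, abs_zero]; positivity)).trans ?_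
    have : 1 ≤ √(x * h x) := Real.le_sqrt_of_sq_le (by nlinarith)
    exact div_le_one_of_le₀ this (Real.sqrt_nonneg _)
  obtain ⟨A₃, hA₃⟩ := eventually_atTop.1 (hlim.eventually_ge_atTop 0)
  set A : ℝ := max 0 (max A₁ (max A₂ A₃)) with hA
  have hAA₁ : A₁ ≤ A := (le_max_left _ _).trans (le_max_right _ _)
  have hAA₂ : A₂ ≤ A := (le_max_left _ _).trans ((le_max_right _ _).trans (le_max_right _ _))
  have hAA₃ : A₃ ≤ A := (le_max_right _ _).trans ((le_max_right _ _).trans (le_max_right _ _))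
  obtain ⟨M, C, T, hsplit⟩ := exists_splitDensity_tilt hc (le_max_left _ _ : 0 ≤ A) hpdef hpzero
    hpi hp1 hgderiv (fun x hx => hA₂ x (hAA₂.trans hx)) (hmono.mono (Ici_subset_Ici.2 hAA₁))
    (fun x hx => hA₃ x (hAA₃.trans hx)) hPhi hc' hC' hloc
  have hmean := (mFun_eq_integral_and_monotone hpnn hpzero hpi hPhi).1
  have htseq := tendsto_atTop_of_mFun hpnn hpzero hpi hPhi ha htm
  obtain ⟨hM, hC⟩ : 0 < M ∧ 0 ≤ C := by
    obtain ⟨f₁, f₂, σ, -, -, H, -⟩ := hsplit T le_rfl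
    exact ⟨H.pos, H.moment_nonneg⟩
  intro δ hδ
  refine squeeze_zero_of_forall_pos (fun n => integral_nonneg fun y => ?_) fun η hη => ?_
  · exact div_nonneg (mul_nonneg (hpnn y) (convPow_nonneg hpnn _ _)) (convPow_nonneg hpnn _ _)
  set K : ℝ := √(2 * (1 + C) / η) with hK
  have hK0 : 0 < K := by positivity
  have hKη : (1 + C) / K ^ 2 = η / 2 := by
    rw [hK, Real.sq_sqrt (by positivity)]
    field_simp
  obtain ⟨B, N₀, hB, hconv⟩ := SplitDensity.exists_convPow_sub_le M C K hM hC hK0.le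
  have hsqrt : Tendsto (fun n : ℕ => √(n : ℝ)) atTop atTop :=
    Real.tendsto_sqrt_atTop.comp tendsto_natCast_atTop_atTop
  have hBn : Tendsto (fun n : ℕ => B / n) atTop (𝓝 0) :=
    tendsto_const_nhds.div_atTop tendsto_natCast_atTop_atTop
  filter_upwards [htseq.eventually_ge_atTop T, eventually_ge_atTop N₀, eventually_ge_atTop 2,
    hsqrt.eventually_ge_atTop (B / δ), hBn.eventually (ge_mem_nhds (half_pos hη)),
    hBn.eventually (ge_mem_nhds one_pos)] with n hT hN h2 hδn hηn h1n
  obtain ⟨f₁, f₂, σ, hσ, hΦ, H, hf⟩ := hsplit (tseq n) hT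
  rw [← hmean, htm n] at hf
  have hBδ : B / n ≤ δ / √n := by
    have hn0 : (0 : ℝ) < n := by positivity
    have hs0 : 0 < √(n : ℝ) := Real.sqrt_pos.2 hn0
    rw [div_le_iff₀ hδ] at hδn
    rw [div_le_div_iff₀ hn0 hs0]
    calc B * √n ≤ √n * δ * √n := by gcongr
      _ = δ * (√n * √n) := by ring
      _ = δ * n := by rw [Real.mul_self_sqrt hn0.le]
  have := setIntegral_condDensity_le h2 hσ hΦ hpzero hppos H hf hK0 h1n hBδ
    (hconv f₁ f₂ H n hN)
  rw [hKη] at this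
  linarith
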